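/- arXiv:2109.04076 — 5 statements merged into one kernel-verified Lean document; each statement's English description precedes it below -/
import Mathlib

section
/- Let p be a prime, let n ≥ 3, and let L be a Lie ring of cardinality p^n that is nilpotent of class exactly n−1. Then p·L ⊆ L^{n−1}; that is, for every a ∈ L, the element p•a lies in the (n−1)st term of the lower central series of L. -/
/-- A Lie ring is nilpotent of class exactly `c`: `L^{c+1} = 0` and `L^c ≠ 0`.
(Here `LieModule.lowerCentralSeries ℤ α α k` is the `(k+1)`st term `α^{k+1}`
of the lower central series.) -/
def LieClassEq (α : Type*) [LieRing α] (c : ℕ) : Prop :=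
  LieModule.lowerCentralSeries ℤ α α c = ⊥ ∧ LieModule.lowerCentralSeries ℤ α α (c - 1) ≠ ⊥

/-- An abelian group of order `p ^ n` carries a strictly monotone length function on its
subgroups, with value `n` at `⊤`. -/
lemma exists_strictMono_length {p n : ℕ} (hp : p.Prime) {L : Type*} [AddCommGroup L]
    (hcard : Nat.card L = p ^ n) :
    ∃ ℓ : Submodule ℤ L → ℕ, StrictMono ℓ ∧ ℓ ⊤ = n := by
  have : Finite L := Nat.finite_of_card_ne_zero (hcard ▸ (pow_pos hp.pos n).ne')
  have hpow (S : Submodule ℤ L) : ∃ e, Nat.card S = p ^ e := by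
    have h : Nat.card S ∣ p ^ n := hcard ▸ S.toAddSubgroup.card_addSubgroup_dvd_card
    obtain ⟨e, -, he⟩ := (Nat.dvd_prime_pow hp).1 h
    exact ⟨e, he⟩
  choose ℓ hℓ using hpow
  refine ⟨ℓ, fun S T hST ↦ ?_, ?_⟩
  · have h : Nat.card S < Nat.card T :=
      Set.ncard_lt_ncard (s := (S : Set L)) (t := T) hST (Set.toFinite _)
    rw [hℓ, hℓ] at h
    exact (Nat.pow_lt_pow_iff_right hp.one_lt).1 h
  · refine Nat.pow_right_injective hp.two_le ?_
    simp only [← hℓ, ← hcard]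
    exact Nat.card_congr Submodule.topEquiv.toEquiv

/-- If `M ≤ N + ℤa` and bracketing with `a` sends `L` into a Lie submodule containing `[L, N]`,
then that Lie submodule contains `[L, M]`. -/
lemma lie_top_le_of_le_sup_span {L : Type*} [LieRing L] {M N P : LieSubmodule ℤ L L} {a : L}
    (hM : M.toSubmodule ≤ N.toSubmodule ⊔ Submodule.span ℤ {a})
    (hN : ⁅(⊤ : LieIdeal ℤ L), N⁆ ≤ P) (ha : ∀ x : L, ⁅x, a⁆ ∈ P) :
    ⁅(⊤ : LieIdeal ℤ L), M⁆ ≤ P := by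
  refine (LieSubmodule.lie_le_iff M P ⊤).2 fun x _ m hm ↦ ?_
  obtain ⟨d, hd, z, hz, rfl⟩ := Submodule.mem_sup.1 (hM hm)
  obtain ⟨j, rfl⟩ := Submodule.mem_span_singleton.1 hz
  rw [lie_add, lie_zsmul]
  exact add_mem (hN (LieSubmodule.lie_mem_lie (LieSubmodule.mem_top x) hd))
    (zsmul_mem (ha x) j)

/-- If `L` is cyclic modulo its derived ideal, the lower central series is stationary from the
derived ideal on. -/
lemma lowerCentralSeries_two_of_sup_span_eq_top {L : Type*} [LieRing L] {a : L}
    (h : (LieModule.lowerCentralSeries ℤ L L 1).toSubmodule ⊔ Submodule.span ℤ {a} = ⊤) :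
    LieModule.lowerCentralSeries ℤ L L 2 = LieModule.lowerCentralSeries ℤ L L 1 := by
  have hlcs (x d : L) (hd : d ∈ LieModule.lowerCentralSeries ℤ L L 1) :
      ⁅x, d⁆ ∈ LieModule.lowerCentralSeries ℤ L L 2 :=
    LieSubmodule.lie_mem_lie (LieSubmodule.mem_top x) hd
  refine le_antisymm (LieModule.antitone_lowerCentralSeries ℤ L L one_le_two) ?_
  refine lie_top_le_of_le_sup_span (M := ⊤) (h ▸ le_top) le_rfl fun x ↦ ?_
  obtain ⟨d, hd, z, hz, rfl⟩ := Submodule.mem_sup.1 (h ▸ Submodule.mem_top (x := x))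
  obtain ⟨j, rfl⟩ := Submodule.mem_span_singleton.1 hz
  rw [add_lie, zsmul_lie, lie_self, smul_zero, add_zero, ← lie_skew]
  exact neg_mem (hlcs a d hd)

/-- If `p • a ∉ N` in a group of exponent dividing `p ^ n`, then `a ∉ N + ℤ(p • a)`. -/
lemma notMem_sup_span_smul {p n : ℕ} {L : Type*} [AddCommGroup L] {N : Submodule ℤ L} {a : L}
    (hexp : p ^ n • a = 0) (ha : p • a ∉ N) : a ∉ N ⊔ Submodule.span ℤ {p • a} := by
  intro hmem
  obtain ⟨d, hd, z, hz, hdz⟩ := Submodule.mem_sup.1 hmem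
  obtain ⟨j, rfl⟩ := Submodule.mem_span_singleton.1 hz
  have hcop : IsCoprime (1 - j * p : ℤ) ((p : ℤ) ^ n) :=
    IsCoprime.pow_right ⟨1, j, by ring⟩
  obtain ⟨u, v, huv⟩ := hcop
  have hd' : (1 - j * p : ℤ) • a = d := by
    rw [sub_smul, one_smul, mul_smul, natCast_zsmul]
    exact sub_eq_of_eq_add hdz.symm
  have hexp' : ((p : ℤ) ^ n) • a = 0 := by
    rw [← hexp, ← natCast_zsmul, Nat.cast_pow]
  have haN : a = u • d := by
    calc a = (u * (1 - j * p) + v * (p : ℤ) ^ n) • a := by rw [huv, one_smul]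
      _ = u • d := by rw [add_smul, mul_smul, mul_smul, hd', hexp', smul_zero, add_zero]
  exact ha (N.toAddSubgroup.nsmul_mem (haN ▸ N.smul_mem u hd) p)

theorem pL_le_lcs (p n : ℕ) (hp : p.Prime) (hn : 3 ≤ n) (L : Type*) [LieRing L]
    (hcard : Nat.card L = p ^ n) (hclass : LieClassEq L (n - 1)) :
    ∀ a : L, p • a ∈ LieModule.lowerCentralSeries ℤ L L (n - 2) := by
  obtain ⟨hbot, hne⟩ := hclass
  obtain ⟨ℓ, hmono, htop⟩ := exists_strictMono_length hp hcard
  set D := LieModule.lowerCentralSeries ℤ L L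
  have hanti : Antitone D := LieModule.antitone_lowerCentralSeries ℤ L L
  have hsucc (i : ℕ) : D (i + 1) = ⁅(⊤ : LieIdeal ℤ L), D i⁆ :=
    LieModule.lowerCentralSeries_succ ℤ L L i
  have hstrict (k : ℕ) (hk : k + 2 ≤ n) : D (k + 1) ≠ D k := by
    intro h
    have hconst (m : ℕ) : D (k + m) = D k := by
      induction m with
      | zero => rfl
      | succ m ih =>
        rw [← add_assoc, hsucc, ih, ← hsucc, h]
    apply hne
    rw [← hbot]
    have h1 := hconst (n - 1 - 1 - k)
    have h2 := hconst (n - 1 - k)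
    rw [show k + (n - 1 - 1 - k) = n - 1 - 1 by omega] at h1
    rw [show k + (n - 1 - k) = n - 1 by omega] at h2
    rw [h1, h2]
  have hlt (k : ℕ) (hk : k + 2 ≤ n) : ℓ (D (k + 1)).toSubmodule < ℓ (D k).toSubmodule :=
    hmono (lt_of_le_of_ne (hanti k.le_succ) fun h ↦
      hstrict k hk (LieSubmodule.toSubmodule_injective h))
  have hnc (a : L) : (D 1).toSubmodule ⊔ Submodule.span ℤ {a} < ⊤ :=
    lt_top_iff_ne_top.2 fun h ↦
      hstrict 1 hn (lowerCentralSeries_two_of_sup_span_eq_top h)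
  have hlow (m : ℕ) (hm : m + 1 ≤ n) : m ≤ ℓ (D (n - 1 - m)).toSubmodule := by
    induction m with
    | zero => exact Nat.zero_le _
    | succ m ih =>
      have h := hlt (n - 1 - (m + 1)) (by omega)
      rw [show n - 1 - (m + 1) + 1 = n - 1 - m by omega] at h
      have := ih (by omega)
      omega
  have hsup_lt {N : Submodule ℤ L} {a : L} (ha : a ∉ N) : N < N ⊔ Submodule.span ℤ {a} :=
    left_lt_sup.2 fun h ↦ ha (h (Submodule.mem_span_singleton_self a))
  have hone : ℓ (D 1).toSubmodule + 2 ≤ n := by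
    obtain ⟨a, -, ha⟩ := SetLike.exists_of_lt
      (lt_of_le_of_lt (le_sup_left) (hnc 0))
    have h1 := hmono (hsup_lt ha)
    have h2 := hmono (hnc a)
    omega
  have hup (k : ℕ) (hk : k + 2 ≤ n) : ℓ (D (k + 1)).toSubmodule + (k + 2) ≤ n := by
    induction k with
    | zero => exact hone
    | succ k ih =>
      have := hlt (k + 1) (by omega)
      have := ih (by omega)
      omega
  suffices h : ∀ k, k + 3 ≤ n → ∀ a : L, p • a ∈ D (k + 1) by
    have := h (n - 3) (by omega)
    rwa [show n - 3 + 1 = n - 2 by omega] at this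
  intro k hk
  induction k with
  | zero =>
    intro a
    rw [zero_add]
    by_contra ha
    have hexp : p ^ n • a = 0 := hcard ▸ card_nsmul_eq_zero'
    have h1 := hmono (hsup_lt ha)
    have h2 := hmono (hsup_lt (notMem_sup_span_smul hexp ha))
    have h3 : (D 1).toSubmodule ⊔ Submodule.span ℤ {p • a} ⊔ Submodule.span ℤ {a} ≤
        (D 1).toSubmodule ⊔ Submodule.span ℤ {a} := by
      refine sup_le (sup_le_sup_left ?_ _) le_sup_right
      rw [Submodule.span_singleton_le_iff_mem]
      exact Submodule.smul_of_tower_mem _ p (Submodule.mem_span_singleton_self a)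
    have h4 := hmono (lt_of_le_of_lt h3 (hnc a))
    have h5 := hlow (n - 2) (by omega)
    rw [show n - 1 - (n - 2) = 1 by omega] at h5
    omega
  | succ k ih =>
    replace ih := ih (by omega)
    intro a
    by_contra ha
    have hsup : (D (k + 1)).toSubmodule =
        (D (k + 1 + 1)).toSubmodule ⊔ Submodule.span ℤ {p • a} := by
      have hle : (D (k + 1 + 1)).toSubmodule ⊔ Submodule.span ℤ {p • a} ≤
          (D (k + 1)).toSubmodule :=
        sup_le (hanti (k + 1).le_succ) ((Submodule.span_singleton_le_iff_mem _ _).2 (ih a))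
      by_contra hne'
      have h1 := hmono (hsup_lt ha)
      have h2 := hmono (lt_of_le_of_ne hle (Ne.symm hne'))
      have h3 := hup k (by omega)
      have h4 := hlow (n - 3 - k) (by omega)
      rw [show n - 1 - (n - 3 - k) = k + 1 + 1 by omega] at h4
      omega
    refine hstrict (k + 1 + 1) (by omega) (le_antisymm (hanti (Nat.le_succ _)) ?_)
    rw [hsucc (k + 1)]
    refine lie_top_le_of_le_sup_span hsup.le (hsucc (k + 1 + 1)).ge fun x ↦ ?_
    obtain ⟨d, hd, z, hz, hdz⟩ := Submodule.mem_sup.1 (hsup.le (ih x))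
    obtain ⟨j, rfl⟩ := Submodule.mem_span_singleton.1 hz
    rw [lie_nsmul, ← nsmul_lie, ← hdz, add_lie, zsmul_lie, nsmul_lie, lie_self, smul_zero,
      smul_zero, add_zero, ← lie_skew]
    exact neg_mem ((hsucc (k + 1 + 1)).ge
      (LieSubmodule.lie_mem_lie (LieSubmodule.mem_top a) hd))
end

section
/- Let p be a prime, let n ≥ 3, and let L be a Lie ring of cardinality p^n that is nilpotent of class exactly n−1. Then the quotient L/L² (where L² = [L, L]) is an elementary abelian Lie ring of cardinality p²: it has trivial Lie bracket, every element is killed by p, and its cardinality is p². -/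
open LieModule in
theorem lowerCentralSeries_eq_of_succ_eq {R L M : Type*} [CommRing R] [LieRing L] [LieAlgebra R L]
    [AddCommGroup M] [Module R M] [LieRingModule L M] {k : ℕ}
    (h : lowerCentralSeries R L M (k + 1) = lowerCentralSeries R L M k) {m : ℕ} (hm : k ≤ m) :
    lowerCentralSeries R L M m = lowerCentralSeries R L M k := by
  induction m, hm using Nat.le_induction with
  | base => rfl
  | succ m _ ih => rw [lowerCentralSeries_succ, ih, ← lowerCentralSeries_succ, h]

open LieModule in
theorem lowerCentralSeries_two_eq_one_of_isAddCyclic {L : Type*} [LieRing L]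
    (h : IsAddCyclic (L ⧸ lowerCentralSeries ℤ L L 1)) :
    lowerCentralSeries ℤ L L 2 = lowerCentralSeries ℤ L L 1 := by
  refine le_antisymm (antitone_lowerCentralSeries ℤ L L one_le_two) ?_
  obtain ⟨q, hq⟩ := h.exists_zsmul_surjective
  obtain ⟨g, rfl⟩ := LieSubmodule.Quotient.surjective_mk' _ q
  have key : ∀ x : L, ∃ a : ℤ, x - a • g ∈ lowerCentralSeries ℤ L L 1 := fun x ↦ by
    obtain ⟨a, ha⟩ := hq (LieSubmodule.Quotient.mk' _ x)
    refine ⟨a, ?_⟩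
    rw [← LieSubmodule.Quotient.mk_eq_zero, map_sub, map_zsmul, sub_eq_zero]
    exact ha.symm
  have hmem : ∀ x : L, ∀ u ∈ lowerCentralSeries ℤ L L 1, ⁅x, u⁆ ∈ lowerCentralSeries ℤ L L 2 :=
    fun x u hu ↦ LieSubmodule.lie_mem_lie (LieSubmodule.mem_top x) hu
  rw [show lowerCentralSeries ℤ L L 1 = ⁅(⊤ : LieIdeal ℤ L), (⊤ : LieSubmodule ℤ L L)⁆ from rfl,
    LieSubmodule.lie_le_iff]
  intro x _ y _
  obtain ⟨a, ha⟩ := key x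
  obtain ⟨b, hb⟩ := key y
  have e : ⁅x, y⁆ = ⁅x, y - b • g⁆ - b • ⁅g, x - a • g⁆ := by
    simp only [lie_sub, lie_zsmul, lie_self, smul_zero, sub_zero]
    rw [← lie_skew x g, smul_neg]
    abel
  rw [e]
  exact sub_mem (hmem _ _ hb) (zsmul_mem (hmem _ _ ha) b)

theorem AddSubgroup.mul_card_le_card_of_lt {G : Type*} [AddGroup G] {p n : ℕ} (hp : p.Prime)
    (hcard : Nat.card G = p ^ n) {H K : AddSubgroup G} (h : H < K) :
    p * Nat.card H ≤ Nat.card K := by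
  have : Finite G := Nat.finite_of_card_ne_zero (hcard ▸ pow_ne_zero n hp.ne_zero)
  obtain ⟨a, -, ha⟩ := (Nat.dvd_prime_pow hp).1 (hcard ▸ H.card_addSubgroup_dvd_card)
  obtain ⟨b, -, hb⟩ := (Nat.dvd_prime_pow hp).1 (hcard ▸ K.card_addSubgroup_dvd_card)
  have hlt : Nat.card H < Nat.card K :=
    Set.Finite.card_lt_card (Set.toFinite (K : Set G)) (SetLike.coe_ssubset_coe.2 h)
  rw [ha, hb] at hlt ⊢
  rw [← pow_succ']
  exact Nat.pow_le_pow_right hp.pos ((Nat.pow_lt_pow_iff_right hp.one_lt).1 hlt)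

open LieModule in
/-- In a nilpotent Lie ring of `p`-power order, the lower central series drops by a factor of
at least `p` at each step. -/
theorem pow_le_card_lowerCentralSeries {L : Type*} [LieRing L] {p n c : ℕ} (hp : p.Prime)
    (hcard : Nat.card L = p ^ n) (hc : lowerCentralSeries ℤ L L (c + 1) = ⊥)
    (hc' : lowerCentralSeries ℤ L L c ≠ ⊥) {j k : ℕ} (h : j + k = c + 1) :
    p ^ j ≤ Nat.card (lowerCentralSeries ℤ L L k) := by
  have : Finite L := Nat.finite_of_card_ne_zero (hcard ▸ pow_ne_zero n hp.ne_zero)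
  induction j generalizing k with
  | zero => exact (pow_zero p).trans_le Nat.card_pos
  | succ j ih =>
    rw [pow_succ']
    refine (Nat.mul_le_mul_left p (ih (k := k + 1) (by omega))).trans ?_
    refine AddSubgroup.mul_card_le_card_of_lt hp hcard
      (H := (lowerCentralSeries ℤ L L (k + 1)).toAddSubgroup)
      (K := (lowerCentralSeries ℤ L L k).toAddSubgroup) ?_
    have hlt : lowerCentralSeries ℤ L L (k + 1) < lowerCentralSeries ℤ L L k := by
      refine lt_of_le_of_ne (antitone_lowerCentralSeries ℤ L L k.le_succ) fun he ↦ hc' ?_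
      rw [lowerCentralSeries_eq_of_succ_eq he (by omega : k ≤ c),
        ← lowerCentralSeries_eq_of_succ_eq he (by omega : k ≤ c + 1), hc]
    exact hlt

theorem quotient_by_derived_elementary_abelian (p n : ℕ) (hp : p.Prime) (hn : 3 ≤ n)
    (L : Type*) [LieRing L] (hcard : Nat.card L = p ^ n) (hclass : LieClassEq L (n - 1)) :
    (∀ x y : L ⧸ LieModule.lowerCentralSeries ℤ L L 1, ⁅x, y⁆ = 0) ∧
    (∀ x : L ⧸ LieModule.lowerCentralSeries ℤ L L 1, p • x = 0) ∧
    Nat.card (L ⧸ LieModule.lowerCentralSeries ℤ L L 1) = p ^ 2 := by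
  obtain ⟨hc, hc'⟩ := hclass
  obtain ⟨c, rfl⟩ : ∃ c, n = c + 3 := ⟨n - 3, by omega⟩
  replace hc : LieModule.lowerCentralSeries ℤ L L (c + 1 + 1) = ⊥ := hc
  replace hc' : LieModule.lowerCentralSeries ℤ L L (c + 1) ≠ ⊥ := hc'
  have : Fact p.Prime := ⟨hp⟩
  have hcyc : ¬ IsAddCyclic (L ⧸ LieModule.lowerCentralSeries ℤ L L 1) := fun h ↦ by
    have he := lowerCentralSeries_two_eq_one_of_isAddCyclic h
    exact hc' <| (lowerCentralSeries_eq_of_succ_eq he (by omega)).trans <|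
      (lowerCentralSeries_eq_of_succ_eq he (by omega)).symm.trans hc
  have hmul : Nat.card L = Nat.card (L ⧸ LieModule.lowerCentralSeries ℤ L L 1) *
      Nat.card (LieModule.lowerCentralSeries ℤ L L 1) :=
    AddSubgroup.card_eq_card_quotient_mul_card_addSubgroup
      (LieModule.lowerCentralSeries ℤ L L 1).toAddSubgroup
  have hle : p ^ (c + 1) ≤ Nat.card (LieModule.lowerCentralSeries ℤ L L 1) :=
    pow_le_card_lowerCentralSeries hp hcard hc hc' rfl
  rw [hcard] at hmul
  obtain ⟨k, -, hk⟩ := (Nat.dvd_prime_pow hp).1 (Dvd.intro _ hmul.symm)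
  have hk2 : k ≤ 2 := by
    have h := (Nat.mul_le_mul_left (p ^ k) hle).trans_eq (hk ▸ hmul.symm)
    rw [← pow_add, Nat.pow_le_pow_iff_right hp.one_lt] at h
    omega
  obtain rfl : k = 2 := by
    by_contra hne
    refine hcyc ?_
    obtain rfl | rfl : k = 0 ∨ k = 1 := by omega
    · have := (Nat.card_eq_one_iff_unique.1 (hk.trans (pow_zero p))).1
      infer_instance
    · exact isAddCyclic_of_prime_card (hk.trans (pow_one p))
  refine ⟨fun x y ↦ ?_, fun x ↦ ?_, hk⟩
  · obtain ⟨x, rfl⟩ := LieSubmodule.Quotient.surjective_mk' _ x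
    obtain ⟨y, rfl⟩ := LieSubmodule.Quotient.surjective_mk' _ y
    exact (LieSubmodule.Quotient.mk_eq_zero _ (m := ⁅x, y⁆)).2
      (LieSubmodule.lie_mem_lie (LieSubmodule.mem_top x) (LieSubmodule.mem_top y))
  · obtain ⟨j, hj, hx⟩ := (Nat.dvd_prime_pow hp).1 (hk ▸ addOrderOf_dvd_natCard x)
    have hj2 : j ≠ 2 := by
      rintro rfl
      have : Finite (L ⧸ LieModule.lowerCentralSeries ℤ L L 1) :=
        Nat.finite_of_card_ne_zero (hk ▸ pow_ne_zero 2 hp.ne_zero)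
      exact hcyc (isAddCyclic_of_addOrderOf_eq_card x (hx.trans hk.symm))
    rw [← addOrderOf_dvd_iff_nsmul_eq_zero, hx]
    simpa using pow_dvd_pow p (by omega : j ≤ 1)
end

section
/- Let p be a prime, let n ≥ 3, and let L be a Lie ring of cardinality p^n that is nilpotent of class exactly n−1. Then for every i with 2 ≤ i ≤ n−1, the quotient L^i/L^{i+1} of consecutive terms of the lower central series has cardinality exactly p; equivalently, L^i has cardinality p^{n−i} for 2 ≤ i ≤ n. -/
open LieModule

section LowerCentralSeries

variable {R L M : Type*} [CommRing R] [LieRing L] [LieAlgebra R L]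
  [AddCommGroup M] [Module R M] [LieRingModule L M]

/-- Once two consecutive terms of the lower central series agree, it is constant. -/
theorem lowerCentralSeries_add_eq_of_succ_eq {k : ℕ}
    (h : lowerCentralSeries R L M (k + 1) = lowerCentralSeries R L M k) (j : ℕ) :
    lowerCentralSeries R L M (k + j) = lowerCentralSeries R L M k := by
  induction j with
  | zero => rfl
  | succ j ih => rw [← add_assoc, lowerCentralSeries_succ, ih, ← lowerCentralSeries_succ, h]

/-- Below the vanishing index of the lower central series, all inclusions are strict. -/
theorem lowerCentralSeries_succ_lt {k c : ℕ} (hkc : k < c)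
    (hc : lowerCentralSeries R L M c = ⊥) (hc' : lowerCentralSeries R L M (c - 1) ≠ ⊥) :
    lowerCentralSeries R L M (k + 1) < lowerCentralSeries R L M k := by
  refine lt_of_le_of_ne (antitone_lowerCentralSeries R L M k.le_succ) fun h => hc' ?_
  have h1 := lowerCentralSeries_add_eq_of_succ_eq h (c - 1 - k)
  have h2 := lowerCentralSeries_add_eq_of_succ_eq h (c - k)
  rw [show k + (c - 1 - k) = c - 1 by lia] at h1
  rw [show k + (c - k) = c by lia] at h2
  rw [h1, ← h2, hc]

end LowerCentralSeries

/-- If a Lie algebra is spanned by one element modulo its derived ideal, then the second and third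
terms of the lower central series agree. -/
theorem lowerCentralSeries_two_eq_one_of_span_singleton {R L : Type*} [CommRing R] [LieRing L]
    [LieAlgebra R L] (x : L) (hx : ∀ y : L, ∃ a : R, y - a • x ∈ lowerCentralSeries R L L 1) :
    lowerCentralSeries R L L 2 = lowerCentralSeries R L L 1 := by
  refine le_antisymm (antitone_lowerCentralSeries R L L one_le_two) ?_
  have key (u v : L) (hv : v ∈ lowerCentralSeries R L L 1) :
      ⁅u, v⁆ ∈ lowerCentralSeries R L L 2 := by
    rw [lowerCentralSeries_succ R L L 1]
    exact LieSubmodule.lie_mem_lie (LieSubmodule.mem_top u) hv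
  rw [lowerCentralSeries_succ R L L 0, LieSubmodule.lie_le_iff]
  rintro y - z -
  obtain ⟨a, ha⟩ := hx y
  obtain ⟨b, hb⟩ := hx z
  have h : ⁅y, z⁆ = ⁅y, z - b • x⁆ - ⁅b • x, y - a • x⁆ := by
    rw [lie_sub, lie_sub, ← lie_skew (b • x) y]
    simp
  rw [h]
  exact sub_mem (key _ _ hb) (key _ _ ha)

/-- An additive group is generated by one element modulo a subgroup of prime index. -/
theorem AddSubgroup.exists_sub_zsmul_mem_of_index_prime {A : Type*} [AddCommGroup A]
    (H : AddSubgroup A) (h : H.index.Prime) : ∃ x : A, ∀ y : A, ∃ a : ℤ, y - a • x ∈ H := by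
  have : Fact H.index.Prime := ⟨h⟩
  obtain ⟨g, hg⟩ := (isAddCyclic_of_prime_card (α := A ⧸ H) (p := H.index) rfl).exists_generator
  obtain ⟨x, rfl⟩ := QuotientAddGroup.mk_surjective g
  refine ⟨x, fun y => ?_⟩
  obtain ⟨a, ha⟩ := AddSubgroup.mem_zmultiples_iff.1 (hg y)
  refine ⟨a, ?_⟩
  rw [← QuotientAddGroup.eq_zero_iff, QuotientAddGroup.mk_sub, QuotientAddGroup.mk_zsmul, ha,
    sub_self]

/-- In a Lie ring of order `p ^ n` in which the second and third terms of the lower central series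
differ, the second term has index at least `p ^ 2`. -/
theorem add_two_le_of_card_lowerCentralSeries_one {p n e : ℕ} (hp : p.Prime) {L : Type*}
    [LieRing L] (hcard : Nat.card L = p ^ n)
    (he : Nat.card (lowerCentralSeries ℤ L L 1) = p ^ e) (hen : e < n)
    (h21 : lowerCentralSeries ℤ L L 2 ≠ lowerCentralSeries ℤ L L 1) : e + 2 ≤ n := by
  by_contra hlt
  obtain rfl : n = e + 1 := by lia
  set H := (lowerCentralSeries ℤ L L 1).toSubmodule.toAddSubgroup
  have hH : p ^ e * H.index = p ^ e * p := by
    rw [← pow_succ, ← hcard, ← he]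
    exact H.card_mul_index
  have hi : H.index = p := Nat.eq_of_mul_eq_mul_left (pow_pos hp.pos e) hH
  obtain ⟨x, hx⟩ := H.exists_sub_zsmul_mem_of_index_prime (hi ▸ hp)
  exact h21 (lowerCentralSeries_two_eq_one_of_span_singleton x hx)

/-- A Lie ring of order `p ^ n` and class `n - 1` has lower central series of the expected
orders. -/
theorem LieClassEq.card_lowerCentralSeries {p n : ℕ} (hp : p.Prime) (hn : 3 ≤ n) {L : Type*}
    [LieRing L] (hcard : Nat.card L = p ^ n) (hclass : LieClassEq L (n - 1)) {k : ℕ}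
    (hk : 1 ≤ k) (hkn : k ≤ n - 1) : Nat.card (lowerCentralSeries ℤ L L k) = p ^ (n - 1 - k) := by
  have : Finite L := Nat.finite_of_card_ne_zero (hcard ▸ (pow_pos hp.pos n).ne')
  have hdvd (k : ℕ) : ∃ e ≤ n, Nat.card (lowerCentralSeries ℤ L L k) = p ^ e := by
    rw [← Nat.dvd_prime_pow hp, ← hcard]
    exact (lowerCentralSeries ℤ L L k).toSubmodule.toAddSubgroup.card_addSubgroup_dvd_card
  choose e _ he using hdvd
  have hstep (k : ℕ) (hk : k < n - 1) :
      lowerCentralSeries ℤ L L (k + 1) < lowerCentralSeries ℤ L L k :=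
    lowerCentralSeries_succ_lt hk hclass.1 hclass.2
  have hlt (k : ℕ) (hk : k < n - 1) : e (k + 1) < e k := by
    rw [← Nat.pow_lt_pow_iff_right hp.one_lt, ← he, ← he]
    exact Set.ncard_lt_ncard (SetLike.coe_ssubset_coe.2 (hstep k hk)) (Set.toFinite _)
  have he0 : e 0 = n := by
    apply Nat.pow_right_injective hp.two_le
    change p ^ e 0 = p ^ n
    rw [← he, ← hcard]
    exact Nat.card_congr (Equiv.Set.univ L)
  have he1 : e 1 + 2 ≤ n :=
    add_two_le_of_card_lowerCentralSeries_one hp hcard (he 1) (he0 ▸ hlt 0 (by lia))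
      (hstep 1 (by lia)).ne
  have hupper : ∀ k, 1 ≤ k → k ≤ n - 1 → e k + k ≤ n - 1 := by
    intro k hk
    induction k, hk using Nat.le_induction with
    | base => lia
    | succ k hk ih => intro h; have := hlt k h; have := ih (by lia); lia
  have hlower : ∀ j ≤ n - 1, j ≤ e (n - 1 - j) := by
    intro j
    induction j with
    | zero => lia
    | succ j ih =>
      intro h
      have h1 := hlt (n - 1 - (j + 1)) (by lia)
      rw [show n - 1 - (j + 1) + 1 = n - 1 - j by lia] at h1
      have := ih (by lia)
      lia
  have h1 := hupper k hk hkn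
  have h2 := hlower (n - 1 - k) (by lia)
  rw [show n - 1 - (n - 1 - k) = k by lia] at h2
  rw [he, show e k = n - 1 - k by lia]

/-- For a Lie ring of order `p^n` of maximal class, each quotient `L^i / L^{i+1}`
of consecutive terms of the lower central series (for `2 ≤ i ≤ n-1`) has cardinality
`p`; equivalently `L^i` has cardinality `p^(n-i)` for `2 ≤ i ≤ n`.
(Here `L^i` is `LieModule.lowerCentralSeries ℤ L L (i-1)`.) -/
theorem lcs_factors_card (p n : ℕ) (hp : p.Prime) (hn : 3 ≤ n)
    (L : Type*) [LieRing L] (hcard : Nat.card L = p ^ n) (hclass : LieClassEq L (n - 1)) :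
    (∀ i : ℕ, 2 ≤ i → i ≤ n - 1 →
      Nat.card ((LieModule.lowerCentralSeries ℤ L L (i - 1) : LieSubmodule ℤ L L) ⧸
        ((LieModule.lowerCentralSeries ℤ L L i : LieSubmodule ℤ L L).toSubmodule.comap
          (LieModule.lowerCentralSeries ℤ L L (i - 1) :
            LieSubmodule ℤ L L).toSubmodule.subtype)) = p) ∧
    (∀ i : ℕ, 2 ≤ i → i ≤ n →
      Nat.card (LieModule.lowerCentralSeries ℤ L L (i - 1) : LieSubmodule ℤ L L) =
        p ^ (n - i)) := by
  refine ⟨fun i hi hin => ?_, fun i hi hin => ?_⟩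
  · have h1 := hclass.card_lowerCentralSeries hp hn hcard (k := i - 1) (by lia) (by lia)
    have h2 := hclass.card_lowerCentralSeries hp hn hcard (k := i) (by lia) hin
    have hle : lowerCentralSeries ℤ L L i ≤ lowerCentralSeries ℤ L L (i - 1) :=
      antitone_lowerCentralSeries ℤ L L (Nat.sub_le i 1)
    have h3 := Submodule.card_eq_card_quotient_mul_card
      ((lowerCentralSeries ℤ L L i).toSubmodule.comap
        (lowerCentralSeries ℤ L L (i - 1)).toSubmodule.subtype)
    rw [Nat.card_congr (Submodule.comapSubtypeEquivOfLe
      ((LieSubmodule.toSubmodule_le_toSubmodule _ _).2 hle)).toEquiv] at h3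
    refine Nat.eq_of_mul_eq_mul_left (pow_pos hp.pos (n - 1 - i)) ?_
    rw [← pow_succ, show n - 1 - i + 1 = n - 1 - (i - 1) by lia, ← h1, ← h2]
    exact h3.symm
  · rw [hclass.card_lowerCentralSeries hp hn hcard (k := i - 1) (by lia) (by lia),
      show n - 1 - (i - 1) = n - i by lia]
end

section
/- For every prime p ≥ 5, the number of isomorphism classes of Lie rings M of cardinality p^7 that are nilpotent of class exactly 6 and satisfy p•x = 0 for all x ∈ M (i.e., of maximal class and characteristic p) equals p + 8. -/
/-- An isomorphism between two Lie rings (Lie algebras over `ℤ`) exists. -/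
def IsLieIso (α β : Type*) [LieRing α] [LieRing β] : Prop :=
  ∃ e : α ≃ β, (∀ x y, e (x + y) = e x + e y) ∧ (∀ x y, e ⁅x, y⁆ = ⁅e x, e y⁆)

/-- A Lie ring has characteristic `p`: every element is killed by `p`. -/
def LieCharP (α : Type*) [LieRing α] (p : ℕ) : Prop :=
  ∀ x : α, p • x = 0

namespace IsLieIso

variable {L L' L'' : Type*} [LieRing L] [LieRing L'] [LieRing L'']

lemma refl (L : Type*) [LieRing L] : IsLieIso L L :=
  ⟨Equiv.refl L, fun _ _ => rfl, fun _ _ => rfl⟩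

lemma symm (h : IsLieIso L L') : IsLieIso L' L := by
  obtain ⟨e, hadd, hlie⟩ := h
  refine ⟨e.symm, fun x y => e.injective ?_, fun x y => e.injective ?_⟩
  · simp [hadd]
  · simp [hlie]

lemma trans (h : IsLieIso L L') (h' : IsLieIso L' L'') : IsLieIso L L'' := by
  obtain ⟨e, hadd, hlie⟩ := h
  obtain ⟨e', hadd', hlie'⟩ := h'
  exact ⟨e.trans e', fun x y => by simp [hadd, hadd'], fun x y => by simp [hlie, hlie']⟩

end IsLieIso

section FiliformModel

variable {F : Type*} [Field F]

/-- The Lie algebra with basis `x, y₁, …, y₆` and nonzero brackets `⁅x, yᵢ⁆ = yᵢ₊₁`,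
`⁅y₁, y₂⁆ = α y₄ + β y₅ + γ y₆`, `⁅y₁, y₃⁆ = α y₅ + β y₆`, `⁅y₁, y₄⁆ = (α - δ) y₆` and
`⁅y₂, y₃⁆ = δ y₆`, in coordinates. -/
@[nolint unusedArguments]
def FiliformModel (_α _β _γ _δ : F) : Type _ := Fin 7 → F

namespace FiliformModel

variable (α β γ δ : F)

instance : AddCommGroup (FiliformModel α β γ δ) := inferInstanceAs (AddCommGroup (Fin 7 → F))

instance : Module F (FiliformModel α β γ δ) := inferInstanceAs (Module F (Fin 7 → F))

instance : Module.Finite F (FiliformModel α β γ δ) :=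
  inferInstanceAs (Module.Finite F (Fin 7 → F))

lemma finrank_eq : Module.finrank F (FiliformModel α β γ δ) = 7 :=
  Module.finrank_fin_fun F

variable {α β γ δ}

/-- The vector with the given coordinates. -/
def mk (v : Fin 7 → F) : FiliformModel α β γ δ := v

/-- The `i`-th coordinate. -/
def coord (u : FiliformModel α β γ δ) (i : Fin 7) : F := u i

omit [Field F] in
@[simp] lemma coord_mk (v : Fin 7 → F) (i : Fin 7) :
    (mk v : FiliformModel α β γ δ).coord i = v i := rfl

@[simp] lemma coord_add (u v : FiliformModel α β γ δ) (i : Fin 7) :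
    (u + v).coord i = u.coord i + v.coord i := rfl

@[simp] lemma coord_smul (c : F) (u : FiliformModel α β γ δ) (i : Fin 7) :
    (c • u).coord i = c * u.coord i := rfl

@[simp] lemma coord_zero (i : Fin 7) : (0 : FiliformModel α β γ δ).coord i = 0 := rfl

omit [Field F] in
lemma ext_coord {u v : FiliformModel α β γ δ} (h0 : u.coord 0 = v.coord 0)
    (h1 : u.coord 1 = v.coord 1) (h2 : u.coord 2 = v.coord 2) (h3 : u.coord 3 = v.coord 3)
    (h4 : u.coord 4 = v.coord 4) (h5 : u.coord 5 = v.coord 5) (h6 : u.coord 6 = v.coord 6) :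
    u = v := by
  funext i
  fin_cases i <;> assumption

instance : Bracket (FiliformModel α β γ δ) (FiliformModel α β γ δ) where
  bracket u v := mk ![0, 0,
    u.coord 0 * v.coord 1 - u.coord 1 * v.coord 0,
    u.coord 0 * v.coord 2 - u.coord 2 * v.coord 0,
    u.coord 0 * v.coord 3 - u.coord 3 * v.coord 0
      + α * (u.coord 1 * v.coord 2 - u.coord 2 * v.coord 1),
    u.coord 0 * v.coord 4 - u.coord 4 * v.coord 0
      + β * (u.coord 1 * v.coord 2 - u.coord 2 * v.coord 1)
      + α * (u.coord 1 * v.coord 3 - u.coord 3 * v.coord 1),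
    u.coord 0 * v.coord 5 - u.coord 5 * v.coord 0
      + γ * (u.coord 1 * v.coord 2 - u.coord 2 * v.coord 1)
      + β * (u.coord 1 * v.coord 3 - u.coord 3 * v.coord 1)
      + δ * (u.coord 2 * v.coord 3 - u.coord 3 * v.coord 2)
      + (α - δ) * (u.coord 1 * v.coord 4 - u.coord 4 * v.coord 1)]

section

variable (u v : FiliformModel α β γ δ)

@[simp] lemma coord_lie_zero : ⁅u, v⁆.coord 0 = 0 := rfl

@[simp] lemma coord_lie_one : ⁅u, v⁆.coord 1 = 0 := rfl

@[simp] lemma coord_lie_two :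
    ⁅u, v⁆.coord 2 = u.coord 0 * v.coord 1 - u.coord 1 * v.coord 0 := rfl

@[simp] lemma coord_lie_three :
    ⁅u, v⁆.coord 3 = u.coord 0 * v.coord 2 - u.coord 2 * v.coord 0 := rfl

@[simp] lemma coord_lie_four :
    ⁅u, v⁆.coord 4 = u.coord 0 * v.coord 3 - u.coord 3 * v.coord 0
      + α * (u.coord 1 * v.coord 2 - u.coord 2 * v.coord 1) := rfl

@[simp] lemma coord_lie_five :
    ⁅u, v⁆.coord 5 = u.coord 0 * v.coord 4 - u.coord 4 * v.coord 0
      + β * (u.coord 1 * v.coord 2 - u.coord 2 * v.coord 1)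
      + α * (u.coord 1 * v.coord 3 - u.coord 3 * v.coord 1) := rfl

@[simp] lemma coord_lie_six :
    ⁅u, v⁆.coord 6 = u.coord 0 * v.coord 5 - u.coord 5 * v.coord 0
      + γ * (u.coord 1 * v.coord 2 - u.coord 2 * v.coord 1)
      + β * (u.coord 1 * v.coord 3 - u.coord 3 * v.coord 1)
      + δ * (u.coord 2 * v.coord 3 - u.coord 3 * v.coord 2)
      + (α - δ) * (u.coord 1 * v.coord 4 - u.coord 4 * v.coord 1) := rfl

end

instance : LieRing (FiliformModel α β γ δ) where
  add_lie u v w := by apply ext_coord <;> simp <;> ring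
  lie_add u v w := by apply ext_coord <;> simp <;> ring
  lie_self u := by apply ext_coord <;> simp <;> ring
  leibniz_lie u v w := by apply ext_coord <;> simp <;> ring

instance : LieAlgebra F (FiliformModel α β γ δ) where
  lie_smul c u v := by apply ext_coord <;> simp <;> ring

/-- A bracket-preserving linear injection between two models is an isomorphism. -/
lemma isLieIso_of_injective {α' β' γ' δ' : F}
    (f : FiliformModel α' β' γ' δ' →ₗ[F] FiliformModel α β γ δ)
    (hlie : ∀ u v, f ⁅u, v⁆ = ⁅f u, f v⁆) (hf : ∀ u, f u = 0 → u = 0) :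
    IsLieIso (FiliformModel α' β' γ' δ') (FiliformModel α β γ δ) := by
  have hinj : Function.Injective f := (injective_iff_map_eq_zero f).2 hf
  have hsurj : Function.Surjective f :=
    (LinearMap.injective_iff_surjective_of_finrank_eq_finrank
      ((finrank_eq ..).trans (finrank_eq ..).symm)).1 hinj
  exact ⟨Equiv.ofBijective f ⟨hinj, hsurj⟩, map_add f, hlie⟩

/-- The effect of `x ↦ a x`, `y₁ ↦ c y₁` on the parameters. -/
lemma isLieIso_scale {a c : F} (ha : a ≠ 0) (hc : c ≠ 0) :
    IsLieIso (FiliformModel (α * c / a ^ 2) (β * c / a ^ 3) (γ * c / a ^ 4) (δ * c / a ^ 2))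
      (FiliformModel α β γ δ) := by
  refine isLieIso_of_injective
    { toFun := fun u => mk ![a * u.coord 0, c * u.coord 1, a * c * u.coord 2,
        a ^ 2 * c * u.coord 3, a ^ 3 * c * u.coord 4, a ^ 4 * c * u.coord 5,
        a ^ 5 * c * u.coord 6]
      map_add' := fun u v => by apply ext_coord <;> simp <;> ring
      map_smul' := fun t u => by apply ext_coord <;> simp <;> ring } ?_ ?_
  · intro u v
    apply ext_coord <;> simp <;> field_simp
  · intro u hu
    have h (i : Fin 7) := congrArg (coord · i) hu
    have h0 := h 0; have h1 := h 1; have h2 := h 2; have h3 := h 3; have h4 := h 4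
    have h5 := h 5; have h6 := h 6
    simp [ha, hc] at h0 h1 h2 h3 h4 h5 h6
    apply ext_coord <;> simpa

/-- The effect of `x ↦ x + b y₁` on the parameters. -/
lemma isLieIso_shear (b : F) :
    IsLieIso (FiliformModel α (β - 2 * b * α ^ 2)
      (γ - b * β * (5 * α - δ) + b ^ 2 * α ^ 2 * (5 * α - δ)) δ) (FiliformModel α β γ δ) := by
  refine isLieIso_of_injective
    { toFun := fun u => mk ![u.coord 0, u.coord 1 + b * u.coord 0, u.coord 2, u.coord 3,
        u.coord 4 + b * α * u.coord 3,
        u.coord 5 + b * β * u.coord 3 + 2 * b * α * u.coord 4,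
        u.coord 6 + b * γ * u.coord 3 + (2 * b * β + b ^ 2 * α * (α - δ)) * u.coord 4
          + b * (3 * α - δ) * u.coord 5]
      map_add' := fun u v => by apply ext_coord <;> simp <;> ring
      map_smul' := fun t u => by apply ext_coord <;> simp <;> ring } ?_ ?_
  · intro u v
    apply ext_coord <;> simp <;> ring
  · intro u hu
    have h (i : Fin 7) := congrArg (coord · i) hu
    have h0 := h 0; have h1 := h 1; have h2 := h 2; have h3 := h 3; have h4 := h 4
    have h5 := h 5; have h6 := h 6
    simp at h0 h1 h2 h3 h4 h5 h6
    simp_all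
    apply ext_coord <;> simpa

/-- The effect of `y₁ ↦ y₁ + e y₃` on the parameters. -/
lemma isLieIso_translate (e : F) :
    IsLieIso (FiliformModel α β (γ - 2 * e * δ) δ) (FiliformModel α β γ δ) := by
  refine isLieIso_of_injective
    { toFun := fun u => mk ![u.coord 0, u.coord 1, u.coord 2, u.coord 3 + e * u.coord 1,
        u.coord 4 + e * u.coord 2, u.coord 5 + e * u.coord 3, u.coord 6 + e * u.coord 4]
      map_add' := fun u v => by apply ext_coord <;> simp <;> ring
      map_smul' := fun t u => by apply ext_coord <;> simp <;> ring } ?_ ?_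
  · intro u v
    apply ext_coord <;> simp <;> ring
  · intro u hu
    have h (i : Fin 7) := congrArg (coord · i) hu
    have h0 := h 0; have h1 := h 1; have h2 := h 2; have h3 := h 3; have h4 := h 4
    have h5 := h 5; have h6 := h 6
    simp at h0 h1 h2 h3 h4 h5 h6
    simp_all
    apply ext_coord <;> simpa

/-- The `i`-th basis vector. -/
def basisVec (α β γ δ : F) (i : Fin 7) : FiliformModel α β γ δ := mk (Pi.single i 1)

/-- How the parameters of two isomorphic models are related: here `x` is sent to
`a x + b y₁ + ⋯` and `y₁` is sent to `c y₁ + ⋯`. -/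
lemma params_of_equiv {α' β' γ' δ' : F}
    (f : FiliformModel α' β' γ' δ' →ₗ[F] FiliformModel α β γ δ)
    (hlie : ∀ u v, f ⁅u, v⁆ = ⁅f u, f v⁆) (hf : Function.Injective f) :
    ∃ a b c : F, a ≠ 0 ∧ c ≠ 0 ∧ α' * a ^ 2 = α * c ∧ δ' * a ^ 2 = δ * c ∧
      β' * a ^ 4 = (a * β - 2 * b * α ^ 2) * c ∧
      (δ = 0 → γ' * a ^ 6 = (a ^ 2 * γ - 5 * a * b * α * β + 5 * b ^ 2 * α ^ 3) * c) := by
  have e2 : basisVec α' β' γ' δ' 2 = ⁅basisVec α' β' γ' δ' 0, basisVec α' β' γ' δ' 1⁆ := by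
    apply ext_coord <;> simp [basisVec]
  have e3 : basisVec α' β' γ' δ' 3 = ⁅basisVec α' β' γ' δ' 0, basisVec α' β' γ' δ' 2⁆ := by
    apply ext_coord <;> simp [basisVec]
  have e4 : basisVec α' β' γ' δ' 4 = ⁅basisVec α' β' γ' δ' 0, basisVec α' β' γ' δ' 3⁆ := by
    apply ext_coord <;> simp [basisVec]
  have e5 : basisVec α' β' γ' δ' 5 = ⁅basisVec α' β' γ' δ' 0, basisVec α' β' γ' δ' 4⁆ := by
    apply ext_coord <;> simp [basisVec]
  have e6 : basisVec α' β' γ' δ' 6 = ⁅basisVec α' β' γ' δ' 0, basisVec α' β' γ' δ' 5⁆ := by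
    apply ext_coord <;> simp [basisVec]
  have r12 : ⁅basisVec α' β' γ' δ' 1, basisVec α' β' γ' δ' 2⁆ =
      α' • basisVec α' β' γ' δ' 4 + β' • basisVec α' β' γ' δ' 5 + γ' • basisVec α' β' γ' δ' 6 := by
    apply ext_coord <;> simp [basisVec]
  have r23 : ⁅basisVec α' β' γ' δ' 2, basisVec α' β' γ' δ' 3⁆ = δ' • basisVec α' β' γ' δ' 6 := by
    apply ext_coord <;> simp [basisVec]
  have n6 : f (basisVec α' β' γ' δ' 6) ≠ 0 := by
    intro h
    have := hf (h.trans (map_zero f).symm)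
    have := congrArg (coord · 6) this
    simp [basisVec] at this
  replace e2 := congrArg f e2
  replace e3 := congrArg f e3
  replace e4 := congrArg f e4
  replace e5 := congrArg f e5
  replace e6 := congrArg f e6
  replace r12 := congrArg f r12
  replace r23 := congrArg f r23
  simp only [hlie, map_add, map_smul] at e2 e3 e4 e5 e6 r12 r23
  generalize f (basisVec α' β' γ' δ' 0) = X at *
  generalize f (basisVec α' β' γ' δ' 1) = Y at *
  rw [e2] at e3 r12 r23
  rw [e3] at e4 r23
  rw [e4] at e5 r12
  rw [e5] at e6 r12
  rw [e6] at r12 r23 n6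
  have r3 := congrArg (coord · 3) r12
  have r4 := congrArg (coord · 4) r12
  have r5 := congrArg (coord · 5) r12
  have r6 := congrArg (coord · 6) r12
  have s6 := congrArg (coord · 6) r23
  have n : X.coord 0 ^ 4 * (X.coord 0 * Y.coord 1 - X.coord 1 * Y.coord 0) ≠ 0 := by
    intro h
    apply n6
    apply ext_coord <;> simp only [coord_zero, coord_lie_zero, coord_lie_one, coord_lie_two,
      coord_lie_three, coord_lie_four, coord_lie_five, coord_lie_six] <;>
      first | ring1 | linear_combination h
  simp only [coord_add, coord_smul, coord_lie_zero, coord_lie_one, coord_lie_two,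
    coord_lie_three, coord_lie_four, coord_lie_five, coord_lie_six, zero_mul, mul_zero, sub_zero,
    zero_add, add_zero] at r3 r4 r5 r6 s6
  have hΔ := right_ne_zero_of_mul n
  have ha : X.coord 0 ≠ 0 := fun h => left_ne_zero_of_mul n (by simp [h])
  have hY0 : Y.coord 0 = 0 := by grind
  have hc : Y.coord 1 ≠ 0 := by
    rintro h
    simp [h, hY0] at hΔ
  simp only [hY0, zero_mul, mul_zero, sub_zero, zero_add] at r4 r5 r6 s6
  generalize X.coord 0 = a at *
  generalize X.coord 1 = b at *
  generalize Y.coord 1 = c at *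
  have hα : α' * a ^ 2 = α * c := by
    apply mul_left_cancel₀ (mul_ne_zero ha hc)
    linear_combination -r4
  have hβ : β' * a ^ 4 = (a * β - 2 * b * α ^ 2) * c := by
    apply mul_left_cancel₀ hc
    linear_combination -r5 - (a * Y.coord 2 + 2 * α * b * c) * hα
  refine ⟨a, b, c, ha, hc, hα, ?_, ?_, ?_⟩
  · apply mul_left_cancel₀ (mul_ne_zero (pow_ne_zero 3 ha) hc)
    linear_combination -s6
  · exact hβ
  · rintro rfl
    apply mul_left_cancel₀ hc
    linear_combination -a * r6 - (a * Y.coord 2 + 3 * α * b * c) * hβ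
      - (a ^ 2 * Y.coord 3 + a * α * (b * Y.coord 2 - X.coord 2 * c) + 2 * a * b * β * c
        + 2 * α * b * a * Y.coord 2 + α ^ 2 * b ^ 2 * c) * hα

end FiliformModel

end FiliformModel

section Classification

variable {F : Type*} [Field F]

/-- Parameters `(α, β, γ, δ)` of representatives of the isomorphism classes of models, given a
nonsquare `ν`. -/
def stdParams (ν : F) : F ⊕ Fin 8 → F × F × F × F
  | .inl a => (a, 0, 0, 1)
  | .inr 0 => (0, 1, 0, 1)
  | .inr 1 => (1, 0, 0, 0)
  | .inr 2 => (1, 0, 1, 0)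
  | .inr 3 => (1, 0, ν, 0)
  | .inr 4 => (0, 1, 0, 0)
  | .inr 5 => (0, 1, 1, 0)
  | .inr 6 => (0, 0, 0, 0)
  | .inr 7 => (0, 0, 1, 0)

/-- The representative model with parameters `stdParams ν t`. -/
abbrev StdModel (ν : F) (t : F ⊕ Fin 8) : Type _ :=
  FiliformModel (stdParams ν t).1 (stdParams ν t).2.1 (stdParams ν t).2.2.1 (stdParams ν t).2.2.2

open FiliformModel

lemma isLieIso_of_params_eq {α β γ δ α' β' γ' δ' : F} (hα : α' = α) (hβ : β' = β) (hγ : γ' = γ)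
    (hδ : δ' = δ) : IsLieIso (FiliformModel α' β' γ' δ') (FiliformModel α β γ δ) := by
  subst hα hβ hγ hδ
  exact .refl _

lemma exists_isLieIso_stdModel {ν : F} (h2 : (2 : F) ≠ 0)
    (hν : ∀ r : F, r ≠ 0 → ∃ s, s ≠ 0 ∧ (r = s ^ 2 ∨ r = ν * s ^ 2)) (α β γ δ : F) :
    ∃ t, IsLieIso (StdModel ν t) (FiliformModel α β γ δ) := by
  by_cases hδ : δ = 0
  · subst hδ
    by_cases hα : α = 0
    · subst hα
      by_cases hβ : β = 0
      · subst hβ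
        by_cases hγ : γ = 0
        · exact ⟨.inr 6, isLieIso_of_params_eq rfl rfl hγ.symm rfl⟩
        · refine ⟨.inr 7, .trans (isLieIso_of_params_eq ?_ ?_ ?_ ?_)
            (isLieIso_scale one_ne_zero (inv_ne_zero hγ))⟩ <;> simp [stdParams, hγ]
      · by_cases hγ : γ = 0
        · subst hγ
          refine ⟨.inr 4, .trans (isLieIso_of_params_eq ?_ ?_ ?_ ?_)
            (isLieIso_scale one_ne_zero (inv_ne_zero hβ))⟩ <;> simp [stdParams, hβ]
        · refine ⟨.inr 5, .trans (isLieIso_of_params_eq ?_ ?_ ?_ ?_)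
            (isLieIso_scale (a := γ / β) (c := γ ^ 3 / β ^ 4) (by positivity) (by positivity))⟩ <;>
            simp [stdParams] <;> field_simp
    · have key (γ : F) : ∃ t, IsLieIso (StdModel ν t) (FiliformModel α 0 γ 0) := by
        by_cases hγ : γ = 0
        · subst hγ
          refine ⟨.inr 1, .trans (isLieIso_of_params_eq ?_ ?_ ?_ ?_)
            (isLieIso_scale one_ne_zero (inv_ne_zero hα))⟩ <;> simp [stdParams, hα]
        · obtain ⟨s, hs, hγs | hγs⟩ := hν (γ / α) (div_ne_zero hγ hα)
          · rw [div_eq_iff hα] at hγs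
            subst hγs
            refine ⟨.inr 2, .trans (isLieIso_of_params_eq ?_ ?_ ?_ ?_)
              (isLieIso_scale hs (div_ne_zero (pow_ne_zero 2 hs) hα))⟩ <;>
              simp [stdParams] <;> field_simp
          · rw [div_eq_iff hα] at hγs
            subst hγs
            refine ⟨.inr 3, .trans (isLieIso_of_params_eq ?_ ?_ ?_ ?_)
              (isLieIso_scale hs (div_ne_zero (pow_ne_zero 2 hs) hα))⟩ <;>
              simp [stdParams] <;> field_simp
      have hβ := isLieIso_shear (α := α) (β := β) (γ := γ) (δ := 0) (β / (2 * α ^ 2))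
      rw [show β - 2 * (β / (2 * α ^ 2)) * α ^ 2 = 0 by field_simp; ring] at hβ
      obtain ⟨t, ht⟩ := key _
      exact ⟨t, ht.trans hβ⟩
  · have hγ (α β γ : F) : IsLieIso (FiliformModel α β 0 δ) (FiliformModel α β γ δ) :=
      .trans (isLieIso_of_params_eq rfl rfl (by field_simp; ring) rfl)
        (isLieIso_translate (γ / (2 * δ)))
    have key (α : F) : ∃ t, IsLieIso (StdModel ν t) (FiliformModel α 0 0 δ) := by
      refine ⟨.inl (α / δ), .trans (isLieIso_of_params_eq ?_ ?_ ?_ ?_)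
        (isLieIso_scale one_ne_zero (inv_ne_zero hδ))⟩ <;> simp [stdParams, hδ, div_eq_mul_inv]
    obtain hβ | ⟨rfl, hβ⟩ : (α ≠ 0 ∨ β = 0) ∨ α = 0 ∧ β ≠ 0 := by tauto
    · have hshear := isLieIso_shear (α := α) (β := β) (γ := γ) (δ := δ) (β / (2 * α ^ 2))
      rw [show β - 2 * (β / (2 * α ^ 2)) * α ^ 2 = 0 by
        rcases hβ with hα | rfl
        · field_simp; ring
        · simp] at hshear
      obtain ⟨t, ht⟩ := key α
      exact ⟨t, (ht.trans (hγ ..)).trans hshear⟩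
    · refine ⟨.inr 0, .trans (.trans (isLieIso_of_params_eq ?_ ?_ ?_ ?_)
        (isLieIso_scale (a := β / δ) (c := (β / δ) ^ 2 / δ) (div_ne_zero hβ hδ)
          (div_ne_zero (pow_ne_zero 2 (div_ne_zero hβ hδ)) hδ))) (hγ 0 β γ)⟩ <;>
        simp [stdParams] <;> field_simp

/-- Distinct representatives over `ZMod p` are not isomorphic. -/
lemma eq_of_isLieIso_stdModel {p : ℕ} [Fact p.Prime] {ν : ZMod p} (h2 : (2 : ZMod p) ≠ 0)
    (hν : ¬ IsSquare ν) {t t' : ZMod p ⊕ Fin 8}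
    (h : IsLieIso (StdModel ν t') (StdModel ν t)) : t' = t := by
  obtain ⟨e, hadd, hlie⟩ := h
  obtain ⟨a, b, c, ha, hc, hα, hδ, hβ, hγ⟩ := params_of_equiv
    ((AddMonoidHom.mk' e hadd).toZModLinearMap p) hlie e.injective
  have hν0 : ν ≠ 0 := by rintro rfl; exact hν IsSquare.zero
  have hνa : ν ≠ a ^ 2 := fun h => hν ⟨a, h.trans (sq a)⟩
  have hνa' : ν ≠ a⁻¹ ^ 2 := fun h => hν ⟨a⁻¹, h.trans (sq a⁻¹)⟩
  clear hadd hlie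
  rcases t with x | i <;> rcases t' with x' | i'
  · simp only [stdParams] at *
    grind
  · exfalso
    fin_cases i' <;> simp [stdParams, hc] at hα hβ hγ hδ <;> grind
  · exfalso
    fin_cases i <;> simp [stdParams, ha, hc] at hα hβ hγ hδ
  · fin_cases i <;> fin_cases i' <;>
      first | rfl | (exfalso; simp [stdParams, ha, hc] at hα hβ hγ hδ <;> grind)

end Classification

section Transport

variable {L L' : Type*} [LieRing L] [LieRing L']

lemma IsLieIso.lieClassEq {c : ℕ} (h : IsLieIso L L') (hc : LieClassEq L c) :
    LieClassEq L' c := by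
  obtain ⟨e, hadd, hlie⟩ := h
  let f : L →ₗ⁅ℤ⁆ L' :=
    { (AddMonoidHom.mk' e hadd).toIntLinearMap with map_lie' := fun {x y} => hlie x y }
  have hmap (k : ℕ) := LieIdeal.lowerCentralSeries_map_eq k (f := f) e.surjective
  have hbot (I : LieIdeal ℤ L) : I.map f = ⊥ ↔ I = ⊥ := by
    have hker : f.ker = ⊥ := (LieHom.ker_eq_bot f).2 e.injective
    rw [LieIdeal.map_eq_bot_iff, hker, le_bot_iff]
  exact ⟨by rw [← hmap, hbot]; exact hc.1, by rw [← hmap, Ne, hbot]; exact hc.2⟩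

lemma IsLieIso.lieCharP {p : ℕ} (h : IsLieIso L L') (hp : LieCharP L p) : LieCharP L' p := by
  obtain ⟨e, hadd, -⟩ := h
  intro x
  obtain ⟨x, rfl⟩ := e.surjective x
  have := map_nsmul (AddMonoidHom.mk' e hadd) p x
  rw [hp x, map_zero] at this
  exact this.symm

lemma Equiv.isLieIso_lieRing {α : Type*} (e : α ≃ L) : @IsLieIso α L e.lieRing _ :=
  letI := e.lieRing
  ⟨e, fun x y => e.apply_symm_apply (e x + e y), fun x y => e.apply_symm_apply ⁅e x, e y⁆⟩

end Transport

namespace FiliformModel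

variable {F : Type*} [Field F] {α β γ δ : F}

lemma coord_eq_zero_of_mem_lowerCentralSeries {k : ℕ} {u : FiliformModel α β γ δ}
    (hu : u ∈ LieModule.lowerCentralSeries F (FiliformModel α β γ δ)
      (FiliformModel α β γ δ) (k + 1))
    (i : Fin 7) (hi : (i : ℕ) ≤ k + 1) : u.coord i = 0 := by
  induction k generalizing u i with
  | zero =>
    rw [LieModule.lowerCentralSeries_succ, ← LieSubmodule.mem_toSubmodule,
      LieSubmodule.lieIdeal_oper_eq_linear_span'] at hu
    induction hu using Submodule.span_induction with
    | mem v hv =>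
      obtain ⟨x, -, y, -, rfl⟩ := hv
      fin_cases i <;> simp at hi ⊢
    | zero => rfl
    | add v w _ _ hv hw => simp [hv, hw]
    | smul c v _ hv => simp [hv]
  | succ k ih =>
    rw [LieModule.lowerCentralSeries_succ, ← LieSubmodule.mem_toSubmodule,
      LieSubmodule.lieIdeal_oper_eq_linear_span'] at hu
    induction hu using Submodule.span_induction with
    | mem v hv =>
      obtain ⟨x, -, y, hy, rfl⟩ := hv
      have hy (j : Fin 7) (hj : (j : ℕ) ≤ k + 1) := ih hy j hj
      have h0 := hy 0 (by simp)
      have h1 := hy 1 (by simp)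
      have h2 (h : 1 ≤ k) := hy 2 (by simp; omega)
      have h3 (h : 2 ≤ k) := hy 3 (by simp; omega)
      have h4 (h : 3 ≤ k) := hy 4 (by simp; omega)
      have h5 (h : 4 ≤ k) := hy 5 (by simp; omega)
      fin_cases i <;> simp at hi ⊢
      · simp [h0, h1]
      · simp [h0, h2 hi]
      · simp [h0, h1, h2 (by omega), h3 (by omega)]
      · simp [h0, h1, h2 (by omega), h3 (by omega), h4 (by omega)]
      · simp [h0, h1, h2 (by omega), h3 (by omega), h4 (by omega), h5 (by omega)]
    | zero => rfl
    | add v w _ _ hv hw => simp [hv, hw]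
    | smul c v _ hv => simp [hv]

lemma lieClassEq : LieClassEq (FiliformModel α β γ δ) 6 := by
  have hcoe (k : ℕ) := LieModule.coe_lowerCentralSeries_eq_int F (FiliformModel α β γ δ)
    (FiliformModel α β γ δ) k
  constructor
  · rw [LieSubmodule.eq_bot_iff]
    intro u hu
    rw [← SetLike.mem_coe, ← hcoe] at hu
    have h (i : Fin 7) : u.coord i = 0 :=
      coord_eq_zero_of_mem_lowerCentralSeries hu i (by omega)
    exact ext_coord (h 0) (h 1) (h 2) (h 3) (h 4) (h 5) (h 6)
  · intro h
    have hmem := LieModule.iterate_toEnd_mem_lowerCentralSeries ℤ (FiliformModel α β γ δ)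
      (FiliformModel α β γ δ) (basisVec α β γ δ 0) (basisVec α β γ δ 1) 5
    rw [show (6 - 1 : ℕ) = 5 from rfl] at h
    rw [h, LieSubmodule.mem_bot] at hmem
    have := congrArg (coord · 6) hmem
    simp [basisVec, Function.iterate_succ_apply'] at this

lemma lieCharP {p : ℕ} {α β γ δ : ZMod p} [Fact p.Prime] :
    LieCharP (FiliformModel α β γ δ) p := fun u => by
  rw [← Nat.cast_smul_eq_nsmul (ZMod p), ZMod.natCast_self, zero_smul]

end FiliformModel

section MaximalClass

variable {F L : Type*} [Field F] [LieRing L] [LieAlgebra F L]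

variable (F L) in
/-- The lower central series of a Lie algebra, starting with `lcs F L 0 = ⊤`. -/
abbrev lcs (k : ℕ) : LieIdeal F L := LieModule.lowerCentralSeries F L L k

lemma lcs_anti {i j : ℕ} (h : i ≤ j) {u : L} (hu : u ∈ lcs F L j) : u ∈ lcs F L i :=
  LieModule.antitone_lowerCentralSeries F L L h hu

lemma mem_lcs_zero (u : L) : u ∈ lcs F L 0 := LieSubmodule.mem_top u

lemma lcs_succ_le {k : ℕ} {W : Submodule F L} (h : ∀ a : L, ∀ b ∈ lcs F L k, ⁅a, b⁆ ∈ W) {u : L}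
    (hu : u ∈ lcs F L (k + 1)) : u ∈ W := by
  rw [lcs, LieModule.lowerCentralSeries_succ, ← LieSubmodule.mem_toSubmodule,
    LieSubmodule.lieIdeal_oper_eq_linear_span'] at hu
  refine Submodule.span_le.2 ?_ hu
  rintro _ ⟨a, -, b, hb, rfl⟩
  exact h a b hb

lemma lie_mem_lcs_succ {k : ℕ} (a : L) {b : L} (hb : b ∈ lcs F L k) : ⁅a, b⁆ ∈ lcs F L (k + 1) := by
  rw [lcs, LieModule.lowerCentralSeries_succ]
  exact LieSubmodule.lie_mem_lie (LieSubmodule.mem_top a) hb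

lemma lie_mem_lcs {i j k : ℕ} (hk : k ≤ i + j + 1) {u v : L} (hu : u ∈ lcs F L i)
    (hv : v ∈ lcs F L j) : ⁅u, v⁆ ∈ lcs F L k := by
  refine lcs_anti hk ?_
  clear hk
  induction i generalizing u v j with
  | zero => simpa using lie_mem_lcs_succ u hv
  | succ i ih =>
    let W : Submodule F L := (lcs F L (i + 1 + j + 1)).toSubmodule.comap
      ((LieModule.toEnd F L L : L →ₗ[F] Module.End F L).flip v)
    refine lcs_succ_le (W := W) (fun a b hb => ?_) hu
    change ⁅⁅a, b⁆, v⁆ ∈ lcs F L (i + 1 + j + 1)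
    rw [lie_lie]
    refine sub_mem ?_ ?_
    · exact lcs_anti (by omega) (lie_mem_lcs_succ a (ih hb hv))
    · exact lcs_anti (by omega) (ih hb (lie_mem_lcs_succ a hv))

lemma lcs_stable {k : ℕ} (h : lcs F L k ≤ lcs F L (k + 1)) {m : ℕ} (hm : k ≤ m) :
    lcs F L k ≤ lcs F L m := by
  induction m, hm using Nat.le_induction with
  | base => exact le_rfl
  | succ m hm ih =>
    refine h.trans ?_
    rw [lcs, lcs, LieModule.lowerCentralSeries_succ, LieModule.lowerCentralSeries_succ]
    exact LieSubmodule.mono_lie_right _ ih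

lemma finrank_lt_span_singleton_sup {V : Type*} [AddCommGroup V] [Module F V] [Module.Finite F V]
    {W : Submodule F V} {z : V} (hz : z ∉ W) :
    Module.finrank F W < Module.finrank F (Submodule.span F {z} ⊔ W : Submodule F V) := by
  refine Submodule.finrank_lt_finrank_of_lt (lt_of_le_of_ne le_sup_right fun h => hz ?_)
  rw [h]
  exact Submodule.mem_sup_left (Submodule.mem_span_singleton_self z)

lemma exists_sub_smul_mem {V : Type*} [AddCommGroup V] [Module F V] {W : Submodule F V} {z v : V}
    (h : v ∈ Submodule.span F {z} ⊔ W) : ∃ c : F, v - c • z ∈ W := by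
  obtain ⟨_, h1, w, hw, rfl⟩ := Submodule.mem_sup.1 h
  obtain ⟨c, rfl⟩ := Submodule.mem_span_singleton.1 h1
  exact ⟨c, by simpa⟩

/-- If `L` is generated by `x` and `y`, and `lcs k` by `u`, modulo the next terms of the lower
central series, then `lcs (k + 1)` is generated by `⁅x, u⁆` and `⁅y, u⁆` modulo the next term. -/
lemma lcs_succ_le_of_lie_mem {x y u : L} {k : ℕ}
    (hL : ∀ z : L, ∃ a b : F, z - a • x - b • y ∈ lcs F L 1) (hu : u ∈ lcs F L k)
    (hk : ∀ z ∈ lcs F L k, ∃ c : F, z - c • u ∈ lcs F L (k + 1))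
    (hx : ⁅x, u⁆ ∈ lcs F L (k + 2)) (hy : ⁅y, u⁆ ∈ lcs F L (k + 2)) :
    lcs F L (k + 1) ≤ lcs F L (k + 2) := by
  intro z hz
  refine lcs_succ_le (W := (lcs F L (k + 2)).toSubmodule) (fun l n hn => ?_) hz
  obtain ⟨a, b, hl⟩ := hL l
  obtain ⟨c, hn⟩ := hk n hn
  have e : ⁅l, n⁆ = ⁅l, n - c • u⁆ + c • (a • ⁅x, u⁆ + b • ⁅y, u⁆ + ⁅l - a • x - b • y, u⁆) := by
    simp only [lie_sub, sub_lie, lie_smul, smul_lie]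
    module
  change ⁅l, n⁆ ∈ lcs F L (k + 2)
  rw [e]
  exact add_mem (lie_mem_lcs_succ l hn) (SMulMemClass.smul_mem c (add_mem (add_mem
    (SMulMemClass.smul_mem a hx) (SMulMemClass.smul_mem b hy))
    (lie_mem_lcs (by omega) hl hu)))

lemma lie_eq_zero_of_mem_lcs {n i j : ℕ} (hn : lcs F L n = ⊥) (h : n ≤ i + j + 1) {u v : L}
    (hu : u ∈ lcs F L i) (hv : v ∈ lcs F L j) : ⁅u, v⁆ = 0 := by
  have := lie_mem_lcs h hu hv
  rwa [hn, LieSubmodule.mem_bot] at this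

lemma generators_swap {x y : L} (hL : ∀ z : L, ∃ a b : F, z - a • x - b • y ∈ lcs F L 1) (z : L) :
    ∃ a b : F, z - a • y - b • x ∈ lcs F L 1 := by
  obtain ⟨a, b, h⟩ := hL z
  exact ⟨b, a, by rwa [sub_right_comm]⟩

variable [Module.Finite F L] (h7 : Module.finrank F L = 7) (h6 : lcs F L 6 = ⊥)
  (h5 : lcs F L 5 ≠ ⊥)

omit [Module.Finite F L] in
include h6 h5 in
lemma not_lcs_le_succ {k : ℕ} (hk : k ≤ 5) : ¬ lcs F L k ≤ lcs F L (k + 1) := by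
  intro h
  refine h5 (le_bot_iff.1 ?_)
  rw [← h6]
  exact (LieModule.antitone_lowerCentralSeries F L L hk).trans (lcs_stable h (by omega))

include h6 h5 in
lemma finrank_lcs_succ_lt {k : ℕ} (hk : k ≤ 5) :
    Module.finrank F (lcs F L (k + 1)) < Module.finrank F (lcs F L k) :=
  Submodule.finrank_lt_finrank_of_lt (s := (lcs F L (k + 1)).toSubmodule)
    (t := (lcs F L k).toSubmodule) (lt_of_le_not_ge
      (LieModule.antitone_lowerCentralSeries F L L k.le_succ) (not_lcs_le_succ h6 h5 hk))

include h7 h6 h5 in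
lemma finrank_lcs_one_le : Module.finrank F (lcs F L 1) ≤ 5 := by
  by_contra! hlt
  obtain ⟨x, -, hx⟩ := SetLike.not_le_iff_exists.1 (not_lcs_le_succ h6 h5 (Nat.zero_le 5))
  have hlt' := finrank_lt_span_singleton_sup (W := (lcs F L 1).toSubmodule) hx
  have htop : Submodule.span F {x} ⊔ (lcs F L 1).toSubmodule = ⊤ := by
    apply Submodule.eq_top_of_finrank_eq
    refine le_antisymm (Submodule.finrank_le _) ?_
    rw [h7]
    exact lt_of_le_of_lt hlt hlt'
  have hgen (z : L) : ∃ c : F, z - c • x ∈ lcs F L 1 :=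
    exists_sub_smul_mem (htop ▸ Submodule.mem_top)
  refine not_lcs_le_succ h6 h5 (k := 1) (by norm_num)
    (lcs_succ_le_of_lie_mem (x := x) (y := 0) (k := 0) (fun z => ?_) (mem_lcs_zero x)
      (fun z _ => hgen z) ?_ ?_)
  · obtain ⟨c, hc⟩ := hgen z
    exact ⟨c, 0, by simpa using hc⟩
  · simp
  · simp

include h7 h6 h5 in
lemma finrank_lcs {k : ℕ} (h1 : 1 ≤ k) (hk : k ≤ 6) : Module.finrank F (lcs F L k) = 6 - k := by
  have := finrank_lcs_one_le h7 h6 h5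
  have l1 := finrank_lcs_succ_lt h6 h5 (k := 1) (by norm_num)
  have l2 := finrank_lcs_succ_lt h6 h5 (k := 2) (by norm_num)
  have l3 := finrank_lcs_succ_lt h6 h5 (k := 3) (by norm_num)
  have l4 := finrank_lcs_succ_lt h6 h5 (k := 4) (by norm_num)
  have l5 := finrank_lcs_succ_lt h6 h5 (k := 5) (by norm_num)
  simp only [Nat.reduceAdd] at l1 l2 l3 l4 l5
  interval_cases k <;> omega

include h7 h6 h5 in
lemma exists_sub_smul_mem_lcs {k : ℕ} (h1 : 1 ≤ k) (hk : k ≤ 5) {u : L} (hu : u ∈ lcs F L k)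
    (hu' : u ∉ lcs F L (k + 1)) {z : L} (hz : z ∈ lcs F L k) :
    ∃ c : F, z - c • u ∈ lcs F L (k + 1) := by
  have hle : Submodule.span F {u} ⊔ (lcs F L (k + 1)).toSubmodule ≤ (lcs F L k).toSubmodule :=
    sup_le ((Submodule.span_singleton_le_iff_mem u _).2 hu)
      (LieModule.antitone_lowerCentralSeries F L L k.le_succ)
  have hfin := finrank_lt_span_singleton_sup (W := (lcs F L (k + 1)).toSubmodule) hu'
  have e : Submodule.span F {u} ⊔ (lcs F L (k + 1)).toSubmodule = (lcs F L k).toSubmodule := by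
    refine Submodule.eq_of_le_of_finrank_le hle ?_
    have e1 : Module.finrank F (lcs F L k).toSubmodule = 6 - k := finrank_lcs h7 h6 h5 h1 (by omega)
    have e2 : Module.finrank F (lcs F L (k + 1)).toSubmodule = 6 - (k + 1) :=
      finrank_lcs h7 h6 h5 (by omega) (by omega)
    omega
  exact exists_sub_smul_mem (W := (lcs F L (k + 1)).toSubmodule) (e ▸ hz)

include h7 h6 h5 in
lemma exists_generators : ∃ x y : L, ∀ z : L, ∃ a b : F, z - a • x - b • y ∈ lcs F L 1 := by
  obtain ⟨x, -, hx⟩ := SetLike.not_le_iff_exists.1 (not_lcs_le_succ h6 h5 (Nat.zero_le 5))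
  have e1 : Module.finrank F (lcs F L 1).toSubmodule = 5 :=
    finrank_lcs h7 h6 h5 le_rfl (by norm_num)
  have hx' := finrank_lt_span_singleton_sup (W := (lcs F L 1).toSubmodule) hx
  set W := Submodule.span F {x} ⊔ (lcs F L 1).toSubmodule with hW
  obtain ⟨y, hy⟩ : ∃ y, y ∉ W ∨ W = ⊤ := by
    by_cases h : W = ⊤
    · exact ⟨0, .inr h⟩
    · obtain ⟨y, hy⟩ := SetLike.exists_not_mem_of_ne_top W h
      exact ⟨y, .inl hy⟩
  have htop : Submodule.span F {y} ⊔ W = ⊤ := by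
    rcases hy with hy | hy
    · apply Submodule.eq_top_of_finrank_eq
      refine le_antisymm (Submodule.finrank_le _) ?_
      have := finrank_lt_span_singleton_sup hy
      omega
    · rw [hy, sup_top_eq]
  refine ⟨x, y, fun z => ?_⟩
  obtain ⟨b, hb⟩ := exists_sub_smul_mem (htop ▸ Submodule.mem_top : z ∈ _)
  obtain ⟨a, ha⟩ := exists_sub_smul_mem hb
  exact ⟨a, b, by rwa [sub_right_comm]⟩

omit [Module.Finite F L] in
include h6 h5 in
lemma lie_generators_notMem {x y : L} (hL : ∀ z : L, ∃ a b : F, z - a • x - b • y ∈ lcs F L 1) :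
    ⁅x, y⁆ ∉ lcs F L 2 := by
  intro h
  refine not_lcs_le_succ h6 h5 (k := 1) (by norm_num) fun z hz => ?_
  refine lcs_succ_le (W := (lcs F L 2).toSubmodule) (fun l n _ => ?_) hz
  obtain ⟨a, b, hl⟩ := hL l
  obtain ⟨a', b', hn⟩ := hL n
  have e : ⁅l, n⁆ = (a * b' - b * a') • ⁅x, y⁆ + ⁅l, n - a' • x - b' • y⁆
      - ⁅a' • x + b' • y, l - a • x - b • y⁆ := by
    simp only [lie_sub, add_lie, lie_smul, smul_lie, lie_self, ← lie_skew x y, ← lie_skew l x,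
      ← lie_skew l y]
    module
  change ⁅l, n⁆ ∈ lcs F L 2
  rw [e]
  exact sub_mem (add_mem (SMulMemClass.smul_mem _ h) (lie_mem_lcs_succ l hn))
    (lie_mem_lcs_succ _ hl)

include h7 h6 h5 in
/-- Generators `x, y` can be chosen so that `y` centralizes `lcs 1` modulo `lcs 3`. -/
lemma exists_generators_lie_mem : ∃ x y : L,
    (∀ z : L, ∃ a b : F, z - a • x - b • y ∈ lcs F L 1) ∧
      ⁅x, ⁅x, y⁆⁆ ∉ lcs F L 3 ∧ ⁅y, ⁅x, y⁆⁆ ∈ lcs F L 3 := by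
  obtain ⟨x, y, hL, hx⟩ : ∃ x y : L,
      (∀ z : L, ∃ a b : F, z - a • x - b • y ∈ lcs F L 1) ∧ ⁅x, ⁅x, y⁆⁆ ∉ lcs F L 3 := by
    obtain ⟨x, y, hL⟩ := exists_generators h7 h6 h5
    by_cases hx : ⁅x, ⁅x, y⁆⁆ ∈ lcs F L 3
    · refine ⟨y, x, generators_swap hL, fun hy => ?_⟩
      rw [← lie_skew y x, lie_neg, neg_mem_iff] at hy
      have hy1 : ⁅x, y⁆ ∈ lcs F L 1 := lie_mem_lcs_succ x (mem_lcs_zero y)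
      exact not_lcs_le_succ h6 h5 (k := 2) (by norm_num) (lcs_succ_le_of_lie_mem hL hy1
        (fun z hz => exists_sub_smul_mem_lcs h7 h6 h5 le_rfl (by norm_num) hy1
          (lie_generators_notMem h6 h5 hL) hz) hx hy)
    · exact ⟨x, y, hL, hx⟩
  have hy1 : ⁅x, y⁆ ∈ lcs F L 1 := lie_mem_lcs_succ x (mem_lcs_zero y)
  obtain ⟨c, hc⟩ := exists_sub_smul_mem_lcs h7 h6 h5 (by norm_num) (by norm_num)
    (lie_mem_lcs_succ x hy1) hx (lie_mem_lcs_succ y hy1)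
  have e : ⁅x, y - c • x⁆ = ⁅x, y⁆ := by simp
  refine ⟨x, y - c • x, fun z => ?_, by rwa [e], by rwa [e, sub_lie, smul_lie]⟩
  obtain ⟨a, b, h⟩ := hL z
  exact ⟨a + b * c, b, by convert! h using 1; module⟩

include h7 h6 h5 in
lemma exists_filiform_generators (h2 : (2 : F) ≠ 0) : ∃ x y : L,
    (∀ z : L, ∃ a b : F, z - a • x - b • y ∈ lcs F L 1) ∧
      ⁅x, y⁆ ∉ lcs F L 2 ∧ ⁅x, ⁅x, y⁆⁆ ∉ lcs F L 3 ∧ ⁅x, ⁅x, ⁅x, y⁆⁆⁆ ∉ lcs F L 4 ∧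
      ⁅x, ⁅x, ⁅x, ⁅x, y⁆⁆⁆⁆ ∉ lcs F L 5 ∧ ⁅x, ⁅x, ⁅x, ⁅x, ⁅x, y⁆⁆⁆⁆⁆ ∉ lcs F L 6 ∧
      ⁅y, ⁅x, y⁆⁆ ∈ lcs F L 3 ∧ ⁅y, ⁅x, ⁅x, ⁅x, y⁆⁆⁆⁆ ∈ lcs F L 5 ∧
      ⁅y, ⁅x, ⁅x, ⁅x, ⁅x, y⁆⁆⁆⁆⁆ = 0 := by
  obtain ⟨x, y, hL, hx3, hy3⟩ := exists_generators_lie_mem h7 h6 h5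
  refine ⟨x, y, hL, lie_generators_notMem h6 h5 hL, hx3, ?_⟩
  have e2 : ⁅y, x⁆ = -⁅x, y⁆ := (lie_skew y x).symm
  have m2 : ⁅x, y⁆ ∈ lcs F L 1 := lie_mem_lcs_succ x (mem_lcs_zero y)
  generalize ⁅x, y⁆ = y2 at *
  have m3 := lie_mem_lcs_succ x m2
  have e3 : ⁅y, ⁅x, y2⁆⁆ = ⁅x, ⁅y, y2⁆⁆ := by rw [leibniz_lie, e2]; simp
  have n3 : ⁅y, ⁅x, y2⁆⁆ ∈ lcs F L 4 := e3 ▸ lie_mem_lcs_succ x hy3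
  generalize e : ⁅x, y2⁆ = y3 at *
  have m4 := lie_mem_lcs_succ x m3
  have hx4 : ⁅x, y3⁆ ∉ lcs F L 4 := fun h => not_lcs_le_succ h6 h5 (k := 3) (by norm_num)
    (lcs_succ_le_of_lie_mem hL m3 (fun z hz =>
      exists_sub_smul_mem_lcs h7 h6 h5 (by norm_num) (by norm_num) m3 hx3 hz) h n3)
  have e4 : ⁅y, ⁅x, y3⁆⁆ = -⁅y2, y3⁆ + ⁅x, ⁅y, y3⁆⁆ := by rw [leibniz_lie, e2, neg_lie]
  have e24 : ⁅x, ⁅y2, y3⁆⁆ = ⁅y2, ⁅x, y3⁆⁆ := by rw [leibniz_lie, e]; simp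
  have e123 : ⁅y, ⁅y2, y3⁆⁆ = 0 := by
    rw [leibniz_lie, lie_eq_zero_of_mem_lcs h6 (by norm_num) hy3 m3,
      lie_eq_zero_of_mem_lcs h6 (by norm_num) m2 n3, add_zero]
  generalize ⁅x, y3⁆ = y4 at *
  have m5 := lie_mem_lcs_succ x m4
  have e5 : ⁅y, ⁅x, y4⁆⁆ = -⁅y2, y4⁆ + ⁅x, ⁅y, y4⁆⁆ := by rw [leibniz_lie, e2, neg_lie]
  have m14 : ⁅y, y4⁆ ∈ lcs F L 4 := lie_mem_lcs_succ y m4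
  have m13 : ⁅x, ⁅y, y3⁆⁆ ∈ lcs F L 5 := lie_mem_lcs_succ x n3
  have e23 : ⁅y2, y3⁆ = -⁅y, y4⁆ + ⁅x, ⁅y, y3⁆⁆ := by rw [e4]; abel
  have e14 : ⁅y, ⁅y, y4⁆⁆ = 0 := by
    rwa [e23, lie_add, lie_neg, lie_eq_zero_of_mem_lcs h6 (by norm_num) (mem_lcs_zero y) m13,
      add_zero, neg_eq_zero] at e123
  rw [e23, lie_add, lie_neg, lie_eq_zero_of_mem_lcs h6 (by norm_num) (mem_lcs_zero x) m13,
    add_zero] at e24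
  rw [← e24, neg_neg, ← two_smul F] at e5
  have n4 : ⁅y, y4⁆ ∈ lcs F L 5 := by
    by_contra h
    have hgen {z : L} (hz : z ∈ lcs F L 4) :=
      exists_sub_smul_mem_lcs h7 h6 h5 (by norm_num) (by norm_num) m14 h hz
    obtain ⟨s, hs⟩ := hgen m5
    have hs := lie_eq_zero_of_mem_lcs h6 (by norm_num) (mem_lcs_zero y) hs
    rw [lie_sub, lie_smul, e14, smul_zero, sub_zero, e5, smul_eq_zero_iff_right h2] at hs
    exact not_lcs_le_succ h6 h5 (k := 5) (by norm_num)
      (lcs_succ_le_of_lie_mem hL m14 (fun z hz => hgen hz) (hs ▸ zero_mem _) (e14 ▸ zero_mem _))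
  rw [lie_eq_zero_of_mem_lcs h6 (by norm_num) (mem_lcs_zero x) n4, smul_zero] at e5
  have hx5 : ⁅x, y4⁆ ∉ lcs F L 5 := fun h => not_lcs_le_succ h6 h5 (k := 4) (by norm_num)
    (lcs_succ_le_of_lie_mem hL m4 (fun z hz =>
      exists_sub_smul_mem_lcs h7 h6 h5 (by norm_num) (by norm_num) m4 hx4 hz) h n4)
  exact ⟨hx4, hx5, fun h => not_lcs_le_succ h6 h5 (k := 5) (by norm_num)
    (lcs_succ_le_of_lie_mem hL m5 (fun z hz =>
      exists_sub_smul_mem_lcs h7 h6 h5 (by norm_num) (by norm_num) m5 hx5 hz) h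
        (e5 ▸ zero_mem _)), hy3, n4, e5⟩

include h7 h6 h5 in
/-- A seven-dimensional Lie algebra of maximal class over a field of characteristic not two is
isomorphic to one of the models. -/
lemma exists_isLieIso_filiformModel (h2 : (2 : F) ≠ 0) :
    ∃ α β γ δ : F, IsLieIso (FiliformModel α β γ δ) L := by
  obtain ⟨x, y, hL, hx2, hx3, hx4, hx5, hx6, n2, n4, e15⟩ := exists_filiform_generators h7 h6 h5 h2
  have e2 : ⁅y, x⁆ = -⁅x, y⁆ := (lie_skew y x).symm
  have m1 : y ∈ lcs F L 0 := mem_lcs_zero y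
  have m2 := lie_mem_lcs_succ x m1
  have m3 := lie_mem_lcs_succ x m2
  have m4 := lie_mem_lcs_succ x m3
  have m5 := lie_mem_lcs_succ x m4
  have m6 := lie_mem_lcs_succ x m5
  have g2 {z : L} (hz : z ∈ lcs F L 1) :=
    exists_sub_smul_mem_lcs h7 h6 h5 (by norm_num) (by norm_num) m2 hx2 hz
  have g3 {z : L} (hz : z ∈ lcs F L 2) :=
    exists_sub_smul_mem_lcs h7 h6 h5 (by norm_num) (by norm_num) m3 hx3 hz
  have g4 {z : L} (hz : z ∈ lcs F L 3) :=
    exists_sub_smul_mem_lcs h7 h6 h5 (by norm_num) (by norm_num) m4 hx4 hz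
  have g5 {z : L} (hz : z ∈ lcs F L 4) :=
    exists_sub_smul_mem_lcs h7 h6 h5 (by norm_num) (by norm_num) m5 hx5 hz
  have g6 {z : L} (hz : z ∈ lcs F L 5) :=
    exists_sub_smul_mem_lcs h7 h6 h5 (by norm_num) (by norm_num) m6 hx6 hz
  clear hx2 hx3 hx4 hx5 hx6
  generalize f2 : ⁅x, y⁆ = y2 at *
  generalize f3 : ⁅x, y2⁆ = y3 at *
  generalize f4 : ⁅x, y3⁆ = y4 at *
  generalize f5 : ⁅x, y4⁆ = y5 at *
  generalize f6 : ⁅x, y5⁆ = y6 at *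
  have z6 {z : L} (hz : z ∈ lcs F L 6) : z = 0 := by rwa [h6, LieSubmodule.mem_bot] at hz
  have r06 : ⁅x, y6⁆ = 0 := z6 (lie_mem_lcs_succ x m6)
  have r16 : ⁅y, y6⁆ = 0 := z6 (lie_mem_lcs_succ y m6)
  obtain ⟨α, β, γ, r12⟩ : ∃ α β γ : F, ⁅y, y2⁆ = α • y4 + β • y5 + γ • y6 := by
    obtain ⟨α, h⟩ := g4 n2
    obtain ⟨β, h⟩ := g5 h
    obtain ⟨γ, h⟩ := g6 h
    exact ⟨α, β, γ, by rw [← sub_eq_zero, ← z6 h]; abel⟩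
  have r13 : ⁅y, y3⁆ = α • y5 + β • y6 := by
    rw [← f3, leibniz_lie, e2, neg_lie, lie_self, neg_zero, zero_add, r12]
    simp only [lie_add, lie_smul, f5, f6, r06, smul_zero, add_zero]
  have e14 : ⁅y, y4⁆ = -⁅y2, y3⁆ + α • y6 := by
    rw [← f4, leibniz_lie, e2, neg_lie, r13]
    simp only [lie_add, lie_smul, f6, r06, smul_zero, add_zero]
  obtain ⟨δ, r23⟩ : ∃ δ : F, ⁅y2, y3⁆ = δ • y6 := by
    have h : ⁅y2, y3⁆ ∈ lcs F L 5 := by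
      rw [show ⁅y2, y3⁆ = α • y6 - ⁅y, y4⁆ by rw [e14]; abel]
      exact sub_mem (SMulMemClass.smul_mem α m6) n4
    obtain ⟨δ, h⟩ := g6 h
    exact ⟨δ, sub_eq_zero.1 (z6 h)⟩
  have r14 : ⁅y, y4⁆ = (α - δ) • y6 := by rw [e14, r23]; module
  have r24 : ⁅y2, y4⁆ = 0 := by
    rw [← f4, leibniz_lie, ← lie_skew y2 x, f3, neg_lie, lie_self, r23, lie_smul, r06]
    simp
  have r25 : ⁅y2, y5⁆ = 0 := lie_eq_zero_of_mem_lcs h6 (by norm_num) m2 m5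
  have r26 : ⁅y2, y6⁆ = 0 := lie_eq_zero_of_mem_lcs h6 (by norm_num) m2 m6
  have r34 : ⁅y3, y4⁆ = 0 := lie_eq_zero_of_mem_lcs h6 (by norm_num) m3 m4
  have r35 : ⁅y3, y5⁆ = 0 := lie_eq_zero_of_mem_lcs h6 (by norm_num) m3 m5
  have r36 : ⁅y3, y6⁆ = 0 := lie_eq_zero_of_mem_lcs h6 (by norm_num) m3 m6
  have r45 : ⁅y4, y5⁆ = 0 := lie_eq_zero_of_mem_lcs h6 (by norm_num) m4 m5
  have r46 : ⁅y4, y6⁆ = 0 := lie_eq_zero_of_mem_lcs h6 (by norm_num) m4 m6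
  have r56 : ⁅y5, y6⁆ = 0 := lie_eq_zero_of_mem_lcs h6 (by norm_num) m5 m6
  let f : FiliformModel α β γ δ →ₗ[F] L :=
    { toFun := fun u => u.coord 0 • x + u.coord 1 • y + u.coord 2 • y2 + u.coord 3 • y3
        + u.coord 4 • y4 + u.coord 5 • y5 + u.coord 6 • y6
      map_add' := fun u v => by simp only [FiliformModel.coord_add]; module
      map_smul' := fun c u => by simp only [FiliformModel.coord_smul, RingHom.id_apply]; module }
  have hsurj : Function.Surjective f := fun z => by
    obtain ⟨c0, c1, h⟩ := hL z
    obtain ⟨c2, h⟩ := g2 h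
    obtain ⟨c3, h⟩ := g3 h
    obtain ⟨c4, h⟩ := g4 h
    obtain ⟨c5, h⟩ := g5 h
    obtain ⟨c6, h⟩ := g6 h
    refine ⟨FiliformModel.mk ![c0, c1, c2, c3, c4, c5, c6], ?_⟩
    rw [eq_comm, ← sub_eq_zero, ← z6 h]
    change z - (c0 • x + c1 • y + c2 • y2 + c3 • y3 + c4 • y4 + c5 • y5 + c6 • y6) = _
    abel
  have hinj : Function.Injective f := (LinearMap.injective_iff_surjective_of_finrank_eq_finrank
    ((FiliformModel.finrank_eq ..).trans h7.symm)).2 hsurj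
  refine ⟨α, β, γ, δ, Equiv.ofBijective f ⟨hinj, hsurj⟩, map_add f, fun u v => ?_⟩
  change ⁅u, v⁆.coord 0 • x + ⁅u, v⁆.coord 1 • y + ⁅u, v⁆.coord 2 • y2 + ⁅u, v⁆.coord 3 • y3
        + ⁅u, v⁆.coord 4 • y4 + ⁅u, v⁆.coord 5 • y5 + ⁅u, v⁆.coord 6 • y6 =
    ⁅u.coord 0 • x + u.coord 1 • y + u.coord 2 • y2 + u.coord 3 • y3
        + u.coord 4 • y4 + u.coord 5 • y5 + u.coord 6 • y6,
      v.coord 0 • x + v.coord 1 • y + v.coord 2 • y2 + v.coord 3 • y3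
        + v.coord 4 • y4 + v.coord 5 • y5 + v.coord 6 • y6⁆
  have skew {a b c : L} (h : ⁅a, b⁆ = c) : ⁅b, a⁆ = -c := by rw [← lie_skew, h]
  simp only [lie_add, add_lie, lie_smul, smul_lie, lie_self, f2, f3, f4, f5, f6, r06, r12, r13, r14,
    e15, r16, r23, r24, r25, r26, r34, r35, r36, r45, r46, r56, skew f2, skew f3, skew f4, skew f5,
    skew f6, skew r06, skew r12, skew r13, skew r14, skew e15, skew r16, skew r23, skew r24,
    skew r25, skew r26, skew r34, skew r35, skew r36, skew r45, skew r46, skew r56,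
    FiliformModel.coord_lie_zero, FiliformModel.coord_lie_one, FiliformModel.coord_lie_two,
    FiliformModel.coord_lie_three, FiliformModel.coord_lie_four, FiliformModel.coord_lie_five,
    FiliformModel.coord_lie_six]
  module

end MaximalClass

lemma exists_eq_sq_or_eq_mul_sq {F : Type*} [Field F] [Fintype F] [DecidableEq F] {ν : F}
    (hν : ¬ IsSquare ν) {r : F} (hr : r ≠ 0) : ∃ s, s ≠ 0 ∧ (r = s ^ 2 ∨ r = ν * s ^ 2) := by
  by_cases hs : IsSquare r
  · obtain ⟨s, rfl⟩ := hs
    exact ⟨s, left_ne_zero_of_mul hr, .inl (sq s).symm⟩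
  · have hν0 : ν ≠ 0 := by
      rintro rfl
      exact hν IsSquare.zero
    obtain ⟨s, hs⟩ : IsSquare (r * ν) := by
      rw [← quadraticChar_one_iff_isSquare (mul_ne_zero hr hν0), map_mul,
        quadraticChar_neg_one_iff_not_isSquare.2 hs, quadraticChar_neg_one_iff_not_isSquare.2 hν]
      norm_num
    have hs0 : s ≠ 0 := left_ne_zero_of_mul (hs ▸ mul_ne_zero hr hν0)
    refine ⟨s / ν, div_ne_zero hs0 hν0, .inr ?_⟩
    field_simp
    rw [hs, sq]

/-- A Lie ring of prime characteristic `p` is a Lie algebra over `ZMod p`. -/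
abbrev LieCharP.lieAlgebra {p : ℕ} {L : Type*} [LieRing L] (hp : LieCharP L p) :
    LieAlgebra (ZMod p) L where
  toModule := AddCommGroup.zmodModule hp
  lie_smul c u v := by
    let := AddCommGroup.zmodModule hp
    exact ZMod.map_smul (LieModule.toEnd ℤ L L u) c v

lemma LieClassEq.exists_isLieIso_filiformModel {F L : Type*} [Field F] [LieRing L]
    [LieAlgebra F L] [Module.Finite F L] (h : LieClassEq L 6) (h7 : Module.finrank F L = 7)
    (h2 : (2 : F) ≠ 0) : ∃ α β γ δ : F, IsLieIso (FiliformModel α β γ δ) L := by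
  have hbot (k : ℕ) : lcs F L k = ⊥ ↔ LieModule.lowerCentralSeries ℤ L L k = ⊥ := by
    simp only [SetLike.ext'_iff, LieModule.coe_lowerCentralSeries_eq_int F L L k,
      LieSubmodule.bot_coe]
  exact _root_.exists_isLieIso_filiformModel h7 ((hbot 6).2 h.1) (mt (hbot 5).1 h.2) h2

lemma LieCharP.exists_isLieIso_filiformModel {p : ℕ} [Fact p.Prime] (h2 : (2 : ZMod p) ≠ 0)
    {L : Type*} [LieRing L] (hp : LieCharP L p) (hcard : Nat.card L = p ^ 7)
    (hclass : LieClassEq L 6) : ∃ α β γ δ : ZMod p, IsLieIso (FiliformModel α β γ δ) L := by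
  let := hp.lieAlgebra
  have hp' : p.Prime := Fact.out
  have : Finite L := Nat.finite_of_card_ne_zero (hcard ▸ pow_ne_zero 7 hp'.ne_zero)
  refine hclass.exists_isLieIso_filiformModel ?_ h2
  have h := Module.natCard_eq_pow_finrank (K := ZMod p) (V := L)
  rw [hcard, Nat.card_zmod] at h
  exact (Nat.pow_right_injective hp'.two_le h).symm

/-- Restricting an isomorphism-invariant property of Lie rings on a fixed carrier to
representatives counts isomorphism classes. -/
lemma card_quot_isLieIso {α ι : Type*} {P : LieRing α → Prop} {M : ι → Type*}
    [∀ i, LieRing (M i)] (e : ∀ i, α ≃ M i) (hP : ∀ i, P (e i).lieRing)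
    (hinj : ∀ i j, IsLieIso (M i) (M j) → i = j)
    (hsurj : ∀ s : LieRing α, P s → ∃ i, IsLieIso (M i) α) :
    Nat.card (Quot fun s t : {s : LieRing α // P s} => @IsLieIso _ _ s.1 t.1) = Nat.card ι := by
  have hequiv : Equivalence fun s t : {s : LieRing α // P s} => @IsLieIso _ _ s.1 t.1 :=
    { refl := fun s => @IsLieIso.refl α s.1
      symm := fun {s t} => @IsLieIso.symm α α s.1 t.1
      trans := fun {s t u} => @IsLieIso.trans α α α s.1 t.1 u.1 }
  refine (Nat.card_eq_of_bijective (fun i => Quot.mk _ ⟨(e i).lieRing, hP i⟩) ⟨?_, ?_⟩).symm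
  · intro i j hij
    have h := hequiv.eqvGen_iff.1 (Quot.eqvGen_exact hij)
    have hi := @IsLieIso.trans _ _ _ (e i).lieRing (e j).lieRing _ h (e j).isLieIso_lieRing
    let := (e i).lieRing
    exact hinj i j ((e i).isLieIso_lieRing.symm.trans hi)
  · rintro ⟨s, hs⟩
    obtain ⟨i, hi⟩ := hsurj s hs
    refine ⟨i, Quot.sound ?_⟩
    exact @IsLieIso.trans _ _ _ (e i).lieRing _ s (e i).isLieIso_lieRing hi

theorem lie_rings_p7_maximal_class_char_p_count (p : ℕ) (hp : p.Prime) (h5 : 5 ≤ p) :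
    Nat.card (Quot (fun s t :
        {s : LieRing (Fin (p ^ 7)) // @LieClassEq _ s 6 ∧ @LieCharP _ s p} =>
      @IsLieIso _ _ s.1 t.1)) = p + 8 := by
  have := Fact.mk hp
  have hchar : ringChar (ZMod p) ≠ 2 := by
    rw [ZMod.ringChar_zmod_n]
    omega
  have h2 : (2 : ZMod p) ≠ 0 := Ring.two_ne_zero hchar
  obtain ⟨ν, hν⟩ := FiniteField.exists_nonsquare hchar
  have hcard (t : ZMod p ⊕ Fin 8) : Nat.card (Fin (p ^ 7)) = Nat.card (StdModel ν t) := by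
    rw [Module.natCard_eq_pow_finrank (K := ZMod p) (V := StdModel ν t), FiliformModel.finrank_eq]
    simp
  have e (t : ZMod p ⊕ Fin 8) : Fin (p ^ 7) ≃ StdModel ν t :=
    have : Finite (StdModel ν t) := Module.finite_of_finite (ZMod p)
    (Finite.card_eq.1 (hcard t)).some
  rw [card_quot_isLieIso e (fun t => ?_) (fun t t' h => eq_of_isLieIso_stdModel h2 hν h)
    (fun s hs => ?_)]
  · simp
  · let := (e t).lieRing
    exact ⟨(e t).isLieIso_lieRing.symm.lieClassEq FiliformModel.lieClassEq,
      (e t).isLieIso_lieRing.symm.lieCharP FiliformModel.lieCharP⟩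
  · obtain ⟨α, β, γ, δ, h⟩ :=
      hs.2.exists_isLieIso_filiformModel h2 (Nat.card_fin _) hs.1
    obtain ⟨t, ht⟩ := exists_isLieIso_stdModel h2 (fun r => exists_eq_sq_or_eq_mul_sq hν) α β γ δ
    exact ⟨t, ht.trans h⟩
end

section
/- Let p ≥ 5 be a prime and let M be the Lie ring ⟨a, b | [b,a,b], [b,a,a,a,b], p•a, p•b, class 6⟩, i.e., the quotient of the free Lie ring on generators a, b by the Lie ideal generated by the left-normed brackets [b,a,b] and [b,a,a,a,b], the elements p•a and p•b, and the 7th term of the lower central series. Then the number of isomorphism classes of Lie rings L of cardinality p^8, nilpotent of class exactly 7, with L/L⁷ ≅ M equals 8 + 8·gcd(p−1,3) + 2·gcd(p−1,5) + gcd(p−1,8). -/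
/-- The free Lie ring on two generators. -/
abbrev FL : Type := FreeLieAlgebra ℤ (Fin 2)

/-- The generator `a`. -/
noncomputable def ga : FL := FreeLieAlgebra.of ℤ 0
/-- The generator `b`. -/
noncomputable def gb : FL := FreeLieAlgebra.of ℤ 1
/-- The left-normed bracket `[b,a,b]`. -/
noncomputable def bab : FL := ⁅⁅gb, ga⁆, gb⁆
/-- The left-normed bracket `[b,a,a,a]`. -/
noncomputable def ba3 : FL := ⁅⁅⁅gb, ga⁆, ga⁆, ga⁆
/-- The left-normed bracket `[b,a,a,a,b]`. -/
noncomputable def ba3b : FL := ⁅ba3, gb⁆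
/-- The left-normed bracket `[b,a,a,a,a]`. -/
noncomputable def ba4 : FL := ⁅ba3, ga⁆
/-- The left-normed bracket `[b,a,a,a,a,a]`. -/
noncomputable def ba5 : FL := ⁅ba4, ga⁆

/-- The quotient of the free Lie ring on `a, b` by the Lie ideal generated by the
given relator set together with `p•a`, `p•b` and the 7th term of the lower central
series (i.e. the presentation is of class at most 6). -/
abbrev presLie (p : ℕ) (rels : Set FL) : Type :=
  FL ⧸ (LieSubmodule.lieSpan ℤ FL (rels ∪ {p • ga, p • gb}) ⊔
    LieModule.lowerCentralSeries ℤ FL FL 6)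

/-- `s` is a Lie ring structure of maximal class 7 on a set of size `p^8` whose
quotient by the 7th term of the lower central series is isomorphic to `β`. -/
def IsMaxClassDescendantOf (p : ℕ) (β : Type*) [LieRing β]
    (s : LieRing (Fin (p ^ 8))) : Prop := by
  letI := s
  exact LieClassEq (Fin (p ^ 8)) 7 ∧
    IsLieIso (Fin (p ^ 8) ⧸ LieModule.lowerCentralSeries ℤ (Fin (p ^ 8)) (Fin (p ^ 8)) 6) β

/-- Structure constants of a descendant: `[b,a,b] = al z`, `[b,a,a,a,b] = be z`, `p a = ga z`,
`p b = de z`, `[b,a,a,a,a,a,a] = ep z`, `[b,a,a,a,a,a,b] = ze z`. -/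
@[ext] structure Param (p : ℕ) where
  (al be ga de ep ze : ZMod p)

/-- The central extension of the Lie ring 7.623 with the given structure constants, in coordinates
with respect to `a`, `b`, `[b,a]`, …, `[b,a,a,a,a,a]` and the central element `z`. -/
@[ext] structure Model (p : ℕ) (q : Param p) where
  (x y1 y2 y3 y4 y5 y6 t : ZMod p)

/-- The carry of the addition of standard representatives modulo `p`. -/
def carry {p : ℕ} (x y : ZMod p) : ZMod p := ((x.val + y.val) / p : ℕ)

section carry
variable {p : ℕ}

theorem carry_comm (x y : ZMod p) : carry x y = carry y x := by
  simp only [carry, add_comm]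

variable [NeZero p]

@[simp] theorem carry_zero_left (x : ZMod p) : carry 0 x = 0 := by
  simp [carry, Nat.div_eq_of_lt (ZMod.val_lt x)]

@[simp] theorem carry_zero_right (x : ZMod p) : carry x 0 = 0 := by
  rw [carry_comm, carry_zero_left]

theorem val_add_carry (x y : ZMod p) :
    x.val + y.val = (x + y).val + p * ((x.val + y.val) / p) := by
  rw [ZMod.val_add, Nat.mod_add_div]

theorem carry_assoc (x y z : ZMod p) :
    carry x y + carry (x + y) z = carry y z + carry x (y + z) := by
  simp only [carry, ← Nat.cast_add]
  congr 1
  have h1 := val_add_carry x y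
  have h2 := val_add_carry y z
  have h3 := val_add_carry (x + y) z
  have h4 := val_add_carry x (y + z)
  rw [add_assoc] at h3
  apply Nat.eq_of_mul_eq_mul_left (Nat.pos_of_neZero p)
  rw [mul_add, mul_add]
  omega

theorem cast_div_add_carry (n : ℕ) (x : ZMod p) :
    (((n * x.val / p : ℕ) : ZMod p)) + carry ((n : ZMod p) * x) x =
      (((n + 1) * x.val / p : ℕ) : ZMod p) := by
  have h : ((n : ZMod p) * x).val = n * x.val % p := by
    rw [← ZMod.val_natCast, Nat.cast_mul, ZMod.natCast_zmod_val]
  rw [carry, h, ← Nat.cast_add]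
  congr 1
  have h1 := Nat.mod_add_div (n * x.val) p
  have h2 : (n + 1) * x.val = (n * x.val % p + x.val) + p * (n * x.val / p) := by
    rw [add_mul]; omega
  rw [h2, Nat.add_mul_div_left _ _ (Nat.pos_of_neZero p), add_comm]

end carry

namespace Model
variable {p : ℕ} {q : Param p}

instance : Zero (Model p q) := ⟨⟨0, 0, 0, 0, 0, 0, 0, 0⟩⟩

instance : Add (Model p q) := ⟨fun m n => ⟨m.x + n.x, m.y1 + n.y1, m.y2 + n.y2, m.y3 + n.y3,
  m.y4 + n.y4, m.y5 + n.y5, m.y6 + n.y6,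
  m.t + n.t + q.ga * carry m.x n.x + q.de * carry m.y1 n.y1⟩⟩

instance : Neg (Model p q) := ⟨fun m => ⟨-m.x, -m.y1, -m.y2, -m.y3, -m.y4, -m.y5, -m.y6,
  -m.t - q.ga * carry m.x (-m.x) - q.de * carry m.y1 (-m.y1)⟩⟩

instance : Bracket (Model p q) (Model p q) := ⟨fun m n => ⟨0, 0,
  m.y1 * n.x - m.x * n.y1, m.y2 * n.x - m.x * n.y2, m.y3 * n.x - m.x * n.y3,
  m.y4 * n.x - m.x * n.y4, m.y5 * n.x - m.x * n.y5,
  q.ep * (m.y6 * n.x - m.x * n.y6) + q.al * (m.y2 * n.y1 - m.y1 * n.y2)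
  + q.be * (m.y4 * n.y1 - m.y1 * n.y4 - m.y3 * n.y2 + m.y2 * n.y3)
  + q.ze * (m.y6 * n.y1 - m.y1 * n.y6 - m.y5 * n.y2 + m.y2 * n.y5 + m.y4 * n.y3 - m.y3 * n.y4)⟩⟩

section coords
variable (m n : Model p q)
@[simp] theorem x_zero : (0 : Model p q).x = 0 := rfl
@[simp] theorem y1_zero : (0 : Model p q).y1 = 0 := rfl
@[simp] theorem y2_zero : (0 : Model p q).y2 = 0 := rfl
@[simp] theorem y3_zero : (0 : Model p q).y3 = 0 := rfl
@[simp] theorem y4_zero : (0 : Model p q).y4 = 0 := rfl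
@[simp] theorem y5_zero : (0 : Model p q).y5 = 0 := rfl
@[simp] theorem y6_zero : (0 : Model p q).y6 = 0 := rfl
@[simp] theorem t_zero : (0 : Model p q).t = 0 := rfl
@[simp] theorem x_add : (m + n).x = m.x + n.x := rfl
@[simp] theorem y1_add : (m + n).y1 = m.y1 + n.y1 := rfl
@[simp] theorem y2_add : (m + n).y2 = m.y2 + n.y2 := rfl
@[simp] theorem y3_add : (m + n).y3 = m.y3 + n.y3 := rfl
@[simp] theorem y4_add : (m + n).y4 = m.y4 + n.y4 := rfl
@[simp] theorem y5_add : (m + n).y5 = m.y5 + n.y5 := rfl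
@[simp] theorem y6_add : (m + n).y6 = m.y6 + n.y6 := rfl
theorem t_add : (m + n).t = m.t + n.t + q.ga * carry m.x n.x + q.de * carry m.y1 n.y1 := rfl
@[simp] theorem x_neg : (-m).x = -m.x := rfl
@[simp] theorem y1_neg : (-m).y1 = -m.y1 := rfl
@[simp] theorem y2_neg : (-m).y2 = -m.y2 := rfl
@[simp] theorem y3_neg : (-m).y3 = -m.y3 := rfl
@[simp] theorem y4_neg : (-m).y4 = -m.y4 := rfl
@[simp] theorem y5_neg : (-m).y5 = -m.y5 := rfl
@[simp] theorem y6_neg : (-m).y6 = -m.y6 := rfl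
theorem t_neg : (-m).t = -m.t - q.ga * carry m.x (-m.x) - q.de * carry m.y1 (-m.y1) := rfl
@[simp] theorem x_lie : ⁅m, n⁆.x = 0 := rfl
@[simp] theorem y1_lie : ⁅m, n⁆.y1 = 0 := rfl
@[simp] theorem y2_lie : ⁅m, n⁆.y2 = m.y1 * n.x - m.x * n.y1 := rfl
@[simp] theorem y3_lie : ⁅m, n⁆.y3 = m.y2 * n.x - m.x * n.y2 := rfl
@[simp] theorem y4_lie : ⁅m, n⁆.y4 = m.y3 * n.x - m.x * n.y3 := rfl
@[simp] theorem y5_lie : ⁅m, n⁆.y5 = m.y4 * n.x - m.x * n.y4 := rfl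
@[simp] theorem y6_lie : ⁅m, n⁆.y6 = m.y5 * n.x - m.x * n.y5 := rfl
@[simp] theorem t_lie : ⁅m, n⁆.t =
    q.ep * (m.y6 * n.x - m.x * n.y6) + q.al * (m.y2 * n.y1 - m.y1 * n.y2)
    + q.be * (m.y4 * n.y1 - m.y1 * n.y4 - m.y3 * n.y2 + m.y2 * n.y3)
    + q.ze * (m.y6 * n.y1 - m.y1 * n.y6 - m.y5 * n.y2 + m.y2 * n.y5 + m.y4 * n.y3
      - m.y3 * n.y4) := rfl
end coords

variable [NeZero p]

instance : AddCommGroup (Model p q) where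
  add_assoc m n k := by
    ext <;> simp only [x_add, y1_add, y2_add, y3_add, y4_add, y5_add, y6_add, t_add, add_assoc]
    linear_combination q.ga * carry_assoc m.x n.x k.x + q.de * carry_assoc m.y1 n.y1 k.y1
  zero_add m := by ext <;> simp [t_add]
  add_zero m := by ext <;> simp [t_add]
  nsmul := nsmulRec
  zsmul := zsmulRec
  neg_add_cancel m := by
    ext <;> simp only [x_add, y1_add, y2_add, y3_add, y4_add, y5_add, y6_add, t_add] <;>
      simp [t_neg, carry_comm]
    ring
  add_comm m n := by
    ext <;> simp only [x_add, y1_add, y2_add, y3_add, y4_add, y5_add, y6_add, t_add, add_comm,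
      carry_comm]

instance : LieRing (Model p q) where
  add_lie m n k := by ext <;> simp [t_add] <;> ring
  lie_add m n k := by ext <;> simp [t_add] <;> ring
  lie_self m := by ext <;> simp <;> ring
  leibniz_lie m n k := by ext <;> simp [t_add] <;> ring

/-- The model as a product of copies of `ZMod p`. -/
def equivProd : Model p q ≃ (Fin 8 → ZMod p) where
  toFun m := ![m.x, m.y1, m.y2, m.y3, m.y4, m.y5, m.y6, m.t]
  invFun f := ⟨f 0, f 1, f 2, f 3, f 4, f 5, f 6, f 7⟩
  left_inv _ := rfl
  right_inv f := by ext i; fin_cases i <;> rfl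

instance : Finite (Model p q) := Finite.of_equiv _ equivProd.symm

theorem card_eq : Nat.card (Model p q) = p ^ 8 := by
  rw [Nat.card_congr equivProd]; simp

section nsmul
variable (n : ℕ) (m : Model p q)
@[simp] theorem x_nsmul : (n • m).x = n * m.x := by
  induction n with
  | zero => simp
  | succ n ih => simp [succ_nsmul, ih, add_mul]
@[simp] theorem y1_nsmul : (n • m).y1 = n * m.y1 := by
  induction n with
  | zero => simp
  | succ n ih => simp [succ_nsmul, ih, add_mul]
@[simp] theorem y2_nsmul : (n • m).y2 = n * m.y2 := by
  induction n with
  | zero => simp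
  | succ n ih => simp [succ_nsmul, ih, add_mul]
@[simp] theorem y3_nsmul : (n • m).y3 = n * m.y3 := by
  induction n with
  | zero => simp
  | succ n ih => simp [succ_nsmul, ih, add_mul]
@[simp] theorem y4_nsmul : (n • m).y4 = n * m.y4 := by
  induction n with
  | zero => simp
  | succ n ih => simp [succ_nsmul, ih, add_mul]
@[simp] theorem y5_nsmul : (n • m).y5 = n * m.y5 := by
  induction n with
  | zero => simp
  | succ n ih => simp [succ_nsmul, ih, add_mul]
@[simp] theorem y6_nsmul : (n • m).y6 = n * m.y6 := by
  induction n with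
  | zero => simp
  | succ n ih => simp [succ_nsmul, ih, add_mul]

theorem t_nsmul : (n • m).t = n * m.t + q.ga * (n * m.x.val / p : ℕ)
    + q.de * (n * m.y1.val / p : ℕ) := by
  induction n with
  | zero => simp
  | succ n ih =>
    rw [succ_nsmul, t_add, ih, x_nsmul, y1_nsmul, ← cast_div_add_carry,
      ← cast_div_add_carry]
    push_cast
    ring

theorem prime_nsmul : p • m = ⟨0, 0, 0, 0, 0, 0, 0, q.ga * m.x + q.de * m.y1⟩ := by
  have h := Nat.pos_of_neZero p
  ext <;> simp [t_nsmul, Nat.mul_div_cancel_left _ h]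
end nsmul

end Model

/-- The left-normed bracket `[b, a, …, a]` with `k` entries `a`. -/
def adIter {L : Type*} [LieRing L] (a b : L) : ℕ → L
  | 0 => b
  | k + 1 => ⁅adIter a b k, a⁆

/-- The multiples of an element annihilated by `p`. -/
def zmodMultiples {A : Type*} [AddCommGroup A] {p : ℕ} (v : A) (h : p • v = 0) : ZMod p →+ A :=
  ZMod.lift p ⟨zmultiplesHom A v, by simpa using h⟩

theorem zmodMultiples_intCast {A : Type*} [AddCommGroup A] {p : ℕ} (v : A) (h : p • v = 0) (n : ℤ) :
    zmodMultiples v h (n : ZMod p) = n • v := by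
  simp [zmodMultiples]

theorem zmodMultiples_val {A : Type*} [AddCommGroup A] {p : ℕ} [NeZero p] (v : A) (h : p • v = 0)
    (c : ZMod p) : zmodMultiples v h c = c.val • v := by
  conv_lhs => rw [← ZMod.natCast_zmod_val c]
  rw [← natCast_zsmul, ← zmodMultiples_intCast v h, Int.cast_natCast]

/-- The elements `a`, `b` and the central multiples `Z c` of `z` satisfy the relations with
structure constants `q`. -/
structure SatisfiesRel {p : ℕ} {L : Type*} [LieRing L] (q : Param p) (a b : L) (Z : ZMod p →+ L) :
    Prop where
  central (c : ZMod p) (x : L) : ⁅Z c, x⁆ = 0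
  ga : p • a = Z q.ga
  de : p • b = Z q.de
  al : ⁅adIter a b 1, b⁆ = Z q.al
  be : ⁅adIter a b 3, b⁆ = Z q.be
  ep : adIter a b 6 = Z q.ep
  ze : ⁅adIter a b 5, b⁆ = Z q.ze

namespace SatisfiesRel
variable {p : ℕ} {L : Type*} [LieRing L] {q : Param p} {a b : L} {Z : ZMod p →+ L}

theorem central' (h : SatisfiesRel q a b Z) (c : ZMod p) (x : L) : ⁅x, Z c⁆ = 0 := by
  rw [← lie_skew, h.central, neg_zero]

theorem lie_succ {L : Type*} [LieRing L] {a b : L} (i j : ℕ)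
    (h : ⁅⁅adIter a b i, adIter a b j⁆, a⁆ = 0) :
    ⁅adIter a b (i + 1), adIter a b j⁆ = -⁅adIter a b i, adIter a b (j + 1)⁆ := by
  have h2 := lie_lie (adIter a b i) a (adIter a b j)
  rw [← lie_skew a ⁅_, _⁆, h, neg_zero, sub_zero, ← lie_skew a, lie_neg] at h2
  exact h2

theorem prime_nsmul_adIter (h : SatisfiesRel q a b Z) (k : ℕ) : p • adIter a b (k + 1) = 0 := by
  induction k with
  | zero => rw [adIter, ← nsmul_lie, adIter, h.de, h.central]
  | succ k ih => rw [adIter, ← nsmul_lie, ih, zero_lie]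

variable (h : SatisfiesRel q a b Z)
include h

theorem lie_one_zero : ⁅adIter a b 1, adIter a b 0⁆ = Z q.al := h.al
theorem lie_two_zero : ⁅adIter a b 2, adIter a b 0⁆ = 0 := by
  rw [lie_succ _ _ (by rw [h.lie_one_zero, h.central]), lie_self, neg_zero]
theorem lie_three_zero : ⁅adIter a b 3, adIter a b 0⁆ = Z q.be := h.be
theorem lie_two_one : ⁅adIter a b 2, adIter a b 1⁆ = -Z q.be := by
  rw [← h.lie_three_zero, lie_succ 2 _ (by rw [h.lie_two_zero, zero_lie]), neg_neg]
theorem lie_three_one : ⁅adIter a b 3, adIter a b 1⁆ = 0 := by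
  rw [lie_succ 2 _ (by rw [h.lie_two_one, neg_lie, h.central, neg_zero]), lie_self, neg_zero]
theorem lie_four_zero : ⁅adIter a b 4, adIter a b 0⁆ = 0 := by
  rw [lie_succ 3 _ (by rw [h.lie_three_zero, h.central]), h.lie_three_one, neg_zero]
theorem lie_five_zero : ⁅adIter a b 5, adIter a b 0⁆ = Z q.ze := h.ze
theorem lie_four_one : ⁅adIter a b 4, adIter a b 1⁆ = -Z q.ze := by
  rw [← h.lie_five_zero, lie_succ 4 _ (by rw [h.lie_four_zero, zero_lie]), neg_neg]
theorem lie_three_two : ⁅adIter a b 3, adIter a b 2⁆ = Z q.ze := by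
  have := lie_succ (a := a) (b := b) 3 1 (by rw [h.lie_three_one, zero_lie])
  rw [h.lie_four_one] at this
  exact (neg_injective this).symm
theorem lie_four_two : ⁅adIter a b 4, adIter a b 2⁆ = 0 := by
  rw [lie_succ 3 _ (by rw [h.lie_three_two, h.central]), lie_self, neg_zero]
theorem lie_five_one : ⁅adIter a b 5, adIter a b 1⁆ = 0 := by
  rw [lie_succ 4 _ (by rw [h.lie_four_one, neg_lie, h.central, neg_zero]), h.lie_four_two, neg_zero]
theorem lie_five_two : ⁅adIter a b 5, adIter a b 2⁆ = 0 := by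
  have := lie_succ (a := a) (b := b) 5 1 (by rw [h.lie_five_one, zero_lie])
  rw [h.ep, h.central] at this
  exact neg_eq_zero.1 this.symm
theorem lie_four_three : ⁅adIter a b 4, adIter a b 3⁆ = 0 := by
  have := lie_succ (a := a) (b := b) 4 2 (by rw [h.lie_four_two, zero_lie])
  rw [h.lie_five_two] at this
  exact neg_eq_zero.1 this.symm
theorem lie_five_three : ⁅adIter a b 5, adIter a b 3⁆ = 0 := by
  rw [lie_succ 4 _ (by rw [h.lie_four_three, zero_lie]), lie_self, neg_zero]
theorem lie_five_four : ⁅adIter a b 5, adIter a b 4⁆ = 0 := by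
  have := lie_succ (a := a) (b := b) 5 3 (by rw [h.lie_five_three, zero_lie])
  rw [h.ep, h.central] at this
  exact neg_eq_zero.1 this.symm

variable [NeZero p]

omit h in
/-- The element with the given coordinates. -/
def eval (a b : L) (Z : ZMod p →+ L) (m : Model p q) : L :=
  m.x.val • a + m.y1.val • b + m.y2.val • adIter a b 1 + m.y3.val • adIter a b 2
    + m.y4.val • adIter a b 3 + m.y5.val • adIter a b 4 + m.y6.val • adIter a b 5 + Z m.t

theorem eval_eq (m : Model p q) : eval a b Z m =
    m.x.val • a + m.y1.val • b + zmodMultiples _ (h.prime_nsmul_adIter 0) m.y2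
    + zmodMultiples _ (h.prime_nsmul_adIter 1) m.y3
    + zmodMultiples _ (h.prime_nsmul_adIter 2) m.y4
    + zmodMultiples _ (h.prime_nsmul_adIter 3) m.y5
    + zmodMultiples _ (h.prime_nsmul_adIter 4) m.y6 + Z m.t := by
  simp only [eval, zmodMultiples_val]

omit h in
theorem val_add_nsmul {c : L} {d : ZMod p} (hc : p • c = Z d) (x y : ZMod p) :
    (x + y).val • c + Z (d * carry x y) = x.val • c + y.val • c := by
  rw [← add_smul, val_add_carry, add_smul, mul_comm p, mul_smul, hc, carry, ← map_nsmul, mul_comm d,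
    nsmul_eq_mul]

theorem eval_add (m n : Model p q) : eval a b Z (m + n) = eval a b Z m + eval a b Z n := by
  have h1 := val_add_nsmul h.ga m.x n.x
  have h2 := val_add_nsmul h.de m.y1 n.y1
  simp only [h.eval_eq, Model.x_add, Model.y1_add, Model.y2_add, Model.y3_add, Model.y4_add,
    Model.y5_add, Model.y6_add, Model.t_add, map_add]
  rw [← sub_eq_zero] at h1 h2 ⊢
  rw [← add_zero (0 : L)]
  nth_rewrite 1 [← h1]
  rw [← h2]
  abel

theorem eval_lie (m n : Model p q) : eval a b Z ⁅m, n⁆ = ⁅eval a b Z m, eval a b Z n⁆ := by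
  have e (m : Model p q) : ∃ x y1 y2 y3 y4 y5 y6 : ℤ, m.x = x ∧ m.y1 = y1 ∧ m.y2 = y2 ∧ m.y3 = y3 ∧
      m.y4 = y4 ∧ m.y5 = y5 ∧ m.y6 = y6 ∧ eval a b Z m = x • a + y1 • adIter a b 0
      + y2 • adIter a b 1
      + y3 • adIter a b 2 + y4 • adIter a b 3 + y5 • adIter a b 4 + y6 • adIter a b 5 + Z m.t :=
    ⟨m.x.val, m.y1.val, m.y2.val, m.y3.val, m.y4.val, m.y5.val, m.y6.val, by
      simp only [eval, natCast_zsmul, adIter, Int.cast_natCast, ZMod.natCast_zmod_val, and_self]⟩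
  obtain ⟨x, y1, y2, y3, y4, y5, y6, hx, h1, h2, h3, h4, h5, h6, hm⟩ := e m
  obtain ⟨x', y1', y2', y3', y4', y5', y6', hx', h1', h2', h3', h4', h5', h6', hn⟩ := e n
  have sk (i j : ℕ) : ⁅adIter a b i, adIter a b j⁆ = -⁅adIter a b j, adIter a b i⁆ :=
    (lie_skew _ _).symm
  have sa (i : ℕ) : ⁅a, adIter a b i⁆ = - adIter a b (i + 1) := (lie_skew _ _).symm
  have sb (i : ℕ) : ⁅adIter a b i, a⁆ = adIter a b (i + 1) := rfl
  have zm (n : ℤ) (c : ZMod p) : Z (c * n) = n • Z c := by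
    rw [← map_zsmul, zsmul_eq_mul, mul_comm]
  rw [hm, hn, h.eval_eq]
  simp only [Model.x_lie, Model.y1_lie, Model.y2_lie, Model.y3_lie, Model.y4_lie, Model.y5_lie,
    Model.y6_lie, Model.t_lie, hx, h1, h2, h3, h4, h5, h6, hx', h1', h2', h3', h4', h5', h6',
    ← Int.cast_mul, ← Int.cast_sub, ← Int.cast_add, zmodMultiples_intCast, map_add, zm]
  simp only [add_lie, lie_add, zsmul_lie, lie_zsmul, h.central, h.central', lie_self, sa, sb,
    Nat.reduceAdd, h.ep,
    h.lie_one_zero, h.lie_two_zero, h.lie_three_zero, h.lie_two_one, h.lie_three_one,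
    h.lie_four_zero, h.lie_five_zero, h.lie_four_one, h.lie_three_two, h.lie_four_two,
    h.lie_five_one, h.lie_five_two, h.lie_four_three, h.lie_five_three, h.lie_five_four,
    sk 0 1, sk 0 2, sk 0 3, sk 0 4, sk 0 5, sk 1 2, sk 1 3, sk 1 4, sk 1 5, sk 2 3, sk 2 4, sk 2 5,
    sk 3 4, sk 3 5, sk 4 5, ZMod.val_zero, zero_smul]
  module

/-- The homomorphism from the model determined by the relations. -/
def hom : Model p q →ₗ⁅ℤ⁆ L where
  toFun := eval a b Z
  map_add' := h.eval_add
  map_smul' n m := (AddMonoidHom.mk' (eval a b Z) h.eval_add).map_zsmul n m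
  map_lie' := h.eval_lie _ _

@[simp] theorem hom_apply (m : Model p q) : h.hom m = eval a b Z m := rfl

end SatisfiesRel

open LieModule (lowerCentralSeries)

section LowerCentralSeries
variable {L L' : Type*} [LieRing L] [LieRing L']

theorem lie_mem_lcs_s10 {k : ℕ} (x : L) {y : L} (h : y ∈ lowerCentralSeries ℤ L L k) :
    ⁅x, y⁆ ∈ lowerCentralSeries ℤ L L (k + 1) := by
  rw [LieModule.lowerCentralSeries_succ]
  exact LieSubmodule.lie_mem_lie (LieSubmodule.mem_top x) h

theorem lie_mem_lcs' {k : ℕ} (x : L) {y : L} (h : y ∈ lowerCentralSeries ℤ L L k) :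
    ⁅y, x⁆ ∈ lowerCentralSeries ℤ L L (k + 1) := by
  rw [← lie_skew]
  exact neg_mem (lie_mem_lcs_s10 x h)

theorem adIter_mem_lcs (a b : L) (k : ℕ) : adIter a b k ∈ lowerCentralSeries ℤ L L k := by
  induction k with
  | zero => simp
  | succ k ih => exact lie_mem_lcs' a ih

theorem map_mem_lcs (f : L →ₗ⁅ℤ⁆ L') {k : ℕ} {x : L} (h : x ∈ lowerCentralSeries ℤ L L k) :
    f x ∈ lowerCentralSeries ℤ L' L' k :=
  LieIdeal.map_lowerCentralSeries_le k (LieIdeal.mem_map h)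

theorem lcs_succ_le_of_lie_mem_s10 (S : AddSubgroup L) (k : ℕ)
    (h : ∀ x y : L, y ∈ lowerCentralSeries ℤ L L k → ⁅x, y⁆ ∈ S) (m : L)
    (hm : m ∈ lowerCentralSeries ℤ L L (k + 1)) : m ∈ S := by
  rw [LieModule.lowerCentralSeries_succ, ← LieSubmodule.mem_toSubmodule,
    LieSubmodule.lieIdeal_oper_eq_linear_span'] at hm
  induction hm using Submodule.span_induction with
  | mem x hx => obtain ⟨y, -, n, hn, rfl⟩ := hx; exact h y n hn
  | zero => exact S.zero_mem
  | add x y _ _ hx hy => exact S.add_mem hx hy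
  | smul r x _ hx => exact S.zsmul_mem hx r

theorem map_adIter (f : L →ₗ⁅ℤ⁆ L') (a b : L) (k : ℕ) : f (adIter a b k) = adIter (f a) (f b) k := by
  induction k with
  | zero => rfl
  | succ k ih => simp [adIter, ih]

theorem SatisfiesRel.map_eval {p : ℕ} {q : Param p} (f : L →ₗ⁅ℤ⁆ L') (a b : L) (Z : ZMod p →+ L)
    (m : Model p q) :
    f (eval a b Z m) = eval (f a) (f b) ((f : L →+ L').comp Z) m := by
  simp [eval, map_adIter]

theorem SatisfiesRel.map {p : ℕ} {q : Param p} {a b : L} {Z : ZMod p →+ L}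
    (h : SatisfiesRel q a b Z) (e : L ≃ₗ⁅ℤ⁆ L') :
    SatisfiesRel q (e a) (e b) ((e : L →+ L').comp Z) where
  central c x := by
    obtain ⟨y, rfl⟩ := e.surjective x
    have := congr_arg e (h.central c y)
    rwa [LieEquiv.map_lie, map_zero] at this
  ga := (map_nsmul e _ _).symm.trans (congr_arg e h.ga)
  de := (map_nsmul e _ _).symm.trans (congr_arg e h.de)
  al := by
    have := congr_arg e h.al
    rwa [LieEquiv.map_lie, ← LieEquiv.coe_toLieHom, map_adIter] at this
  be := by
    have := congr_arg e h.be
    rwa [LieEquiv.map_lie, ← LieEquiv.coe_toLieHom, map_adIter] at this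
  ep := by
    have := congr_arg e h.ep
    rwa [← LieEquiv.coe_toLieHom, map_adIter] at this
  ze := by
    have := congr_arg e h.ze
    rwa [LieEquiv.map_lie, ← LieEquiv.coe_toLieHom, map_adIter] at this

end LowerCentralSeries

namespace Model
variable {p : ℕ} {q : Param p} [NeZero p]

/-- The generator `a`. -/
def genA (q : Param p) : Model p q := ⟨1, 0, 0, 0, 0, 0, 0, 0⟩
/-- The generator `b`. -/
def genB (q : Param p) : Model p q := ⟨0, 1, 0, 0, 0, 0, 0, 0⟩
/-- The central elements. -/
def genZ (q : Param p) : ZMod p →+ Model p q where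
  toFun c := ⟨0, 0, 0, 0, 0, 0, 0, c⟩
  map_zero' := rfl
  map_add' c d := by ext <;> simp [t_add]

theorem genZ_apply (c : ZMod p) : genZ q c = ⟨0, 0, 0, 0, 0, 0, 0, c⟩ := rfl

theorem satisfiesRel : SatisfiesRel q (genA q) (genB q) (genZ q) where
  central c x := by ext <;> simp [genZ_apply]
  ga := by rw [prime_nsmul]; simp [genA, genZ_apply]
  de := by rw [prime_nsmul]; simp [genB, genZ_apply]
  al := by ext <;> simp [genZ_apply, genA, genB, adIter, -lie_lie, -lie_skew]
  be := by ext <;> simp [genZ_apply, genA, genB, adIter, -lie_lie, -lie_skew]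
  ep := by ext <;> simp [genZ_apply, genA, genB, adIter, -lie_lie, -lie_skew]
  ze := by ext <;> simp [genZ_apply, genA, genB, adIter, -lie_lie, -lie_skew]

theorem eval_gen (hp : 1 < p) (m : Model p q) :
    SatisfiesRel.eval (genA q) (genB q) (genZ q) m = m := by
  have : Fact (1 < p) := ⟨hp⟩
  ext <;> simp [SatisfiesRel.eval, genA, genB, genZ_apply, adIter, -lie_lie, -lie_skew, t_nsmul, t_add,
    ZMod.val_one, Nat.div_eq_of_lt (ZMod.val_lt _)]

/-- A filtration containing the lower central series of the model. -/
def filt (q : Param p) (k : ℕ) : AddSubgroup (Model p q) where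
  carrier := {m | (1 ≤ k → m.x = 0 ∧ m.y1 = 0) ∧ (2 ≤ k → m.y2 = 0) ∧ (3 ≤ k → m.y3 = 0) ∧
    (4 ≤ k → m.y4 = 0) ∧ (5 ≤ k → m.y5 = 0) ∧ (6 ≤ k → m.y6 = 0) ∧
    (7 ≤ k ∨ 6 ≤ k ∧ q.ep = 0 ∧ q.ze = 0 → m.t = 0)}
  zero_mem' := by simp
  add_mem' {m n} hm hn := by
    simp only [Set.mem_ofPred_eq] at *
    refine ⟨fun h => ?_, fun h => ?_, fun h => ?_, fun h => ?_, fun h => ?_, fun h => ?_,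
      fun h => ?_⟩
    any_goals simp_all
    have h1 : 1 ≤ k := by omega
    simp_all [t_add]
  neg_mem' {m} hm := by
    simp only [Set.mem_ofPred_eq] at *
    refine ⟨fun h => ?_, fun h => ?_, fun h => ?_, fun h => ?_, fun h => ?_, fun h => ?_,
      fun h => ?_⟩
    any_goals simp_all
    have h1 : 1 ≤ k := by omega
    simp_all [t_neg]

theorem mem_filt {k : ℕ} {m : Model p q} : m ∈ filt q k ↔
    (1 ≤ k → m.x = 0 ∧ m.y1 = 0) ∧ (2 ≤ k → m.y2 = 0) ∧ (3 ≤ k → m.y3 = 0) ∧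
    (4 ≤ k → m.y4 = 0) ∧ (5 ≤ k → m.y5 = 0) ∧ (6 ≤ k → m.y6 = 0) ∧
    (7 ≤ k ∨ 6 ≤ k ∧ q.ep = 0 ∧ q.ze = 0 → m.t = 0) := Iff.rfl

theorem lie_mem_filt {k : ℕ} (m : Model p q) {n : Model p q} (hn : n ∈ filt q k) :
    ⁅m, n⁆ ∈ filt q (k + 1) := by
  rw [mem_filt] at *
  refine ⟨fun h => ⟨rfl, rfl⟩, fun h => ?_, fun h => ?_, fun h => ?_, fun h => ?_, fun h => ?_,
      fun h => ?_⟩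
  any_goals
    have h1 : 1 ≤ k := by omega
    simp_all
  rcases h with h | h
  · have : 1 ≤ k ∧ 2 ≤ k ∧ 3 ≤ k ∧ 4 ≤ k ∧ 5 ≤ k := by omega
    simp_all
  · have : 1 ≤ k ∧ 2 ≤ k ∧ 3 ≤ k ∧ 4 ≤ k := by omega
    simp_all

theorem lcs_le_filt (k : ℕ) (m : Model p q)
    (hm : m ∈ lowerCentralSeries ℤ (Model p q) (Model p q) k) : m ∈ filt q k := by
  induction k generalizing m with
  | zero => simp [mem_filt]
  | succ k ih =>
    exact lcs_succ_le_of_lie_mem_s10 (filt q (k + 1)) k (fun x y hy => lie_mem_filt x (ih y hy)) m hm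

end Model

namespace Model
variable {p : ℕ} {q : Param p} [Fact p.Prime]

theorem genZ_mem_lcs (hq : q.ep ≠ 0 ∨ q.ze ≠ 0) (c : ZMod p) :
    genZ q c ∈ lowerCentralSeries ℤ (Model p q) (Model p q) 6 := by
  have key (d : ZMod p) (hd : d ≠ 0) (h : genZ q d ∈ lowerCentralSeries ℤ (Model p q) (Model p q) 6) :
      genZ q c ∈ lowerCentralSeries ℤ (Model p q) (Model p q) 6 := by
    have : genZ q c = (c / d).val • genZ q d := by
      rw [← map_nsmul, nsmul_eq_mul, ZMod.natCast_zmod_val, div_mul_cancel₀ _ hd]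
    rw [this]
    exact nsmul_mem h _
  rcases hq with hq | hq
  · refine key _ hq ?_
    rw [← satisfiesRel.ep]
    exact adIter_mem_lcs _ _ _
  · refine key _ hq ?_
    rw [← satisfiesRel.ze]
    exact lie_mem_lcs' _ (adIter_mem_lcs _ _ _)

theorem eq_genZ_of_mem_lcs {m : Model p q}
    (hm : m ∈ lowerCentralSeries ℤ (Model p q) (Model p q) 6) : m = genZ q m.t := by
  have := mem_filt.1 (lcs_le_filt 6 m hm)
  ext <;> simp_all [genZ_apply]

theorem mem_lcs_iff (hq : q.ep ≠ 0 ∨ q.ze ≠ 0) {m : Model p q} :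
    m ∈ lowerCentralSeries ℤ (Model p q) (Model p q) 6 ↔ m = genZ q m.t :=
  ⟨eq_genZ_of_mem_lcs, fun h => h ▸ genZ_mem_lcs hq _⟩

theorem lcs_seven : lowerCentralSeries ℤ (Model p q) (Model p q) 7 = ⊥ := by
  rw [LieSubmodule.eq_bot_iff]
  intro m hm
  have := mem_filt.1 (lcs_le_filt 7 m hm)
  ext <;> simp_all

theorem lcs_six_ne_bot_iff :
    lowerCentralSeries ℤ (Model p q) (Model p q) 6 ≠ ⊥ ↔ (q.ep ≠ 0 ∨ q.ze ≠ 0) := by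
  constructor
  · intro h
    by_contra! hq
    refine h ((LieSubmodule.eq_bot_iff _).2 fun m hm => ?_)
    have := mem_filt.1 (lcs_le_filt 6 m hm)
    ext <;> simp_all
  · intro hq h
    have := genZ_mem_lcs hq 1
    rw [h, LieSubmodule.mem_bot] at this
    have := congr_arg Model.t this
    simp [genZ_apply] at this

end Model

section pres
variable (p : ℕ)

/-- The ideal of relations of the Lie ring 7.623. -/
noncomputable abbrev relIdeal : LieIdeal ℤ FL :=
  LieSubmodule.lieSpan ℤ FL ({bab, ba3b} ∪ {p • ga, p • gb}) ⊔ lowerCentralSeries ℤ FL FL 6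

/-- The projection from the free Lie ring. -/
noncomputable def presMk : FL →ₗ⁅ℤ⁆ presLie p {bab, ba3b} where
  toFun := LieSubmodule.Quotient.mk (N := relIdeal p)
  map_add' _ _ := rfl
  map_smul' _ _ := rfl
  map_lie' := rfl

theorem presMk_surjective : Function.Surjective (presMk p) := Quot.mk_surjective

theorem presMk_eq_zero {x : FL} : presMk p x = 0 ↔ x ∈ relIdeal p :=
  LieSubmodule.Quotient.mk_eq_zero' (N := relIdeal p)

theorem presMk_eq_zero_of_mem {x : FL} (h : x ∈ ({bab, ba3b} ∪ {p • ga, p • gb} : Set FL)) :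
    presMk p x = 0 :=
  (presMk_eq_zero p).2 (LieSubmodule.mem_sup_left (LieSubmodule.subset_lieSpan h))

/-- The image of `a`. -/
noncomputable abbrev presA : presLie p {bab, ba3b} := presMk p ga
/-- The image of `b`. -/
noncomputable abbrev presB : presLie p {bab, ba3b} := presMk p gb

theorem presLie_satisfiesRel (q : Param p) :
    SatisfiesRel q (presA p) (presB p) (0 : ZMod p →+ presLie p {bab, ba3b}) where
  central c x := by rw [AddMonoidHom.zero_apply, zero_lie]
  ga := by
    rw [← map_nsmul]
    exact presMk_eq_zero_of_mem p (by simp)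
  de := by
    rw [← map_nsmul]
    exact presMk_eq_zero_of_mem p (by simp)
  al := by
    rw [← map_adIter, ← LieHom.map_lie]
    exact presMk_eq_zero_of_mem p (by simp [adIter, bab, -lie_lie, -lie_skew])
  be := by
    rw [← map_adIter, ← LieHom.map_lie]
    exact presMk_eq_zero_of_mem p (by simp [adIter, ba3b, ba3, -lie_lie, -lie_skew])
  ep := by
    rw [← map_adIter]
    exact (presMk_eq_zero p).2 (LieSubmodule.mem_sup_right (adIter_mem_lcs _ _ _))
  ze := by
    rw [← map_adIter, ← LieHom.map_lie]
    exact (presMk_eq_zero p).2 (LieSubmodule.mem_sup_right (lie_mem_lcs' _ (adIter_mem_lcs _ _ _)))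

variable {p} [Fact p.Prime]

/-- The homomorphism from a model onto the Lie ring 7.623. -/
noncomputable def modelToPres (q : Param p) : Model p q →ₗ⁅ℤ⁆ presLie p {bab, ba3b} :=
  (presLie_satisfiesRel p q).hom

/-- The homomorphism from the free Lie ring onto a model. -/
noncomputable def freeToModel (q : Param p) : FL →ₗ⁅ℤ⁆ Model p q :=
  FreeLieAlgebra.lift ℤ ![Model.genA q, Model.genB q]

@[simp] theorem freeToModel_ga (q : Param p) : freeToModel q ga = Model.genA q := by
  exact FreeLieAlgebra.lift_of_apply _ _

@[simp] theorem freeToModel_gb (q : Param p) : freeToModel q gb = Model.genB q := by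
  exact FreeLieAlgebra.lift_of_apply _ _

theorem modelToPres_genA (q : Param p) : modelToPres q (Model.genA q) = presA p := by
  have : Fact (1 < p) := ⟨(Fact.out : p.Prime).one_lt⟩
  simp [modelToPres, SatisfiesRel.eval, Model.genA, ZMod.val_one]

theorem modelToPres_genB (q : Param p) : modelToPres q (Model.genB q) = presB p := by
  have : Fact (1 < p) := ⟨(Fact.out : p.Prime).one_lt⟩
  simp [modelToPres, SatisfiesRel.eval, Model.genB, ZMod.val_one]

theorem modelToPres_comp_freeToModel (q : Param p) :
    (modelToPres q).comp (freeToModel q) = presMk p := by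
  apply FreeLieAlgebra.hom_ext
  intro i
  fin_cases i
  · change modelToPres q (freeToModel q ga) = _
    rw [freeToModel_ga, modelToPres_genA]; rfl
  · change modelToPres q (freeToModel q gb) = _
    rw [freeToModel_gb, modelToPres_genB]; rfl

theorem modelToPres_surjective (q : Param p) : Function.Surjective (modelToPres q) := by
  intro y
  obtain ⟨w, rfl⟩ := presMk_surjective p y
  exact ⟨freeToModel q w, by rw [← modelToPres_comp_freeToModel q]; rfl⟩

theorem freeToModel_mem_lcs {q : Param p} (hq : q.ep ≠ 0 ∨ q.ze ≠ 0) {w : FL}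
    (hw : w ∈ relIdeal p) :
    freeToModel q w ∈ lowerCentralSeries ℤ (Model p q) (Model p q) 6 := by
  suffices h : relIdeal p ≤
      LieIdeal.comap (freeToModel q) (lowerCentralSeries ℤ (Model p q) (Model p q) 6) from
    h hw
  refine sup_le (LieSubmodule.lieSpan_le.2 ?_) fun x hx => ?_
  · rintro x ((rfl | rfl) | (rfl | rfl)) <;>
      rw [SetLike.mem_coe, LieIdeal.mem_comap]
    · have := Model.genZ_mem_lcs hq q.al
      rw [← Model.satisfiesRel.al] at this
      simpa [bab, adIter, -lie_lie, -lie_skew] using this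
    · have := Model.genZ_mem_lcs hq q.be
      rw [← Model.satisfiesRel.be] at this
      simpa [ba3b, ba3, adIter, -lie_lie, -lie_skew] using this
    · have := Model.genZ_mem_lcs hq q.ga
      rwa [← Model.satisfiesRel.ga, ← freeToModel_ga, ← map_nsmul] at this
    · have := Model.genZ_mem_lcs hq q.de
      rwa [← Model.satisfiesRel.de, ← freeToModel_gb, ← map_nsmul] at this
  · exact LieIdeal.mem_comap.2 (map_mem_lcs _ hx)

theorem modelToPres_eq_zero_iff {q : Param p} (hq : q.ep ≠ 0 ∨ q.ze ≠ 0) {m : Model p q} :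
    modelToPres q m = 0 ↔ m ∈ lowerCentralSeries ℤ (Model p q) (Model p q) 6 := by
  have hp : p.Prime := Fact.out
  constructor
  · intro h
    change SatisfiesRel.eval (presA p) (presB p) _ m = 0 at h
    have h0 : presMk p (SatisfiesRel.eval ga gb 0 m) = 0 := by
      rw [SatisfiesRel.map_eval, AddMonoidHom.comp_zero, h]
    have h1 := freeToModel_mem_lcs hq ((presMk_eq_zero p).1 h0)
    rw [SatisfiesRel.map_eval, freeToModel_ga, freeToModel_gb, AddMonoidHom.comp_zero] at h1
    have h2 : SatisfiesRel.eval (Model.genA q) (Model.genB q) (Model.genZ q) m =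
        SatisfiesRel.eval (Model.genA q) (Model.genB q) 0 m + Model.genZ q m.t := by
      simp [SatisfiesRel.eval]
    rw [Model.eval_gen hp.one_lt] at h2
    rw [h2]
    exact add_mem h1 (Model.genZ_mem_lcs hq _)
  · intro h
    rw [Model.eq_genZ_of_mem_lcs h]
    simp [modelToPres, SatisfiesRel.eval, Model.genZ_apply]

theorem prime_mul_card_presLie : p * Nat.card (presLie p {bab, ba3b}) = p ^ 8 := by
  have hp : p.Prime := Fact.out
  let q : Param p := ⟨0, 0, 0, 0, 1, 0⟩
  have hq : q.ep ≠ 0 ∨ q.ze ≠ 0 := Or.inl one_ne_zero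
  let f : Model p q →+ presLie p {bab, ba3b} := modelToPres q
  have h1 := f.ker.card_mul_index
  rw [AddSubgroup.index_ker, AddMonoidHom.range_eq_top.2 (modelToPres_surjective q),
    AddSubgroup.card_top, Model.card_eq] at h1
  have e : f.ker ≃ ZMod p :=
    { toFun := fun m => m.1.t
      invFun := fun c => ⟨Model.genZ q c, (modelToPres_eq_zero_iff hq).2 (Model.genZ_mem_lcs hq c)⟩
      left_inv := fun m => Subtype.ext
        (((Model.mem_lcs_iff hq).1 ((modelToPres_eq_zero_iff hq).1 m.2)).symm)
      right_inv := fun c => rfl }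
  rwa [Nat.card_congr e, Nat.card_zmod] at h1

end pres

/-- `L` has class exactly 7 and its quotient by the last term of the lower central series is the
Lie ring 7.623. -/
def IsDesc (p : ℕ) (L : Type*) [LieRing L] : Prop :=
  LieClassEq L 7 ∧ IsLieIso (L ⧸ lowerCentralSeries ℤ L L 6) (presLie p {bab, ba3b})

theorem isMaxClassDescendantOf_iff (p : ℕ) (s : LieRing (Fin (p ^ 8))) :
    IsMaxClassDescendantOf p (presLie p {bab, ba3b}) s ↔ @IsDesc p (Fin (p ^ 8)) s := Iff.rfl

theorem isLieIso_iff {L L' : Type*} [LieRing L] [LieRing L'] :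
    IsLieIso L L' ↔ Nonempty (L ≃ₗ⁅ℤ⁆ L') := by
  constructor
  · rintro ⟨e, h1, h2⟩
    exact ⟨{ (AddEquiv.mk' e h1).toIntLinearEquiv with map_lie' := h2 _ _ }⟩
  · rintro ⟨e⟩
    exact ⟨e.toLinearEquiv.toEquiv, map_add e.toLinearEquiv, e.map_lie⟩

theorem isLieIso_quotient {L L' : Type*} [LieRing L] [LieRing L'] (f : L →ₗ⁅ℤ⁆ L')
    (hf : Function.Surjective f) (I : LieIdeal ℤ L) (hI : ∀ x, f x = 0 ↔ x ∈ I) :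
    IsLieIso (L ⧸ I) L' := by
  obtain rfl : f.ker = I := by ext; simp [hI]
  refine isLieIso_iff.2 ⟨f.quotKerEquivRange.trans ?_⟩
  exact (LieEquiv.ofEq _ _ (by rw [f.range_eq_top.2 hf])).trans LieSubalgebra.topEquiv

theorem exists_hom_of_isLieIso {L L' : Type*} [LieRing L] [LieRing L'] (I : LieIdeal ℤ L)
    (h : IsLieIso (L ⧸ I) L') :
    ∃ f : L →ₗ⁅ℤ⁆ L', Function.Surjective f ∧ ∀ x, f x = 0 ↔ x ∈ I := by
  obtain ⟨e⟩ := isLieIso_iff.1 h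
  refine ⟨⟨e.toLinearEquiv.toLinearMap ∘ₗ I.toSubmodule.mkQ, ?_⟩, ?_, ?_⟩
  · intro x y
    exact e.map_lie (LieSubmodule.Quotient.mk x) (LieSubmodule.Quotient.mk y)
  · exact e.surjective.comp I.toSubmodule.mkQ_surjective
  · intro x
    refine (EmbeddingLike.map_eq_zero_iff (f := e.toLinearEquiv)).trans ?_
    exact LieSubmodule.Quotient.mk_eq_zero'

section
variable {p : ℕ} [Fact p.Prime]

theorem isDesc_of_equiv {q : Param p} (hq : q.ep ≠ 0 ∨ q.ze ≠ 0) {L : Type*} [LieRing L]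
    (e : L ≃ₗ⁅ℤ⁆ Model p q) : IsDesc p L := by
  have h6 (k : ℕ) (x : L) : e x ∈ lowerCentralSeries ℤ (Model p q) (Model p q) k ↔
      x ∈ lowerCentralSeries ℤ L L k :=
    ⟨fun h => by simpa using map_mem_lcs e.symm.toLieHom h, fun h => map_mem_lcs e.toLieHom h⟩
  refine ⟨⟨?_, fun h => ?_⟩, ?_⟩
  · rw [LieSubmodule.eq_bot_iff]
    intro x hx
    rw [← h6, Model.lcs_seven, LieSubmodule.mem_bot] at hx
    simpa using hx
  · refine Model.lcs_six_ne_bot_iff.2 hq ((LieSubmodule.eq_bot_iff _).2 fun m hm => ?_)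
    have h1 := (h6 6 (e.symm m)).1 (by simpa using hm)
    have h2 : e.symm m ∈ (⊥ : LieSubmodule ℤ L L) := h ▸ h1
    simpa using h2
  · refine isLieIso_quotient ((modelToPres q).comp e.toLieHom)
      ((modelToPres_surjective q).comp e.surjective) _ fun x => ?_
    rw [← h6, ← modelToPres_eq_zero_iff hq]
    rfl

end

section
variable {p : ℕ} [Fact p.Prime]

theorem exists_equiv_model {L : Type*} [LieRing L] (hL : IsDesc p L) (hcard : Nat.card L = p ^ 8) :
    ∃ q : Param p, (q.ep ≠ 0 ∨ q.ze ≠ 0) ∧ Nonempty (L ≃ₗ⁅ℤ⁆ Model p q) := by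
  have hp : p.Prime := Fact.out
  obtain ⟨⟨h7, h6⟩, hiso⟩ := hL
  obtain ⟨f, hf, hker⟩ := exists_hom_of_isLieIso _ hiso
  let K : AddSubgroup L := (f : L →+ presLie p {bab, ba3b}).ker
  have hK (x : L) : x ∈ K ↔ f x = 0 := AddMonoidHom.mem_ker
  have hKcard : Nat.card K = p := by
    have h1 := K.card_mul_index
    rw [AddSubgroup.index_ker, AddMonoidHom.range_eq_top.2 hf, AddSubgroup.card_top, hcard,
      ← prime_mul_card_presLie (p := p)] at h1
    refine Nat.eq_of_mul_eq_mul_right (Nat.pos_of_ne_zero fun h0 => ?_) h1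
    have := prime_mul_card_presLie (p := p)
    rw [h0, mul_zero] at this
    exact pow_ne_zero 8 hp.ne_zero this.symm
  obtain ⟨z, hz, hz0⟩ : ∃ z ∈ lowerCentralSeries ℤ L L 6, z ≠ 0 := by
    by_contra! h
    exact h6 ((LieSubmodule.eq_bot_iff _).2 h)
  have hz' : z ∈ K := (hK z).2 ((hker z).2 hz)
  have hpz : p • z = 0 := by
    have := card_nsmul_eq_zero' (x := (⟨z, hz'⟩ : K))
    rw [hKcard] at this
    exact congr_arg Subtype.val this
  let Z := zmodMultiples z hpz
  have hZ (x : L) (hx : f x = 0) : ∃ c, x = Z c := by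
    have h0 : (⟨z, hz'⟩ : K) ≠ 0 := fun h => hz0 (congr_arg Subtype.val h)
    obtain ⟨n, hn⟩ := AddSubgroup.mem_zmultiples_iff.1
      (mem_zmultiples_of_prime_card hKcard h0 (g' := ⟨x, (hK x).2 hx⟩))
    exact ⟨n, by rw [zmodMultiples_intCast]; exact (congr_arg Subtype.val hn).symm⟩
  have hfZ (c : ZMod p) : f (Z c) = 0 := by
    rw [zmodMultiples_val, map_nsmul, (hker z).2 hz, smul_zero]
  have hcent (c : ZMod p) (x : L) : ⁅Z c, x⁆ = 0 := by
    have := lie_mem_lcs' x ((hker _).1 (hfZ c))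
    rwa [h7, LieSubmodule.mem_bot] at this
  obtain ⟨a, ha⟩ := hf (presA p)
  obtain ⟨b, hb⟩ := hf (presB p)
  have H0 := presLie_satisfiesRel p ⟨0, 0, 0, 0, 0, 0⟩
  obtain ⟨al, hal⟩ := hZ ⁅adIter a b 1, b⁆ (by rw [f.map_lie, map_adIter, ha, hb]; exact H0.al)
  obtain ⟨be, hbe⟩ := hZ ⁅adIter a b 3, b⁆ (by rw [f.map_lie, map_adIter, ha, hb]; exact H0.be)
  obtain ⟨ga, hga⟩ := hZ (p • a) (by rw [map_nsmul, ha]; exact H0.ga)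
  obtain ⟨de, hde⟩ := hZ (p • b) (by rw [map_nsmul, hb]; exact H0.de)
  obtain ⟨ep, hep⟩ := hZ (adIter a b 6) (by rw [map_adIter, ha, hb]; exact H0.ep)
  obtain ⟨ze, hze⟩ := hZ ⁅adIter a b 5, b⁆ (by rw [f.map_lie, map_adIter, ha, hb]; exact H0.ze)
  have H : SatisfiesRel ⟨al, be, ga, de, ep, ze⟩ a b Z := ⟨hcent, hga, hde, hal, hbe, hep, hze⟩
  set q : Param p := ⟨al, be, ga, de, ep, ze⟩
  have hsurj : Function.Surjective H.hom := by
    intro l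
    obtain ⟨m, hm⟩ := modelToPres_surjective q (f l)
    have h1 : f (l - H.hom m) = 0 := by
      have h2 : (f : L →+ presLie p {bab, ba3b}).comp Z = 0 := AddMonoidHom.ext hfZ
      rw [map_sub, H.hom_apply, SatisfiesRel.map_eval, h2, ha, hb, ← hm]
      exact sub_self _
    obtain ⟨c, hc⟩ := hZ _ h1
    refine ⟨m + Model.genZ q c, ?_⟩
    have h3 : H.hom (Model.genZ q c) = Z c := by
      simp [SatisfiesRel.eval, Model.genZ_apply]
    rw [map_add, h3, ← hc, add_sub_cancel]
  have hbij : Function.Bijective H.hom := by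
    have : Finite L := Nat.finite_of_card_ne_zero (hcard ▸ pow_ne_zero 8 hp.ne_zero)
    exact hsurj.bijective_of_nat_card_le (by rw [hcard, Model.card_eq])
  let e : Model p q ≃ₗ⁅ℤ⁆ L := LieEquiv.ofBijective H.hom hbij
  refine ⟨q, ?_, ⟨e.symm⟩⟩
  rw [← Model.lcs_six_ne_bot_iff]
  intro h
  have := map_mem_lcs e.symm.toLieHom hz
  rw [h, LieSubmodule.mem_bot] at this
  exact hz0 (by simpa using this)

namespace Model
variable {q : Param p}

theorem adIter_one_lie (a b : Model p q) (hb : b.x = 0) : ⁅adIter a b 1, b⁆ =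
    genZ q (a.x * (b.y1 ^ 2 * q.al + (2 * b.y1 * b.y3 - b.y2 ^ 2) * q.be
      + (2 * b.y1 * b.y5 - 2 * b.y2 * b.y4 + b.y3 ^ 2) * q.ze)) := by
  ext <;> simp [adIter, genZ_apply, hb, -lie_lie, -lie_skew]
  ring

theorem adIter_three_lie (a b : Model p q) (hb : b.x = 0) : ⁅adIter a b 3, b⁆ =
    genZ q (a.x ^ 3 * (b.y1 ^ 2 * q.be + (2 * b.y1 * b.y3 - b.y2 ^ 2) * q.ze)) := by
  ext <;> simp [adIter, genZ_apply, hb, -lie_lie, -lie_skew]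
  ring

theorem adIter_five_lie (a b : Model p q) (hb : b.x = 0) : ⁅adIter a b 5, b⁆ =
    genZ q (a.x ^ 5 * b.y1 ^ 2 * q.ze) := by
  ext <;> simp [adIter, genZ_apply, hb, -lie_lie, -lie_skew]
  ring

theorem adIter_six (a b : Model p q) (hb : b.x = 0) : adIter a b 6 =
    genZ q (a.x ^ 5 * b.y1 * (a.x * q.ep + a.y1 * q.ze)) := by
  ext <;> simp [adIter, genZ_apply, hb, -lie_lie, -lie_skew]
  ring

theorem genZ_inj {c d : ZMod p} : genZ q c = genZ q d ↔ c = d :=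
  ⟨fun h => congr_arg Model.t h, fun h => h ▸ rfl⟩

theorem prime_nsmul' (a : Model p q) : p • a = genZ q (q.ga * a.x + q.de * a.y1) := prime_nsmul a

/-- An element outside of which the iterated bracket does not vanish. -/
theorem exists_ne_zero (hq : q.ep ≠ 0 ∨ q.ze ≠ 0) : ∃ c : ZMod p, q.ep + c * q.ze ≠ 0 := by
  by_cases h : q.ep = 0
  · exact ⟨1, by simpa [h] using hq⟩
  · exact ⟨0, by simpa using h⟩

theorem injective_of_genZ (hq : q.ep ≠ 0 ∨ q.ze ≠ 0) {L : Type*} [LieRing L]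
    (f : Model p q →ₗ⁅ℤ⁆ L) (hf : ∀ c, f (genZ q c) = 0 → c = 0) : Function.Injective f := by
  obtain ⟨c, hc⟩ := exists_ne_zero hq
  have lie {m : Model p q} (n : Model p q) (h : f m = 0) : f ⁅m, n⁆ = 0 := by
    rw [f.map_lie, h, zero_lie]
  let g : Model p q := ⟨1, c, 0, 0, 0, 0, 0, 0⟩
  have h6 (m : Model p q) (h : f m = 0) (hx : m.x = 0) (h1 : m.y1 = 0) (h2 : m.y2 = 0)
      (h3 : m.y3 = 0) (h4 : m.y4 = 0) (h5 : m.y5 = 0) : m.y6 = 0 := by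
    have e : ⁅m, g⁆ = genZ q ((q.ep + c * q.ze) * m.y6) := by
      ext <;> simp [g, genZ_apply, *]
      ring
    have := hf _ (e ▸ lie g h)
    exact (mul_eq_zero.1 this).resolve_left hc
  have h5 (m : Model p q) (h : f m = 0) (hx : m.x = 0) (h1 : m.y1 = 0) (h2 : m.y2 = 0)
      (h3 : m.y3 = 0) (h4 : m.y4 = 0) : m.y5 = 0 := by
    simpa [g, hx] using h6 ⁅m, g⁆ (lie g h) (by simp) (by simp) (by simp [*]) (by simp [*])
      (by simp [*]) (by simp [*])
  have h4 (m : Model p q) (h : f m = 0) (hx : m.x = 0) (h1 : m.y1 = 0) (h2 : m.y2 = 0)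
      (h3 : m.y3 = 0) : m.y4 = 0 := by
    simpa [g, hx] using h5 ⁅m, g⁆ (lie g h) (by simp) (by simp) (by simp [*]) (by simp [*])
      (by simp [*])
  have h3 (m : Model p q) (h : f m = 0) (hx : m.x = 0) (h1 : m.y1 = 0) (h2 : m.y2 = 0) :
      m.y3 = 0 := by
    simpa [g, hx] using h4 ⁅m, g⁆ (lie g h) (by simp) (by simp) (by simp [*]) (by simp [*])
  have h2 (m : Model p q) (h : f m = 0) (hx : m.x = 0) (h1 : m.y1 = 0) : m.y2 = 0 := by
    simpa [g, hx] using h3 ⁅m, g⁆ (lie g h) (by simp) (by simp) (by simp [*])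
  have h1 (m : Model p q) (h : f m = 0) (hx : m.x = 0) : m.y1 = 0 := by
    simpa [g, hx] using h2 ⁅m, g⁆ (lie g h) (by simp) (by simp)
  have h0 (m : Model p q) (h : f m = 0) : m.x = 0 := by
    have e : ⁅⁅m, (⟨0, 0, 0, 0, 0, 1, 0, 0⟩ : Model p q)⁆, g⁆ =
        genZ q ((q.ep + c * q.ze) * -m.x) := by
      ext <;> simp [g, genZ_apply, -lie_lie, -lie_skew]
      ring
    have := hf _ (e ▸ lie g (lie _ h))
    exact neg_eq_zero.1 ((mul_eq_zero.1 this).resolve_left hc)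
  refine (injective_iff_map_eq_zero f).2 fun m hm => ?_
  have e0 := h0 m hm
  have e1 := h1 m hm e0
  have e2 := h2 m hm e0 e1
  have e3 := h3 m hm e0 e1 e2
  have e4 := h4 m hm e0 e1 e2 e3
  have e5 := h5 m hm e0 e1 e2 e3 e4
  have e6 := h6 m hm e0 e1 e2 e3 e4 e5
  have e7 : m = genZ q m.t := by ext <;> simp [genZ_apply, *]
  rw [e7, hf m.t (e7 ▸ hm), map_zero]

theorem eq_genZ_of_central (hq : q.ep ≠ 0 ∨ q.ze ≠ 0) {m : Model p q}
    (h : ∀ n : Model p q, ⁅m, n⁆ = 0) : m = genZ q m.t := by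
  obtain ⟨c, hc⟩ := exists_ne_zero hq
  have hx : m.x = 0 := by simpa using congr_arg y6 (h ⟨0, 0, 0, 0, 0, 1, 0, 0⟩)
  have hA := h ⟨1, c, 0, 0, 0, 0, 0, 0⟩
  have h1 : m.y1 = 0 := by simpa [hx] using congr_arg y2 hA
  have h2 : m.y2 = 0 := by simpa [hx] using congr_arg y3 hA
  have h3 : m.y3 = 0 := by simpa [hx] using congr_arg y4 hA
  have h4 : m.y4 = 0 := by simpa [hx] using congr_arg y5 hA
  have h5 : m.y5 = 0 := by simpa [hx] using congr_arg y6 hA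
  have h6 : (q.ep + c * q.ze) * m.y6 = 0 := by
    have := congr_arg t hA
    simp [hx, h1, h2, h3, h4, h5] at this
    linear_combination this
  have h6' := (mul_eq_zero.1 h6).resolve_left hc
  ext <;> simp [genZ_apply, *]

end Model

/-- Two tuples of structure constants are related by a change of generators. -/
def Param.Rel (q q' : Param p) : Prop :=
  ∃ k l n m s r : ZMod p, k ≠ 0 ∧ l ≠ 0 ∧ n ≠ 0 ∧
    q'.al = k * l * (n ^ 2 * q.al + s * q.be + r * q.ze) ∧
    q'.be = k * l ^ 3 * (n ^ 2 * q.be + s * q.ze) ∧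
    q'.ga = k * (l * q.ga + m * q.de) ∧
    q'.de = k * n * q.de ∧
    q'.ep = k * l ^ 5 * n * (l * q.ep + m * q.ze) ∧
    q'.ze = k * l ^ 5 * n ^ 2 * q.ze

theorem Param.Rel.of_equiv {q q' : Param p} (hq : q.ep ≠ 0 ∨ q.ze ≠ 0)
    (hq' : q'.ep ≠ 0 ∨ q'.ze ≠ 0) (e : Model p q' ≃ₗ⁅ℤ⁆ Model p q) : q.Rel q' := by
  have H := (Model.satisfiesRel (q := q')).map e
  set a := e (Model.genA q')
  set b := e (Model.genB q')
  set Z := (e : Model p q' →+ Model p q).comp (Model.genZ q') with hZdef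
  have hZinj (c : ZMod p) (h : Z c = 0) : c = 0 := by
    have h1 : e (Model.genZ q' c) = 0 := h
    have h2 : Model.genZ q' c = 0 := by simpa using h1
    exact congr_arg Model.t h2
  set k := (Z 1).t
  have hZ (c : ZMod p) : Z c = Model.genZ q (k * c) := by
    have h1 : Z 1 = Model.genZ q k := Model.eq_genZ_of_central hq (H.central 1)
    have h2 : c = c.val • (1 : ZMod p) := by simp
    rw [h2, map_nsmul, h1, ← map_nsmul]
    simp [mul_comm]
  have hk : k ≠ 0 := by
    intro h
    refine one_ne_zero (hZinj 1 ?_)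
    rw [hZ, h, zero_mul, map_zero]
  have hD : b.y1 * a.x - b.x * a.y1 ≠ 0 := by
    intro hD
    have h5 : adIter a b 5 = Model.genZ q (adIter a b 5).t := by
      have e1 : (adIter a b 1).y2 = 0 := by simpa [adIter] using hD
      have e2 : (adIter a b 2).y3 = 0 := by
        rw [adIter, Model.y3_lie, e1]; simp [adIter]
      have e3 : (adIter a b 3).y4 = 0 := by
        rw [adIter, Model.y4_lie, e2]; simp [adIter, -lie_lie, -lie_skew]
      have e4 : (adIter a b 4).y5 = 0 := by
        rw [adIter, Model.y5_lie, e3]; simp [adIter, -lie_lie, -lie_skew]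
      have e5 : (adIter a b 5).y6 = 0 := by
        rw [adIter, Model.y6_lie, e4]; simp [adIter, -lie_lie, -lie_skew]
      ext
      all_goals first
        | exact e5
        | rfl
        | simp [Model.genZ_apply, adIter, -lie_lie, -lie_skew]
    rcases hq' with h | h
    · refine h (hZinj _ ?_)
      rw [← H.ep, adIter, h5, Model.satisfiesRel.central]
    · refine h (hZinj _ ?_)
      rw [← H.ze, h5, Model.satisfiesRel.central]
  have hbx : b.x = 0 := by
    have h1 := congr_arg Model.y3 H.al
    rw [hZ] at h1
    simp [adIter, Model.genZ_apply, -lie_lie, -lie_skew] at h1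
    exact h1.resolve_left hD
  have hab : b.y1 ≠ 0 ∧ a.x ≠ 0 := by
    rw [hbx, zero_mul, sub_zero] at hD
    exact mul_ne_zero_iff.1 hD
  have hal := H.al
  have hbe := H.be
  have hga := H.ga
  have hde := H.de
  have hep := H.ep
  have hze := H.ze
  rw [Model.adIter_one_lie a b hbx, hZ, Model.genZ_inj] at hal
  rw [Model.adIter_three_lie a b hbx, hZ, Model.genZ_inj] at hbe
  rw [Model.adIter_five_lie a b hbx, hZ, Model.genZ_inj] at hze
  rw [Model.adIter_six a b hbx, hZ, Model.genZ_inj] at hep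
  rw [Model.prime_nsmul', hZ, Model.genZ_inj] at hga hde
  rw [hbx, mul_zero, zero_add] at hde
  refine ⟨k⁻¹, a.x, b.y1, a.y1, 2 * b.y1 * b.y3 - b.y2 ^ 2,
    2 * b.y1 * b.y5 - 2 * b.y2 * b.y4 + b.y3 ^ 2, inv_ne_zero hk, hab.2, hab.1, ?_, ?_, ?_, ?_, ?_,
    ?_⟩ <;> apply mul_left_cancel₀ hk
  · rw [← hal]; field_simp
  · rw [← hbe]; field_simp
  · rw [← hga]; field_simp
  · rw [← hde]; field_simp
  · rw [← hep]; field_simp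
  · rw [← hze]; field_simp

theorem Param.Rel.nonempty_equiv (h2 : (2 : ZMod p) ≠ 0) {q q' : Param p}
    (hq' : q'.ep ≠ 0 ∨ q'.ze ≠ 0) (h : q.Rel q') : Nonempty (Model p q' ≃ₗ⁅ℤ⁆ Model p q) := by
  obtain ⟨k, l, n, m, s, r, hk, hl, hn, hal, hbe, hga, hde, hep, hze⟩ := h
  let a : Model p q := ⟨l, m, 0, 0, 0, 0, 0, 0⟩
  let n3 := s / (2 * n)
  let n5 := (r - n3 ^ 2) / (2 * n)
  have hn3 : 2 * n * n3 = s := by simp only [n3]; field_simp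
  have hn5 : 2 * n * n5 + n3 ^ 2 = r := by simp only [n5]; field_simp; ring
  let b : Model p q := ⟨0, n, 0, n3, 0, n5, 0, 0⟩
  let Z : ZMod p →+ Model p q := (Model.genZ q).comp (AddMonoidHom.mulLeft k⁻¹)
  have hZ (c : ZMod p) : Z c = Model.genZ q (k⁻¹ * c) := rfl
  have H : SatisfiesRel q' a b Z :=
    { central := fun c x => Model.satisfiesRel.central _ _
      ga := by
        rw [Model.prime_nsmul', hZ, Model.genZ_inj, hga]; simp only [a]; field_simp
      de := by
        rw [Model.prime_nsmul', hZ, Model.genZ_inj, hde]; simp only [b]; field_simp; simp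
      al := by
        rw [Model.adIter_one_lie _ _ rfl, hZ, Model.genZ_inj, hal, ← hn5, ← hn3]
        simp only [a, b]; field_simp; ring
      be := by
        rw [Model.adIter_three_lie _ _ rfl, hZ, Model.genZ_inj, hbe, ← hn3]
        simp only [a, b]; field_simp; ring
      ep := by
        rw [Model.adIter_six _ _ rfl, hZ, Model.genZ_inj, hep]
        simp only [a, b]; field_simp
      ze := by
        rw [Model.adIter_five_lie _ _ rfl, hZ, Model.genZ_inj, hze]
        simp only [a, b]; field_simp }
  have hinj : Function.Injective H.hom := by
    refine Model.injective_of_genZ hq' _ fun c hc => ?_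
    have h3 : Z c = 0 := by
      rw [← hc]; simp [SatisfiesRel.eval, Model.genZ_apply]
    rw [hZ] at h3
    have := congr_arg Model.t h3
    simpa [Model.genZ_apply, hk] using this
  exact ⟨LieEquiv.ofBijective H.hom
    (hinj.bijective_of_nat_card_le (by rw [Model.card_eq, Model.card_eq]))⟩

end

/-- The group of units modulo `n`-th powers. -/
abbrev PowClass (p n : ℕ) [Fact p.Prime] : Type :=
  (ZMod p)ˣ ⧸ (powMonoidHom n : (ZMod p)ˣ →* (ZMod p)ˣ).range

section
variable {p : ℕ} [Fact p.Prime]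

theorem card_powClass {n : ℕ} : Nat.card (PowClass p n) = (p - 1).gcd n := by
  have h := IsCyclic.index_powMonoidHom_range (G := (ZMod p)ˣ) n
  rw [Nat.card_eq_fintype_card, ZMod.card_units] at h
  exact h

open Classical in
/-- The class of an element modulo `n`-th powers (with a default value for zero). -/
noncomputable def powClass (n : ℕ) (x : ZMod p) : PowClass p n :=
  if h : x = 0 then 1 else (Units.mk0 x h : (ZMod p)ˣ)

theorem powClass_eq_iff {n : ℕ} {x y : ZMod p} (hx : x ≠ 0) (hy : y ≠ 0) :
    powClass n x = powClass n y ↔ ∃ t, t ≠ 0 ∧ y = t ^ n * x := by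
  rw [powClass, powClass, dif_neg hx, dif_neg hy, QuotientGroup.eq]
  constructor
  · rintro ⟨t, ht⟩
    refine ⟨t, t.ne_zero, ?_⟩
    have := congr_arg Units.val (eq_inv_mul_iff_mul_eq.1 ht)
    simp only [Units.val_mul, Units.val_mk0, powMonoidHom_apply, Units.val_pow_eq_pow_val] at this
    rw [← this, mul_comm]
  · rintro ⟨t, ht, rfl⟩
    refine ⟨Units.mk0 t ht, ?_⟩
    rw [eq_inv_mul_iff_mul_eq]
    ext
    simp [mul_comm]

theorem exists_powClass_eq {n : ℕ} (c : PowClass p n) : ∃ x, x ≠ 0 ∧ powClass n x = c := by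
  obtain ⟨u, rfl⟩ := QuotientGroup.mk_surjective c
  exact ⟨u, u.ne_zero, by simp [powClass]⟩

variable (p) in
/-- The set of values of a complete invariant of descendants. -/
abbrev InvType : Type :=
  Fin 6 ⊕ PowClass p 2 ⊕ Fin 4 × PowClass p 6 ⊕ PowClass p 10 ⊕ PowClass p 8

theorem card_invType (h2 : p ≠ 2) :
    Nat.card (InvType p) = 8 + 8 * (p - 1).gcd 3 + 2 * (p - 1).gcd 5 + (p - 1).gcd 8 := by
  have hp : p.Prime := Fact.out
  obtain ⟨m, hm⟩ : ∃ m, p - 1 = 2 * m := (hp.even_sub_one h2).two_dvd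
  have key (d : ℕ) (hd : Nat.Coprime 2 d) : (p - 1).gcd (2 * d) = 2 * (p - 1).gcd d := by
    rw [hm, Nat.gcd_mul_left, Nat.Coprime.gcd_mul_left_cancel m hd]
  simp only [Nat.card_sum, Nat.card_prod, Nat.card_fin, card_powClass]
  rw [show (6 : ℕ) = 2 * 3 from rfl, show (10 : ℕ) = 2 * 5 from rfl, key 3 (by norm_num),
    key 5 (by norm_num), hm, Nat.gcd_mul_right_left]
  ring

namespace Param

/-- The combination of structure constants which is scaled by every change of generators. -/
def disc (q : Param p) : ZMod p := q.ga * q.ze - q.ep * q.de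

open Classical in
/-- A complete invariant of the relation `Param.Rel`. -/
noncomputable def invariant (q : Param p) : InvType p :=
  if q.ze ≠ 0 then
    if q.de = 0 then
      if q.disc = 0 then .inl 0 else .inr (.inl (powClass 2 q.disc))
    else
      if q.disc = 0 then .inl 1 else .inr (.inr (.inl (0, powClass 6 (q.disc / q.de ^ 2))))
  else if q.de ≠ 0 then
    if q.be ≠ 0 then .inr (.inr (.inl (1, powClass 6 (q.de / q.ep))))
    else if q.al ≠ 0 then .inr (.inr (.inl (2, powClass 6 (q.de / q.ep))))
    else .inr (.inr (.inl (3, powClass 6 (q.de / q.ep))))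
  else if q.ga ≠ 0 then
    if q.be ≠ 0 then .inr (.inr (.inr (.inr (powClass 8 (q.be * q.ga / q.ep ^ 2)))))
    else if q.al ≠ 0 then .inr (.inr (.inr (.inl (powClass 10 (q.al * q.ga / q.ep ^ 2)))))
    else .inl 4
  else
    if q.be ≠ 0 then .inl 2 else if q.al ≠ 0 then .inl 3 else .inl 5

theorem exists_invariant_eq (c : InvType p) :
    ∃ q : Param p, (q.ep ≠ 0 ∨ q.ze ≠ 0) ∧ q.invariant = c := by
  rcases c with c | c | ⟨i, c⟩ | c | c
  · fin_cases c
    · exact ⟨⟨0, 0, 0, 0, 0, 1⟩, by simp [invariant, disc]⟩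
    · exact ⟨⟨0, 0, 0, 1, 0, 1⟩, by simp [invariant, disc]⟩
    · exact ⟨⟨0, 1, 0, 0, 1, 0⟩, by simp [invariant]⟩
    · exact ⟨⟨1, 0, 0, 0, 1, 0⟩, by simp [invariant]⟩
    · exact ⟨⟨0, 0, 1, 0, 1, 0⟩, by simp [invariant]⟩
    · exact ⟨⟨0, 0, 0, 0, 1, 0⟩, by simp [invariant]⟩
  all_goals obtain ⟨x, hx, rfl⟩ := exists_powClass_eq c
  · exact ⟨⟨0, 0, x, 0, 0, 1⟩, by simp [invariant, disc, hx]⟩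
  · fin_cases i
    · exact ⟨⟨0, 0, x, 1, 0, 1⟩, by simp [invariant, disc, hx]⟩
    · exact ⟨⟨0, 1, 0, x, 1, 0⟩, by simp [invariant, hx]⟩
    · exact ⟨⟨1, 0, 0, x, 1, 0⟩, by simp [invariant, hx]⟩
    · exact ⟨⟨0, 0, 0, x, 1, 0⟩, by simp [invariant, hx]⟩
  · exact ⟨⟨1, 0, x, 0, 1, 0⟩, by simp [invariant, hx]⟩
  · exact ⟨⟨0, 1, x, 0, 1, 0⟩, by simp [invariant, hx]⟩

variable {q q' : Param p}

theorem Rel.invariant_eq (hq : q.ep ≠ 0 ∨ q.ze ≠ 0) (hq' : q'.ep ≠ 0 ∨ q'.ze ≠ 0) (h : q.Rel q') :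
    q.invariant = q'.invariant := by
  obtain ⟨k, l, n, m, s, r, hk, hl, hn, hal, hbe, hga, hde, hep, hze⟩ := h
  have hD : q'.disc = k ^ 2 * l ^ 6 * n ^ 2 * q.disc := by
    rw [disc, disc, hga, hze, hep, hde]; ring
  have zde : q'.de = 0 ↔ q.de = 0 := by simp [hde, hk, hn]
  have zD : q'.disc = 0 ↔ q.disc = 0 := by simp [hD, hk, hl, hn]
  have zze : q'.ze = 0 ↔ q.ze = 0 := by simp [hze, hk, hl, hn]
  by_cases ze : q.ze = 0
  · have ze' := zze.2 ze
    have ep : q.ep ≠ 0 := hq.resolve_right (by simp [ze])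
    have ep' : q'.ep ≠ 0 := hq'.resolve_right (by simp [ze'])
    simp only [ze, mul_zero, add_zero] at hal hbe hep
    have zbe : q'.be = 0 ↔ q.be = 0 := by simp [hbe, hk, hl, hn]
    by_cases be : q.be = 0
    · have zal : q'.al = 0 ↔ q.al = 0 := by simp [hal, hk, hl, hn, be]
      have be' := zbe.2 be
      by_cases de : q.de = 0
      · have de' := zde.2 de
        have zga : q'.ga = 0 ↔ q.ga = 0 := by simp [hga, hk, hl, de]
        by_cases ga : q.ga = 0
        · simp [invariant, ze, ze', be, be', de, de', ga, zga.2 ga, zal]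
        by_cases al : q.al = 0
        · simp [invariant, ze, ze', be, be', de, de', ga, zga, al, zal]
        have ga' := zga.not.2 ga
        have al' := zal.not.2 al
        have key : powClass 10 (q.al * q.ga / q.ep ^ 2) =
            powClass 10 (q'.al * q'.ga / q'.ep ^ 2) := by
          rw [powClass_eq_iff (div_ne_zero (mul_ne_zero al ga) (pow_ne_zero 2 ep))
            (div_ne_zero (mul_ne_zero al' ga') (pow_ne_zero 2 ep'))]
          refine ⟨l⁻¹, inv_ne_zero hl, ?_⟩
          rw [hal, hga, hep, de, be]; field_simp; ring
        simp [invariant, ze, ze', be, be', de, de', ga, ga', al, al', key]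
      · have de' := zde.not.2 de
        have key : powClass 6 (q.de / q.ep) = powClass 6 (q'.de / q'.ep) := by
          rw [powClass_eq_iff (div_ne_zero de ep) (div_ne_zero de' ep')]
          refine ⟨l⁻¹, inv_ne_zero hl, ?_⟩
          rw [hde, hep]; field_simp
        simp [invariant, ze, ze', be, be', de, de', zal, key]
    have be' := zbe.not.2 be
    by_cases de : q.de = 0
    · have de' := zde.2 de
      have zga : q'.ga = 0 ↔ q.ga = 0 := by simp [hga, hk, hl, de]
      by_cases ga : q.ga = 0
      · simp [invariant, ze, ze', be, be', de, de', ga, zga.2 ga]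
      have ga' := zga.not.2 ga
      have key : powClass 8 (q.be * q.ga / q.ep ^ 2) = powClass 8 (q'.be * q'.ga / q'.ep ^ 2) := by
        rw [powClass_eq_iff (div_ne_zero (mul_ne_zero be ga) (pow_ne_zero 2 ep))
          (div_ne_zero (mul_ne_zero be' ga') (pow_ne_zero 2 ep'))]
        refine ⟨l⁻¹, inv_ne_zero hl, ?_⟩
        rw [hbe, hga, hep, de]; field_simp; simp
      simp [invariant, ze, ze', be, be', de, de', ga, ga', key]
    · have de' := zde.not.2 de
      have key : powClass 6 (q.de / q.ep) = powClass 6 (q'.de / q'.ep) := by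
        rw [powClass_eq_iff (div_ne_zero de ep) (div_ne_zero de' ep')]
        refine ⟨l⁻¹, inv_ne_zero hl, ?_⟩
        rw [hde, hep]; field_simp
      simp [invariant, ze, ze', be, be', de, de', key]
  · have ze' := zze.not.2 ze
    by_cases D : q.disc = 0
    · simp [invariant, ze, ze', D, zD.2 D, zde]
    have D' := zD.not.2 D
    by_cases de : q.de = 0
    · have key : powClass 2 q.disc = powClass 2 q'.disc := by
        rw [powClass_eq_iff D D']
        exact ⟨k * l ^ 3 * n, by simp [hk, hl, hn], by rw [hD]; ring⟩
      simp [invariant, ze, ze', D, D', de, zde.2 de, key]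
    · have de' := zde.not.2 de
      have key : powClass 6 (q.disc / q.de ^ 2) = powClass 6 (q'.disc / q'.de ^ 2) := by
        rw [powClass_eq_iff (div_ne_zero D (pow_ne_zero 2 de)) (div_ne_zero D' (pow_ne_zero 2 de'))]
        refine ⟨l, hl, ?_⟩
        rw [hD, hde]; field_simp
      simp [invariant, ze, ze', D, D', de, de', key]

theorem Rel.of_ze_ne_zero (ze : q.ze ≠ 0) (ze' : q'.ze ≠ 0) {k l n : ZMod p} (hk : k ≠ 0)
    (hl : l ≠ 0) (hn : n ≠ 0) (hde : q'.de = k * n * q.de) (hze : q'.ze = k * l ^ 5 * n ^ 2 * q.ze)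
    (hD : q'.disc = k ^ 2 * l ^ 6 * n ^ 2 * q.disc) : q.Rel q' := by
  obtain ⟨m, hm⟩ : ∃ m, q'.ep = k * l ^ 5 * n * (l * q.ep + m * q.ze) :=
    ⟨(q'.ep / (k * l ^ 5 * n) - l * q.ep) / q.ze, by field_simp; ring⟩
  obtain ⟨s, hs⟩ : ∃ s, q'.be = k * l ^ 3 * (n ^ 2 * q.be + s * q.ze) :=
    ⟨(q'.be / (k * l ^ 3) - n ^ 2 * q.be) / q.ze, by field_simp; ring⟩
  obtain ⟨r, hr⟩ : ∃ r, q'.al = k * l * (n ^ 2 * q.al + s * q.be + r * q.ze) :=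
    ⟨(q'.al / (k * l) - n ^ 2 * q.al - s * q.be) / q.ze, by field_simp; ring⟩
  refine ⟨k, l, n, m, s, r, hk, hl, hn, hr, hs, ?_, hde, hm, hze⟩
  apply mul_right_cancel₀ ze'
  rw [disc, disc, hm, hde] at hD
  rw [eq_add_of_sub_eq hD, hze]
  ring

theorem Rel.of_ze_eq_zero (ze : q.ze = 0) (ze' : q'.ze = 0) {c l n : ZMod p} (hc : c ≠ 0)
    (hl : l ≠ 0) (hn : n ≠ 0) (hde : q'.de = c * q.de) (hep : q'.ep = c * l ^ 6 * q.ep)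
    (hbe : q'.be = c * l ^ 3 * n * q.be) (hal : q.be ≠ 0 ∨ q'.al = c * l * n * q.al)
    (hga : q.de ≠ 0 ∨ n * q'.ga = c * l * q.ga) : q.Rel q' := by
  obtain ⟨m, hm⟩ : ∃ m, n * q'.ga = c * (l * q.ga + m * q.de) := by
    rcases hga with h | h
    · exact ⟨(n * q'.ga / c - l * q.ga) / q.de, by field_simp; ring⟩
    · exact ⟨0, by rw [h]; ring⟩
  obtain ⟨s, hs⟩ : ∃ s, n * q'.al = c * l * (n ^ 2 * q.al + s * q.be) := by
    rcases hal with h | h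
    · exact ⟨(n * q'.al / (c * l) - n ^ 2 * q.al) / q.be, by field_simp; ring⟩
    · exact ⟨0, by rw [h]; ring⟩
  refine ⟨c / n, l, n, m, s, 0, div_ne_zero hc hn, hl, hn, ?_, ?_, ?_, ?_, ?_, ?_⟩
  · apply mul_left_cancel₀ hn
    rw [hs]; field_simp; ring
  · rw [hbe, ze]; field_simp; ring
  · apply mul_left_cancel₀ hn
    rw [hm]; field_simp
  · rw [hde]; field_simp
  · rw [hep, ze]; field_simp; ring
  · rw [ze, ze']; ring

theorem exists_sixth_of_powClass_eq {x y x' y' : ZMod p} (hx : x ≠ 0) (hy : y ≠ 0) (hx' : x' ≠ 0)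
    (hy' : y' ≠ 0) (h : powClass 6 (x / y) = powClass 6 (x' / y')) :
    ∃ l, l ≠ 0 ∧ y' = x' / x * l ^ 6 * y := by
  obtain ⟨t, ht, e⟩ := (powClass_eq_iff (div_ne_zero hx hy) (div_ne_zero hx' hy')).1 h
  refine ⟨t⁻¹, inv_ne_zero ht, ?_⟩
  field_simp at e ⊢
  linear_combination -e

set_option maxHeartbeats 2000000 in
theorem rel_of_invariant_eq (hq : q.ep ≠ 0 ∨ q.ze ≠ 0) (hq' : q'.ep ≠ 0 ∨ q'.ze ≠ 0)
    (h : q.invariant = q'.invariant) : q.Rel q' := by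
  unfold invariant at h
  split_ifs at h
  all_goals simp only [reduceCtorEq, Sum.inl.injEq, Sum.inr.injEq, Prod.mk.injEq, Fin.reduceEq,
    false_and, true_and] at h
  all_goals simp only [ne_eq, not_not] at *
  · rename_i ze de D ze' de' D'
    have ga : q.ga = 0 := by simpa [disc, de, ze] using D
    refine Rel.of_ze_ne_zero ze ze' (k := q'.ze / q.ze) (l := 1) (n := 1) ?_ ?_ ?_ ?_ ?_ ?_ <;>
      simp [*]
  · rename_i ze de D ze' de' D'
    obtain ⟨t, ht, e⟩ := (powClass_eq_iff D D').1 h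
    have ga : q.ga ≠ 0 := by rintro ga; simp [disc, ga, de] at D
    have ga' : q'.ga ≠ 0 := by rintro ga; simp [disc, ga, de'] at D'
    refine Rel.of_ze_ne_zero ze ze' (k := q'.ga / q.ga) (l := 1) (n := t * (q.ga / q'.ga))
      (div_ne_zero ga' ga) one_ne_zero (mul_ne_zero ht (div_ne_zero ga ga')) ?_ ?_ ?_
    · simp [de, de']
    · simp only [disc, de, de'] at e
      field_simp
      linear_combination e
    · rw [e]; field_simp
  · rename_i ze de D ze' de' D'
    refine Rel.of_ze_ne_zero ze ze' (k := (q'.de / q.de) ^ 2 * (q.ze / q'.ze)) (l := 1)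
      (n := q'.ze / q.ze * (q.de / q'.de)) (by simp [*]) one_ne_zero (by simp [*]) ?_ ?_ ?_
    · field_simp
    · field_simp
    · simp [D, D']
  · rename_i ze de D ze' de' D'
    obtain ⟨l, hl, e⟩ := (powClass_eq_iff (div_ne_zero D (pow_ne_zero 2 de))
      (div_ne_zero D' (pow_ne_zero 2 de'))).1 h
    refine Rel.of_ze_ne_zero ze ze' (k := (q'.de / q.de) ^ 2 * (q.ze / q'.ze) * l ^ 5) (l := l)
      (n := q'.ze / q.ze * (q.de / q'.de) / l ^ 5) (by simp [*]) hl (by simp [*]) ?_ ?_ ?_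
    · field_simp
    · field_simp
    · field_simp at e ⊢
      linear_combination e
  · rename_i de be de' be' ze ze'
    have ep : q.ep ≠ 0 := hq.resolve_right (not_not.2 ze)
    have ep' : q'.ep ≠ 0 := hq'.resolve_right (not_not.2 ze')
    obtain ⟨l, hl, e⟩ := exists_sixth_of_powClass_eq de ep de' ep' h
    refine Rel.of_ze_eq_zero ze ze' (c := q'.de / q.de) (l := l)
      (n := q'.be / (q'.de / q.de * l ^ 3 * q.be)) (by simp [*]) hl (by simp [*])
      (by field_simp) e (by field_simp) (.inl be) (.inl de)
  · rename_i de al de' al' ze be ze' be'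
    have ep : q.ep ≠ 0 := hq.resolve_right (not_not.2 ze)
    have ep' : q'.ep ≠ 0 := hq'.resolve_right (not_not.2 ze')
    obtain ⟨l, hl, e⟩ := exists_sixth_of_powClass_eq de ep de' ep' h
    refine Rel.of_ze_eq_zero ze ze' (c := q'.de / q.de) (l := l)
      (n := q'.al / (q'.de / q.de * l * q.al)) (by simp [*]) hl (by simp [*])
      (by field_simp) e (by simp [be, be']) (.inr (by field_simp)) (.inl de)
  · rename_i de de' ze be al ze' be' al'
    have ep : q.ep ≠ 0 := hq.resolve_right (not_not.2 ze)
    have ep' : q'.ep ≠ 0 := hq'.resolve_right (not_not.2 ze')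
    obtain ⟨l, hl, e⟩ := exists_sixth_of_powClass_eq de ep de' ep' h
    refine Rel.of_ze_eq_zero ze ze' (c := q'.de / q.de) (l := l)
      (n := 1) (by simp [*]) hl one_ne_zero
      (by field_simp) e (by simp [be, be']) (.inr (by simp [al, al'])) (.inl de)
  · rename_i ga be ga' be' ze de ze' de'
    have ep : q.ep ≠ 0 := hq.resolve_right (not_not.2 ze)
    have ep' : q'.ep ≠ 0 := hq'.resolve_right (not_not.2 ze')
    obtain ⟨t, ht, e⟩ := (powClass_eq_iff (div_ne_zero (mul_ne_zero be ga) (pow_ne_zero 2 ep))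
      (div_ne_zero (mul_ne_zero be' ga') (pow_ne_zero 2 ep'))).1 h
    refine Rel.of_ze_eq_zero ze ze' (c := q'.ep * t ^ 6 / q.ep) (l := t⁻¹)
      (n := q'.be / (q'.ep * t ^ 3 / q.ep * q.be)) (by simp [*]) (inv_ne_zero ht) (by simp [*])
      (by simp [de, de']) (by field_simp) (by field_simp) (.inl be) (.inr ?_)
    field_simp at e ⊢
    linear_combination e
  · rename_i ga al ga' al' ze de be ze' de' be'
    have ep : q.ep ≠ 0 := hq.resolve_right (not_not.2 ze)
    have ep' : q'.ep ≠ 0 := hq'.resolve_right (not_not.2 ze')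
    obtain ⟨t, ht, e⟩ := (powClass_eq_iff (div_ne_zero (mul_ne_zero al ga) (pow_ne_zero 2 ep))
      (div_ne_zero (mul_ne_zero al' ga') (pow_ne_zero 2 ep'))).1 h
    refine Rel.of_ze_eq_zero ze ze' (c := q'.ep * t ^ 6 / q.ep) (l := t⁻¹)
      (n := q'.al / (q'.ep * t ^ 5 / q.ep * q.al)) (by simp [*]) (inv_ne_zero ht) (by simp [*])
      (by simp [de, de']) (by field_simp) (by simp [be, be']) (.inr (by field_simp)) (.inr ?_)
    field_simp at e ⊢
    linear_combination e
  · rename_i ga ga' ze de be al ze' de' be' al'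
    have ep : q.ep ≠ 0 := hq.resolve_right (not_not.2 ze)
    have ep' : q'.ep ≠ 0 := hq'.resolve_right (not_not.2 ze')
    exact Rel.of_ze_eq_zero ze ze' (c := q'.ep / q.ep) (l := 1)
      (n := q'.ep / q.ep * q.ga / q'.ga) (by simp [*]) one_ne_zero (by simp [*])
      (by simp [de, de']) (by field_simp) (by simp [be, be']) (.inr (by simp [al, al']))
      (.inr (by field_simp))
  · rename_i be be' ze de ga ze' de' ga'
    have ep : q.ep ≠ 0 := hq.resolve_right (not_not.2 ze)
    have ep' : q'.ep ≠ 0 := hq'.resolve_right (not_not.2 ze')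
    exact Rel.of_ze_eq_zero ze ze' (c := q'.ep / q.ep) (l := 1)
      (n := q'.be / (q'.ep / q.ep * q.be)) (by simp [*]) one_ne_zero (by simp [*])
      (by simp [de, de']) (by field_simp) (by field_simp) (.inl be) (.inr (by simp [ga, ga']))
  · rename_i al al' ze de ga be ze' de' ga' be'
    have ep : q.ep ≠ 0 := hq.resolve_right (not_not.2 ze)
    have ep' : q'.ep ≠ 0 := hq'.resolve_right (not_not.2 ze')
    exact Rel.of_ze_eq_zero ze ze' (c := q'.ep / q.ep) (l := 1)
      (n := q'.al / (q'.ep / q.ep * q.al)) (by simp [*]) one_ne_zero (by simp [*])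
      (by simp [de, de']) (by field_simp) (by simp [be, be']) (.inr (by field_simp))
      (.inr (by simp [ga, ga']))
  · rename_i ze de ga be al ze' de' ga' be' al'
    have ep : q.ep ≠ 0 := hq.resolve_right (not_not.2 ze)
    have ep' : q'.ep ≠ 0 := hq'.resolve_right (not_not.2 ze')
    exact Rel.of_ze_eq_zero ze ze' (c := q'.ep / q.ep) (l := 1) (n := 1) (by simp [*])
      one_ne_zero one_ne_zero (by simp [de, de']) (by field_simp) (by simp [be, be'])
      (.inr (by simp [al, al'])) (.inr (by simp [ga, ga']))

end Param
end

section
variable {p : ℕ} [Fact p.Prime]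

/-- Transport of a Lie ring structure along a bijection. -/
abbrev transportLieRing {α β : Type*} (e : α ≃ β) [LieRing β] : LieRing α :=
  { e.addCommGroup with
    bracket := fun x y => e.symm ⁅e x, e y⁆
    add_lie := fun x y z => by
      change e.symm ⁅e (e.symm (e x + e y)), e z⁆ =
        e.symm (e (e.symm ⁅e x, e z⁆) + e (e.symm ⁅e y, e z⁆))
      simp
    lie_add := fun x y z => by
      change e.symm ⁅e x, e (e.symm (e y + e z))⁆ =
        e.symm (e (e.symm ⁅e x, e y⁆) + e (e.symm ⁅e x, e z⁆))
      simp
    lie_self := fun x => by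
      change e.symm ⁅e x, e x⁆ = e.symm 0
      simp
    leibniz_lie := fun x y z => by
      change e.symm ⁅e x, e (e.symm ⁅e y, e z⁆)⁆ =
        e.symm (e (e.symm ⁅e (e.symm ⁅e x, e y⁆), e z⁆) + e (e.symm ⁅e y, e (e.symm ⁅e x, e z⁆)⁆))
      simp }

theorem exists_lieRing_equiv {α β : Type*} (e : α ≃ β) [LieRing β] :
    ∃ _ : LieRing α, Nonempty (α ≃ₗ⁅ℤ⁆ β) := by
  let _ := transportLieRing e
  exact ⟨inferInstance, isLieIso_iff.1 ⟨e, fun x y => e.apply_symm_apply _,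
    fun x y => e.apply_symm_apply _⟩⟩

theorem card_quot_eq {X T : Type*} {r : X → X → Prop} (f : X → T) (hf : Function.Surjective f)
    (h : ∀ x y, r x y ↔ f x = f y) : Nat.card (Quot r) = Nat.card T := by
  refine Nat.card_eq_of_bijective (Quot.lift f fun x y hxy => (h x y).1 hxy) ⟨?_, ?_⟩
  · rintro ⟨x⟩ ⟨y⟩ hxy
    exact Quot.sound ((h x y).2 hxy)
  · intro t
    obtain ⟨x, rfl⟩ := hf t
    exact ⟨Quot.mk _ x, rfl⟩

theorem isLieIso_iff_invariant_eq (h2 : (2 : ZMod p) ≠ 0) {q q' : Param p}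
    (hq : q.ep ≠ 0 ∨ q.ze ≠ 0) (hq' : q'.ep ≠ 0 ∨ q'.ze ≠ 0) {L L' : Type*} [LieRing L]
    [LieRing L'] (e : L ≃ₗ⁅ℤ⁆ Model p q) (e' : L' ≃ₗ⁅ℤ⁆ Model p q') :
    IsLieIso L L' ↔ q.invariant = q'.invariant := by
  rw [isLieIso_iff]
  constructor
  · rintro ⟨f⟩
    exact (Param.Rel.of_equiv hq hq' ((e'.symm.trans f.symm).trans e)).invariant_eq hq hq'
  · intro h
    obtain ⟨f⟩ := (Param.rel_of_invariant_eq hq hq' h).nonempty_equiv h2 hq'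
    exact ⟨(e.trans f.symm).trans e'.symm⟩

end

/-- The Lie ring 7.623 : `⟨a,b | [b,a,b], [b,a,a,a,b], pa, pb, class 6⟩` has
`8 + 8gcd(p-1,3) + 2gcd(p-1,5) + gcd(p-1,8)` descendants of order `p^8`
(of maximal class 7). -/
theorem descendants_of_7_623 (p : ℕ) (hp : p.Prime) (h5 : 5 ≤ p) :
    Nat.card (Quot (fun s t :
        {s : LieRing (Fin (p ^ 8)) // IsMaxClassDescendantOf p (presLie p {bab, ba3b}) s} =>
      @IsLieIso _ _ s.1 t.1)) =
    8 + 8 * Nat.gcd (p - 1) 3 + 2 * Nat.gcd (p - 1) 5 + Nat.gcd (p - 1) 8 := by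
  have : Fact p.Prime := ⟨hp⟩
  have h2 : (2 : ZMod p) ≠ 0 := by
    have h := (ZMod.natCast_eq_zero_iff 2 p).not.2 (Nat.not_dvd_of_pos_of_lt two_pos (by omega))
    exact_mod_cast h
  choose q hq e using fun s : {s : LieRing (Fin (p ^ 8)) //
      IsMaxClassDescendantOf p (presLie p {bab, ba3b}) s} =>
    @exists_equiv_model p _ (Fin (p ^ 8)) s.1 ((isMaxClassDescendantOf_iff p s.1).1 s.2)
      (Nat.card_fin _)
  have key (s t) : @IsLieIso _ _ s.1 t.1 ↔ (q s).invariant = (q t).invariant := by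
    exact @isLieIso_iff_invariant_eq p _ h2 _ _ (hq s) (hq t) _ _ s.1 t.1 (e s).some (e t).some
  rw [card_quot_eq (fun s => (q s).invariant) ?_ key, card_invType (by omega)]
  intro c
  obtain ⟨q₀, hq₀, rfl⟩ := Param.exists_invariant_eq c
  have : Finite (Model p q₀) :=
    Nat.finite_of_card_ne_zero (by rw [Model.card_eq]; exact pow_ne_zero 8 hp.ne_zero)
  obtain ⟨s, ⟨f⟩⟩ := exists_lieRing_equiv
    (Finite.equivFinOfCardEq (Model.card_eq (p := p) (q := q₀))).symm
  let s' : {s : LieRing (Fin (p ^ 8)) // IsMaxClassDescendantOf p (presLie p {bab, ba3b}) s} :=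
    ⟨s, isDesc_of_equiv hq₀ f⟩
  refine ⟨s', ?_⟩
  exact (@isLieIso_iff_invariant_eq p _ h2 _ _ (hq s') hq₀ _ _ s s (e s').some f).1
    (isLieIso_iff.2 ⟨LieEquiv.refl⟩)
end
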